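/- Let Ω ⊂ ℝ² be a bounded, open, connected set with Lipschitz boundary and let u ∈ W^{1,1}(Ω;S¹). Then for every ε > 0 there exist u_ε ∈ W^{1,1}(Ω;S¹), n_ε ∈ ℕ and points x_1,…,x_{n_ε}, y_1,…,y_{n_ε} ∈ cl(Ω) such that: (i) ⟨Det(∇u_ε),φ⟩ = π Σ_{i=1}^{n_ε} (φ(x_i) − φ(y_i)) for all φ ∈ Lip₀(Ω), and the points among the x_i, y_i lying in Ω are distinct and three by three not collinear; (ii) there exist radii ρ_{x_i}, ρ_{y_i} ∈ (0,ε) such that the closed discs of these radii centered at the points x_i ∈ Ω, y_i ∈ Ω are contained in Ω and pairwise disjoint, u_ε(z) = (z − x_i)/|z − x_i| on B_{ρ_{x_i}}(x_i) whenever x_i ∈ Ω, and u_ε(z) = ι((z − y_i)/|z − y_i|) on B_{ρ_{y_i}}(y_i) whenever y_i ∈ Ω, where ι(w₁,w₂) := (w₁,−w₂); (iii) ‖u − u_ε‖_{W^{1,1}} + ‖Det(∇u) − Det(∇u_ε)‖_flat < ε. -/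

import Mathlib

open MeasureTheory Metric Filter Set
open scoped ENNReal NNReal Topology Classical

noncomputable section

abbrev R2 := EuclideanSpace ℝ (Fin 2)

/-- `Ω ⊂ ℝ²` has Lipschitz boundary: near every boundary point, after a rigid motion,
`Ω` coincides with the open region strictly above the graph of a Lipschitz function. -/
def HasLipschitzBoundary (Ω : Set R2) : Prop :=
  ∀ p ∈ frontier Ω, ∃ r : ℝ, 0 < r ∧ ∃ (f : R2 ≃ᵢ R2) (γ : ℝ → ℝ) (L : ℝ≥0),
    LipschitzWith L γ ∧ ∀ x ∈ Metric.ball p r, (x ∈ Ω ↔ γ (f x 0) < f x 1)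

/-- `G` is the weak (distributional) gradient of `u` on `Ω`:
`∫_Ω u_i ∂_j φ = -∫_Ω G_{ij} φ` for all test functions `φ ∈ C_c^∞(Ω)`. -/
def IsWeakGradient (Ω : Set R2) (u : R2 → R2) (G : R2 → Matrix (Fin 2) (Fin 2) ℝ) : Prop :=
  ∀ φ : R2 → ℝ, ContDiff ℝ (⊤ : ℕ∞) φ → HasCompactSupport φ → tsupport φ ⊆ Ω →
    ∀ i j : Fin 2,
      (∫ x in Ω, u x i * fderiv ℝ φ x (EuclideanSpace.single j 1)) =
        - ∫ x in Ω, G x i j * φ x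

/-- `u ∈ W^{1,1}(Ω;ℝ²)` with weak gradient `G`. -/
def MemW11 (Ω : Set R2) (u : R2 → R2) (G : R2 → Matrix (Fin 2) (Fin 2) ℝ) : Prop :=
  IntegrableOn u Ω ∧ (∀ i j : Fin 2, IntegrableOn (fun x => G x i j) Ω) ∧
    IsWeakGradient Ω u G

/-- `|u| = 1` a.e. in `Ω`. -/
def SphereValued (Ω : Set R2) (u : R2 → R2) : Prop :=
  ∀ᵐ x ∂(volume.restrict Ω), ‖u x‖ = 1

/-- Frobenius norm of a `2×2` matrix. -/
def frob (M : Matrix (Fin 2) (Fin 2) ℝ) : ℝ :=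
  Real.sqrt (∑ i, ∑ j, (M i j) ^ 2)

/-- Jacobian matrix of a map `v : ℝ² → ℝ²`. -/
def jacobianMatrix (v : R2 → R2) (x : R2) : Matrix (Fin 2) (Fin 2) ℝ :=
  Matrix.of fun i j => fderiv ℝ v x (EuclideanSpace.single j 1) i

/-- Classical graph area `A(v,A) = ∫_A √(1 + |∇v|² + (Jv)²)` of a `C¹` map. -/
def classicalArea (A : Set R2) (v : R2 → R2) : ℝ≥0∞ :=
  ∫⁻ x in A, ENNReal.ofReal
    (Real.sqrt (1 + (∑ i, ∑ j, (jacobianMatrix v x i j) ^ 2) + (jacobianMatrix v x).det ^ 2))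

/-- `L¹`-relaxed area functional `𝒜(u,A)`. -/
def relaxedArea (u : R2 → R2) (A : Set R2) : ℝ≥0∞ :=
  sInf { a : ℝ≥0∞ | ∃ v : ℕ → R2 → R2,
    (∀ k, ContDiffOn ℝ 1 (v k) A) ∧
    (∀ k, IntegrableOn (fun x => v k x - u x) A) ∧
    Tendsto (fun k => ∫ x in A, ‖v k x - u x‖) atTop (nhds 0) ∧
    a = Filter.liminf (fun k => classicalArea A (v k)) atTop }

/-- `λ_u = (1/2)(u₁ ∇^⊥u₂ − u₂ ∇^⊥u₁)`, computed from the weak gradient `G`. -/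
def lambdaVec (u : R2 → R2) (G : R2 → Matrix (Fin 2) (Fin 2) ℝ) (x : R2) : Fin 2 → ℝ :=
  ![ (1 / 2) * (-(u x 0) * G x 1 1 + u x 1 * G x 0 1),
     (1 / 2) * (u x 0 * G x 1 0 - u x 1 * G x 0 0) ]

/-- Distributional Jacobian pairing `⟨Det(∇u), φ⟩ = ∫_Ω λ_u · ∇φ`. -/
def detPairing (Ω : Set R2) (u : R2 → R2) (G : R2 → Matrix (Fin 2) (Fin 2) ℝ)
    (φ : R2 → ℝ) : ℝ :=
  ∫ x in Ω, ∑ j, lambdaVec u G x j * fderiv ℝ φ x (EuclideanSpace.single j 1)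

/-- `φ ∈ Lip₀(Ω)`: Lipschitz on `cl(Ω)` and vanishing on `∂Ω`. -/
def MemLip0 (Ω : Set R2) (φ : R2 → ℝ) : Prop :=
  (∃ L : ℝ≥0, LipschitzOnWith L φ (closure Ω)) ∧ ∀ p ∈ frontier Ω, φ p = 0

/-- Admissible test functions for the flat norm: Lipschitz constant `≤ L` on `cl(Ω)`,
vanishing on `Z`, and bounded by `1` on `cl(Ω)`. -/
def FlatAdmissible (Ω Z : Set R2) (L : ℝ≥0) (φ : R2 → ℝ) : Prop :=
  LipschitzOnWith L φ (closure Ω) ∧ (∀ p ∈ Z, φ p = 0) ∧ ∀ p ∈ closure Ω, |φ p| ≤ 1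

/-- Flat norm of a functional `F`, with vanishing condition on the set `Z`. -/
def flatNormOn (Ω Z : Set R2) (L : ℝ≥0) (F : (R2 → ℝ) → ℝ) : ℝ≥0∞ :=
  ⨆ φ ∈ {φ : R2 → ℝ | FlatAdmissible Ω Z L φ}, ENNReal.ofReal (F φ)

/-- Flat norm of a functional `F` on `Lip₀(Ω)`; `L = 2` gives `‖·‖_{flat,α}` (α = 1/2),
`L = 1` gives `‖·‖_flat`. -/
def flatNorm (Ω : Set R2) (L : ℝ≥0) (F : (R2 → ℝ) → ℝ) : ℝ≥0∞ :=
  flatNormOn Ω (frontier Ω) L F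

/-- `d̄_Ω(x,y) = min{|x−y|, dist(x,∂Ω) + dist(y,∂Ω)}`. -/
def dbar (Ω : Set R2) (x y : R2) : ℝ :=
  min (dist x y) (Metric.infDist x (frontier Ω) + Metric.infDist y (frontier Ω))

/-- Countably subadditive interior envelope `𝒜**(u,V)` (relative to `Ω`). -/
def envA (u : R2 → R2) (Ω V : Set R2) : ℝ≥0∞ :=
  sInf { a : ℝ≥0∞ | ∃ A : ℕ → Set R2,
    (∀ k, IsOpen (A k) ∧ A k ⊆ Ω) ∧ V ⊆ ⋃ k, A k ∧ a = ∑' k, relaxedArea u (A k) }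

/-- Property `(P_f)` for a finite family of pairs of points of `cl(Ω)`. -/
def SatisfiesPf (Ω : Set R2) {n : ℕ} (x y : Fin n → R2) : Prop :=
  (∀ k, (x k ∈ Ω ∧ y k ∈ frontier Ω ∧ dist (x k) (y k) = Metric.infDist (x k) (frontier Ω)) ∨
        (y k ∈ Ω ∧ x k ∈ frontier Ω ∧ dist (x k) (y k) = Metric.infDist (y k) (frontier Ω))) ∧
  ∀ i j, x i ∈ Ω → y j ∈ Ω → x i ≠ y j

/-- The points of the family `x, y` lying in `Ω` are distinct and three by three
not collinear. -/
def InteriorPointsGeneric (Ω : Set R2) {n : ℕ} (x y : Fin n → R2) : Prop :=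
  (∀ a b : Fin n ⊕ Fin n, Sum.elim x y a ∈ Ω → Sum.elim x y b ∈ Ω → a ≠ b →
    Sum.elim x y a ≠ Sum.elim x y b) ∧
  ∀ a b c : Fin n ⊕ Fin n, Sum.elim x y a ∈ Ω → Sum.elim x y b ∈ Ω → Sum.elim x y c ∈ Ω →
    a ≠ b → a ≠ c → b ≠ c →
    ¬ Collinear ℝ ({Sum.elim x y a, Sum.elim x y b, Sum.elim x y c} : Set R2)

/-- `ι(w₁,w₂) = (w₁,−w₂)`. -/
def conjPt (w : R2) : R2 := (WithLp.equiv 2 (Fin 2 → ℝ)).symm ![w 0, -(w 1)]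

/-- `u` is a (positive/negative) vortex around the points of the family lying in `Ω`:
the closed discs of radii `ρ` are contained in `Ω` and pairwise disjoint,
`u(z) = (z−x_i)/|z−x_i|` on `B_{ρ}(x_i)` and `u(z) = ι((z−y_j)/|z−y_j|)` on `B_{ρ}(y_j)`. -/
def VortexAt (Ω : Set R2) (u : R2 → R2) {n : ℕ} (x y : Fin n → R2)
    (ρ : Fin n ⊕ Fin n → ℝ) : Prop :=
  (∀ a, Sum.elim x y a ∈ Ω → Metric.closedBall (Sum.elim x y a) (ρ a) ⊆ Ω) ∧
  (∀ a b, a ≠ b → Sum.elim x y a ∈ Ω → Sum.elim x y b ∈ Ω →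
    Disjoint (Metric.closedBall (Sum.elim x y a) (ρ a))
      (Metric.closedBall (Sum.elim x y b) (ρ b))) ∧
  (∀ i, x i ∈ Ω → ∀ᵐ z ∂(volume.restrict (Metric.ball (x i) (ρ (Sum.inl i)))),
    u z = ‖z - x i‖⁻¹ • (z - x i)) ∧
  (∀ i, y i ∈ Ω → ∀ᵐ z ∂(volume.restrict (Metric.ball (y i) (ρ (Sum.inr i)))),
    u z = conjPt (‖z - y i‖⁻¹ • (z - y i)))

/-- The energy `E(I_P, I_D, τ)` of a partition `{I_Dᶜ, I_D}` of `I` and an injection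
`τ : I_D → I`. -/
def energy (Ω : Set R2) {n : ℕ} (x y : Fin n → R2) (ID : Finset (Fin n))
    (τ : Fin n → Fin n) : ℝ≥0∞ :=
  ((IDᶜ.filter fun k => x k ∈ Ω).card : ℝ≥0∞) +
  (((Finset.univ \ ID.image τ).filter fun j => y j ∈ Ω).card : ℝ≥0∞) +
  2 * ∑ k ∈ ID, μH[1] (segment ℝ (y (τ k)) (x k) ∩ Ω)

open MeasureTheory Metric Filter Set
open scoped ENNReal NNReal Topology Classical ContDiff Manifold
noncomputable section

lemma coord_le_norm (h : R2) (i : Fin 2) : |h i| ≤ ‖h‖ := by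
  have := PiLp.norm_apply_le h i
  simpa using this

lemma cone_cond (Ω : Set R2) (hΩl : HasLipschitzBoundary Ω) (p : R2) (hp : p ∈ frontier Ω) :
    ∃ (e : R2) (κ r : ℝ), ‖e‖ = 1 ∧ 0 < κ ∧ κ ≤ 1 ∧ 0 < r ∧ ∀ x ∈ Ω, x ∈ ball p r → ∀ t, 0 < t → t < r →
      ∀ y, dist y (x + t • e) ≤ κ * t → y ∈ Ω := by
  obtain ⟨r, hr, f, γ, L, hγ, hx⟩ := hΩl p hp
  set A := f.toRealAffineIsometryEquiv.linearIsometryEquiv with hA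
  have hfA : ∀ x y, f x - f y = A (x - y) := by
    intro x y
    have := f.toRealAffineIsometryEquiv.map_vsub x y
    simpa using this.symm
  set e : R2 := A.symm (EuclideanSpace.single 1 1) with he
  have hLnn : (0:ℝ) ≤ L := L.2
  refine ⟨e, 1 / (2 + L), r / 3, ?_, by positivity, ?_, by positivity, ?_⟩
  · rw [he, A.symm.norm_map]; simp
  · rw [div_le_one (by positivity)]; linarith
  intro x hxΩ hxp t ht htr y hy
  have hnorme : ‖e‖ = 1 := by rw [he, A.symm.norm_map]; simp
  have hκ1 : 1 / (2 + (L:ℝ)) * t ≤ t / 2 := by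
    rw [div_mul_eq_mul_div, one_mul]; apply div_le_div_of_nonneg_left ht.le (by norm_num); linarith
  have hyp : y ∈ ball p r := by
    rw [mem_ball] at hxp ⊢
    have h1 : dist (x + t • e) x = t := by
      rw [dist_eq_norm]; simp [norm_smul, hnorme, abs_of_pos ht]
    have := dist_triangle4 y (x + t • e) x p
    linarith
  have hxp' : x ∈ ball p r := ball_subset_ball (by linarith) hxp
  rw [hx y hyp]
  have h0 := (hx x hxp').1 hxΩ
  set h := A (y - (x + t • e)) with hh
  have hnh : ‖h‖ ≤ 1 / (2 + L) * t := by
    rw [hh, A.norm_map, ← dist_eq_norm]; exact hy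
  have hdiff : f y = f x + (t • EuclideanSpace.single 1 1 + h) := by
    have : f y - f x = t • EuclideanSpace.single 1 1 + h := by
      rw [hfA, hh]
      have : t • (EuclideanSpace.single 1 1 : R2) = A (t • e) := by simp [he]
      rw [this, ← map_add]; congr 1; abel
    rw [← this]; abel
  have e0 : f y 0 = f x 0 + h 0 := by rw [hdiff]; simp
  have e1 : f y 1 = f x 1 + (t + h 1) := by rw [hdiff]; simp
  have a0 := (coord_le_norm h 0).trans hnh
  have a1 := (coord_le_norm h 1).trans hnh
  have hg : γ (f y 0) ≤ γ (f x 0) + L * |h 0| := by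
    have := hγ.dist_le_mul (f y 0) (f x 0)
    rw [Real.dist_eq, Real.dist_eq, e0] at this
    have h2 := le_abs_self (γ (f x 0 + h 0) - γ (f x 0))
    rw [e0]
    have h3 : f x 0 + h 0 - f x 0 = h 0 := by ring
    rw [h3] at this
    linarith
  have h4 : (L:ℝ) * |h 0| ≤ L * (1 / (2 + L) * t) := by gcongr
  have h5 := neg_abs_le (h 1)
  have h6 : L * (1 / (2 + (L:ℝ)) * t) + 1 / (2 + L) * t < t := by
    have : L * (1 / (2 + (L:ℝ)) * t) + 1 / (2 + L) * t = ((1 + L) / (2 + L)) * t := by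
      field_simp; ring
    rw [this]
    have : (1 + (L:ℝ)) / (2 + L) < 1 := by rw [div_lt_one (by positivity)]; linarith
    nlinarith
  rw [e1]
  linarith

/-- admissible cutoffs -/
def QProp (Ω : Set R2) (χ : R2 → ℝ) : Prop :=
  ∀ τ : ℝ, 0 < τ → ∃ (b : R2) (δ : ℝ), 0 < δ ∧ ‖b‖ + δ < τ ∧
    ∀ x ∈ Ω, tsupport χ ∩ closedBall (x + b) δ ⊆ Ω

lemma exists_partition (Ω : Set R2) (hΩo : IsOpen Ω)
    (hΩb : Bornology.IsBounded Ω) (hΩl : HasLipschitzBoundary Ω) :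
    ∃ (ι : Type) (_ : Fintype ι) (χ : ι → R2 → ℝ), (∀ i, ContDiff ℝ ∞ (χ i)) ∧
      (∀ i, HasCompactSupport (χ i)) ∧ (∀ i, QProp Ω (χ i)) ∧ ∀ x ∈ Ω, ∑ i, χ i x = 1 := by
  have hcomp : IsCompact (frontier Ω) :=
    (hΩb.isCompact_closure).of_isClosed_subset isClosed_frontier frontier_subset_closure
  choose! e κ r h using cone_cond Ω hΩl
  obtain ⟨t, htf, htc⟩ := hcomp.elim_nhds_subcover (fun p => ball p (r p / 2))
    (fun p hp => ball_mem_nhds _ (by have := (h p hp).2.2.2.1; positivity))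
  let U : Option t → Set R2 := fun o => o.elim Ω (fun p => ball (p:R2) (r p / 2))
  have hUo : ∀ i, IsOpen (U i) := by
    intro i; cases i
    · exact hΩo
    · exact isOpen_ball
  have hcov : closure Ω ⊆ ⋃ i, U i := by
    intro x hx
    by_cases hxo : x ∈ Ω
    · exact mem_iUnion.2 ⟨none, hxo⟩
    · have : x ∈ frontier Ω := by rw [hΩo.frontier_eq]; exact ⟨hx, hxo⟩
      obtain ⟨p, hp, hxp⟩ := mem_iUnion₂.1 (htc this)
      exact mem_iUnion.2 ⟨some ⟨p, hp⟩, hxp⟩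
  obtain ⟨f, hf⟩ := SmoothPartitionOfUnity.exists_isSubordinate 𝓘(ℝ, R2) isClosed_closure U hUo hcov
  let eqv := (Fintype.equivFin (Option t))
  refine ⟨Fin (Fintype.card (Option t)), inferInstance, fun i => f (eqv.symm i), ?_, ?_, ?_, ?_⟩
  · intro i; exact (f (eqv.symm i)).contMDiff.contDiff
  · intro i
    have hs := hf (eqv.symm i)
    have hb : Bornology.IsBounded (U (eqv.symm i)) := by
      cases (eqv.symm i)
      · exact hΩb
      · exact isBounded_ball
    exact Metric.isCompact_of_isClosed_isBounded (isClosed_tsupport _) (hb.subset hs)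
  · intro i
    have hs := hf (eqv.symm i)
    change QProp Ω (f (eqv.symm i))
    revert hs
    generalize eqv.symm i = o
    cases o with
    | none =>
      intro hs τ hτ
      exact ⟨0, τ / 2, by positivity, by simp [hτ], fun x hx y hy => hs hy.1⟩
    | some p =>
      intro hs τ hτ
      have hp := h p (htf p p.2)
      obtain ⟨he, hκ, hκ1, hr, H⟩ := hp
      set t := min (τ / 3) (r p / 5) with ht
      have ht0 : 0 < t := by positivity
      have ht1 : t ≤ τ / 3 := min_le_left _ _
      have ht2 : t ≤ r p / 5 := min_le_right _ _
      have hκt : κ p * t ≤ t := by nlinarith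
      refine ⟨t • e p, κ p * t, by positivity, ?_, ?_⟩
      · rw [norm_smul, he, Real.norm_of_nonneg ht0.le]; linarith
      · intro x hx y hy
        have hy1 : y ∈ ball (p:R2) (r p / 2) := hs hy.1
        have hy2 := hy.2
        rw [mem_closedBall] at hy2
        refine H x hx ?_ t ht0 (by linarith) y hy2
        rw [mem_ball] at hy1 ⊢
        have h1 : dist x (x + t • e p) = t := by
          rw [dist_eq_norm]; simp [norm_smul, he, abs_of_pos ht0]
        have := dist_triangle4 x (x + t • e p) y p
        rw [dist_comm (x + t • e p) y] at this
        linarith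
  · intro x hx
    have := f.sum_eq_one (subset_closure hx)
    rw [finsum_eq_sum_of_fintype] at this
    rw [← this]
    exact Equiv.sum_comp eqv.symm (fun i => f i x)
end

open MeasureTheory Metric Filter Set
open scoped ENNReal NNReal Topology Classical ContDiff Manifold
noncomputable section

lemma trans_cont_cc (c : R2 → ℝ) (hc : Continuous c) (hcs : HasCompactSupport c) (ε : ℝ) (hε : 0 < ε) :
    ∃ τ > 0, ∀ s : R2, ‖s‖ < τ → ∫⁻ x, ‖c (x + s) - c x‖ₑ ≤ ENNReal.ofReal ε := by
  obtain ⟨R, hR⟩ := hcs.isCompact.isBounded.subset_closedBall (0:R2)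
  set K := closedBall (0:R2) (R + 1)
  have hKv : volume K ≠ ⊤ := (isCompact_closedBall _ _).measure_ne_top
  set V := (volume K).toReal with hV
  have huc := hcs.uniformContinuous_of_continuous hc
  rw [Metric.uniformContinuous_iff] at huc
  obtain ⟨τ, hτ, H⟩ := huc (ε / (V + 1)) (by positivity)
  refine ⟨min τ 1, by positivity, fun s hs => ?_⟩
  have hs1 : ‖s‖ < τ := lt_of_lt_of_le hs (min_le_left _ _)
  have hs2 : ‖s‖ < 1 := lt_of_lt_of_le hs (min_le_right _ _)
  calc ∫⁻ x, ‖c (x + s) - c x‖ₑ ≤ ∫⁻ x, K.indicator (fun _ => ENNReal.ofReal (ε / (V+1))) x := by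
        apply lintegral_mono
        intro x
        dsimp only
        by_cases hx : x ∈ K
        · rw [indicator_of_mem hx, ← ofReal_norm]
          apply ENNReal.ofReal_le_ofReal
          rw [← dist_eq_norm]
          exact (H (by simpa [dist_eq_norm] using hs1)).le
        · rw [indicator_of_notMem hx]
          have hx' : R + 1 < ‖x‖ := by simpa [K] using hx
          have h1 : c x = 0 := by
            apply image_eq_zero_of_notMem_tsupport
            intro h; have := hR h; simp at this; linarith
          have h2 : c (x + s) = 0 := by
            apply image_eq_zero_of_notMem_tsupport
            intro h; have := hR h; simp at this
            have := norm_sub_le (x + s) s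
            simp at this; linarith
          simp [h1, h2]
    _ = ENNReal.ofReal (ε / (V+1)) * volume K := by
        rw [lintegral_indicator_const measurableSet_closedBall]
    _ ≤ ENNReal.ofReal ε := by
        rw [← ENNReal.ofReal_toReal hKv, ← ENNReal.ofReal_mul (by positivity)]
        apply ENNReal.ofReal_le_ofReal
        rw [div_mul_eq_mul_div, div_le_iff₀ (by positivity)]
        nlinarith

lemma trans_cont (h : R2 → ℝ) (hi : Integrable h) (ε : ℝ) (hε : 0 < ε) :
    ∃ τ > 0, ∀ s : R2, ‖s‖ < τ → ∫⁻ x, ‖h (x + s) - h x‖ₑ ≤ ENNReal.ofReal ε := by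
  obtain ⟨c, hcs, hle, hc, hci⟩ := hi.exists_hasCompactSupport_lintegral_sub_le
    (ε := ENNReal.ofReal (ε / 3)) (by simpa using by positivity)
  obtain ⟨τ, hτ, H⟩ := trans_cont_cc c hc hcs (ε / 3) (by positivity)
  refine ⟨τ, hτ, fun s hs => ?_⟩
  have hm : AEMeasurable (fun x => ‖h x - c x‖ₑ) := (hi.sub hci).aestronglyMeasurable.enorm
  have hmp : MeasurePreserving (fun x : R2 => x + s) := measurePreserving_add_right volume s
  have htr : ∫⁻ x, ‖h (x + s) - c (x + s)‖ₑ = ∫⁻ x, ‖h x - c x‖ₑ :=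
    lintegral_add_right_eq_self (fun x => ‖h x - c x‖ₑ) s
  have hm2 : AEMeasurable (fun x => ‖h (x+s) - c (x+s)‖ₑ) :=
    hm.comp_quasiMeasurePreserving hmp.quasiMeasurePreserving
  have hm3 : AEMeasurable (fun x => ‖c (x+s) - c x‖ₑ) := by
    apply Continuous.aemeasurable; fun_prop
  calc ∫⁻ x, ‖h (x + s) - h x‖ₑ
      ≤ ∫⁻ x, ((‖h (x + s) - c (x+s)‖ₑ + ‖c (x+s) - c x‖ₑ) + ‖h x - c x‖ₑ) := by
        apply lintegral_mono
        intro x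
        dsimp only
        have : h (x + s) - h x = ((h (x+s) - c (x+s)) + (c (x+s) - c x)) - (h x - c x) := by ring
        rw [this]
        exact (enorm_sub_le).trans (add_le_add_left (enorm_add_le _ _) _)
    _ = (∫⁻ x, ‖h (x + s) - c (x+s)‖ₑ) + (∫⁻ x, ‖c (x+s) - c x‖ₑ) + ∫⁻ x, ‖h x - c x‖ₑ := by
        rw [lintegral_add_right' _ hm, lintegral_add_right' _ hm3]
    _ ≤ ENNReal.ofReal (ε/3) + ENNReal.ofReal (ε/3) + ENNReal.ofReal (ε/3) := by
        rw [htr]; gcongr; exact H s hs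
    _ = ENNReal.ofReal ε := by
        rw [← ENNReal.ofReal_add, ← ENNReal.ofReal_add] <;> try positivity
        congr 1; ring

lemma moll_aux (h : R2 → ℝ) (hi : Integrable h) (hm : StronglyMeasurable h) (ε τ : ℝ)
    (H : ∀ s : R2, ‖s‖ < τ → ∫⁻ x, ‖h (x + s) - h x‖ₑ ≤ ENNReal.ofReal ε)
    (η : R2 → ℝ) (hη : Continuous η) (hηs : HasCompactSupport η) (hη0 : ∀ x, 0 ≤ η x) (hη1 : ∫ x, η x = 1)
    (b : R2) (δ : ℝ) (hδ : tsupport η ⊆ closedBall 0 δ) (hb : ‖b‖ + δ < τ) :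
    ∫⁻ x, ‖(∫ y, η (x + b - y) * h y) - h x‖ₑ ≤ ENNReal.ofReal ε := by
  have hηi : Integrable η := hη.integrable_of_hasCompactSupport hηs
  obtain ⟨C, hC⟩ := hηs.exists_bound_of_continuous hη
  have h1 : ∀ x, (∫ y, η (x + b - y) * h y) - h x = ∫ s, η s * (h (x + b - s) - h x) := by
    intro x
    have e1 : ∫ y, η (x + b - y) * h y = ∫ s, η s * h (x + b - s) := by
      rw [← integral_sub_left_eq_self (fun y => η (x+b-y) * h y) volume (x + b)]
      simp
    have hi2 : Integrable (fun s => h (x + b - s)) := hi.comp_sub_left (x+b)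
    rw [e1]
    have e2 : h x = ∫ s, η s * h x := by rw [integral_mul_const, hη1, one_mul]
    conv_lhs => rw [e2]
    rw [← integral_sub]
    · congr 1; ext s; ring
    · exact hi2.bdd_mul (c := C) hη.aestronglyMeasurable (ae_of_all _ hC)
    · exact hηi.mul_const _
  calc ∫⁻ x, ‖(∫ y, η (x + b - y) * h y) - h x‖ₑ
      ≤ ∫⁻ x, ∫⁻ s, ‖η s‖ₑ * ‖h (x + b - s) - h x‖ₑ := by
        apply lintegral_mono
        intro x
        dsimp only
        rw [h1]
        refine (enorm_integral_le_lintegral_enorm _).trans (le_of_eq ?_)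
        simp only [enorm_mul]
    _ = ∫⁻ s, ∫⁻ x, ‖η s‖ₑ * ‖h (x + b - s) - h x‖ₑ := by
        apply lintegral_lintegral_swap
        apply Measurable.aemeasurable
        have hhm := hm.measurable
        have hηm := hη.measurable
        simp only [Function.uncurry_def]
        apply Measurable.fun_mul
        · exact (hηm.comp measurable_snd).enorm
        · apply Measurable.enorm
          apply Measurable.fun_sub
          · exact hhm.comp ((measurable_fst.add_const b).sub measurable_snd)
          · exact hhm.comp measurable_fst
    _ ≤ ∫⁻ s, ‖η s‖ₑ * ENNReal.ofReal ε := by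
        apply lintegral_mono
        intro s
        dsimp only
        rw [lintegral_const_mul' _ _ enorm_ne_top]
        by_cases hs : s ∈ tsupport η
        · gcongr
          have := hδ hs
          simp at this
          have hh := H (b - s) (by have := norm_sub_le b s; linarith)
          simpa [add_sub_assoc] using hh
        · rw [image_eq_zero_of_notMem_tsupport hs]; simp
    _ = ENNReal.ofReal ε := by
        rw [lintegral_mul_const' _ _ ENNReal.ofReal_ne_top]
        have : ∫⁻ s, ‖η s‖ₑ = 1 := by
          have e : ∀ s, ‖η s‖ₑ = ENNReal.ofReal (η s) := fun s => by
            rw [← ofReal_norm, Real.norm_of_nonneg (hη0 s)]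
          simp only [e]
          rw [← ofReal_integral_eq_lintegral_ofReal hηi (ae_of_all _ hη0), hη1]; simp
        rw [this, one_mul]

lemma moll (h : R2 → ℝ) (hi : Integrable h) (ε : ℝ) (hε : 0 < ε) :
    ∃ τ > 0, ∀ η : R2 → ℝ, Continuous η → HasCompactSupport η → (∀ x, 0 ≤ η x) → (∫ x, η x = 1) →
    ∀ (b : R2) (δ : ℝ), tsupport η ⊆ closedBall 0 δ → ‖b‖ + δ < τ → 
    ∫⁻ x, ‖(∫ y, η (x + b - y) * h y) - h x‖ₑ ≤ ENNReal.ofReal ε := by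
  set h' := hi.aestronglyMeasurable.mk h
  have he : h =ᵐ[volume] h' := hi.aestronglyMeasurable.ae_eq_mk
  have hi' : Integrable h' := hi.congr he
  obtain ⟨τ, hτ, H⟩ := trans_cont h' hi' ε hε
  refine ⟨τ, hτ, fun η a1 a2 a3 a4 b δ a5 a6 => ?_⟩
  have := moll_aux h' hi' hi.aestronglyMeasurable.stronglyMeasurable_mk ε τ H η a1 a2 a3 a4 b δ a5 a6
  refine le_trans (le_of_eq ?_) this
  apply lintegral_congr_ae
  filter_upwards [he] with x hx
  rw [hx]
  congr 2
  apply integral_congr_ae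
  filter_upwards [he] with y hy
  rw [hy]
end

open MeasureTheory Metric Filter Set
open scoped ENNReal NNReal Topology Classical ContDiff Manifold Convolution
noncomputable section

abbrev ee (j : Fin 2) : R2 := EuclideanSpace.single j 1

def ScalarWeak (Ω : Set R2) (f : R2 → ℝ) (g : Fin 2 → R2 → ℝ) : Prop :=
  ∀ φ : R2 → ℝ, ContDiff ℝ (⊤ : ℕ∞) φ → HasCompactSupport φ → tsupport φ ⊆ Ω →
    ∀ j : Fin 2, (∫ x in Ω, f x * fderiv ℝ φ x (ee j)) = - ∫ x in Ω, g j x * φ x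

lemma moll_deriv (h η : R2 → ℝ) (hi : Integrable h) (hη : ContDiff ℝ ∞ η) (hηs : HasCompactSupport η)
    (b : R2) :
    ContDiff ℝ ∞ (fun x => ∫ y, η (x + b - y) * h y) ∧
    ∀ x v, fderiv ℝ (fun x => ∫ y, η (x + b - y) * h y) x v = ∫ y, fderiv ℝ η (x + b - y) v * h y := by
  have e : (fun x => ∫ y, η (x + b - y) * h y) =
      (h ⋆[ContinuousLinearMap.mul ℝ ℝ, volume] η) ∘ (fun x => x + b) := by
    ext x; simp [convolution_def, mul_comm]
  have hl : LocallyIntegrable h := hi.locallyIntegrable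
  constructor
  · rw [e]
    exact (hηs.contDiff_convolution_right (n := ⊤) _ hl hη).comp (contDiff_id.add contDiff_const)
  · intro x v
    rw [e]
    have h1 := hηs.hasFDerivAt_convolution_right (ContinuousLinearMap.mul ℝ ℝ) hl
      (hη.of_le (by exact_mod_cast le_top)) (x + b)
    have h2 : HasFDerivAt (fun x : R2 => x + b) (ContinuousLinearMap.id ℝ R2) x :=
      (hasFDerivAt_id x).add_const b
    have h3 := h1.comp x h2
    rw [h3.fderiv]
    simp only [ContinuousLinearMap.comp_id]
    rw [convolution_precompR_apply (L := ContinuousLinearMap.mul ℝ ℝ) hl (hηs.fderiv ℝ)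
      (hη.continuous_fderiv (by simp))]
    simp [convolution_def, mul_comm]

lemma approx_cut (Ω : Set R2) (hΩo : IsOpen Ω) (f : R2 → ℝ) (g : Fin 2 → R2 → ℝ)
    (hf : IntegrableOn f Ω) (hg : ∀ j, IntegrableOn (g j) Ω) (hw : ScalarWeak Ω f g)
    (χ : R2 → ℝ) (hχ : ContDiff ℝ ∞ χ) (hχs : HasCompactSupport χ) (hQ : QProp Ω χ) (ε : ℝ) (hε : 0 < ε) :
    ∃ F : R2 → ℝ, ContDiff ℝ ∞ F ∧ ∫⁻ x in Ω, ‖F x - χ x * f x‖ₑ ≤ ENNReal.ofReal ε ∧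
      ∀ j, ∫⁻ x in Ω, ‖fderiv ℝ F x (ee j) - (χ x * g j x + f x * fderiv ℝ χ x (ee j))‖ₑ ≤ ENNReal.ofReal ε := by
  have hχd : ∀ j, Continuous (fun x => fderiv ℝ χ x (ee j)) := fun j =>
    (hχ.continuous_fderiv (by simp)).clm_apply continuous_const
  have hχds : ∀ j, HasCompactSupport (fun x => fderiv ℝ χ x (ee j)) := fun j =>
    hχs.fderiv_apply ℝ (ee j)
  obtain ⟨C, hC⟩ := hχs.exists_bound_of_continuous hχ.continuous
  choose C' hC' using fun j => (hχds j).exists_bound_of_continuous (hχd j)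
  have i1 : IntegrableOn (fun x => χ x * f x) Ω :=
    hf.bdd_mul (c := C) hχ.continuous.aestronglyMeasurable (ae_of_all _ hC)
  have i2 : ∀ j, IntegrableOn (fun x => χ x * g j x) Ω := fun j =>
    (hg j).bdd_mul (c := C) hχ.continuous.aestronglyMeasurable (ae_of_all _ hC)
  have i3 : ∀ j, IntegrableOn (fun x => f x * fderiv ℝ χ x (ee j)) Ω := fun j =>
    hf.mul_bdd (c := C' j) (hχd j).aestronglyMeasurable (ae_of_all _ (hC' j))
  set h := Ω.indicator (fun x => χ x * f x) with hh
  set H := fun j => Ω.indicator (fun x => χ x * g j x + f x * fderiv ℝ χ x (ee j)) with hH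
  have hhi : Integrable h := i1.integrable_indicator hΩo.measurableSet
  have hHi : ∀ j, Integrable (H j) := fun j => ((i2 j).add (i3 j)).integrable_indicator hΩo.measurableSet
  obtain ⟨τ, hτ, T⟩ := moll h hhi ε hε
  choose τ' hτ' T' using fun j => moll (H j) (hHi j) ε hε
  obtain ⟨b, δ, hδ, hbδ, hsub⟩ := hQ (min τ (min (τ' 0) (τ' 1)))
    (lt_min hτ (lt_min (hτ' 0) (hτ' 1)))
  let bump : ContDiffBump (0:R2) := ⟨δ / 2, δ, by positivity, by linarith⟩
  set η := bump.normed volume with hηdef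
  have hηc : ContDiff ℝ ∞ η := bump.contDiff_normed
  have hηs : HasCompactSupport η := bump.hasCompactSupport_normed
  have hη0 : ∀ x, 0 ≤ η x := bump.nonneg_normed
  have hη1 : ∫ x, η x = 1 := bump.integral_normed
  have hηt : tsupport η ⊆ closedBall 0 δ := by rw [hηdef, bump.tsupport_normed_eq]
  obtain ⟨D1, D2⟩ := moll_deriv h η hhi hηc hηs b
  refine ⟨_, D1, ?_, ?_⟩
  · refine le_trans ?_ (T η hηc.continuous hηs hη0 hη1 b δ hηt (lt_of_lt_of_le hbδ (min_le_left _ _)))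
    rw [← lintegral_indicator hΩo.measurableSet]
    apply lintegral_mono
    intro x
    dsimp only
    by_cases hx : x ∈ Ω
    · simp only [indicator_of_mem hx, hh]; rfl
    · simp [indicator_of_notMem hx]
  · intro j
    have hj : ‖b‖ + δ < τ' j := by
      refine lt_of_lt_of_le hbδ ((min_le_right _ _).trans ?_)
      fin_cases j
      · exact min_le_left _ _
      · exact min_le_right _ _
    refine le_trans ?_ (T' j η hηc.continuous hηs hη0 hη1 b δ hηt hj)
    rw [← lintegral_indicator hΩo.measurableSet]
    apply lintegral_mono
    intro x
    dsimp only
    by_cases hx : x ∈ Ω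
    swap
    · simp [indicator_of_notMem hx]
    rw [indicator_of_mem hx]
    have hHx : H j x = χ x * g j x + f x * fderiv ℝ χ x (ee j) := by
      simp only [hH, indicator_of_mem hx]
    rw [hHx]
    apply le_of_eq
    congr 2
    rw [D2]
    -- weak formulation
    set φ : R2 → ℝ := fun y => η (x + b - y) * χ y with hφ
    have hηx : ContDiff ℝ ∞ (fun y => η (x + b - y)) := hηc.comp (contDiff_const.sub contDiff_id)
    have hφc : ContDiff ℝ ∞ φ := hηx.mul hχ
    have hφs : HasCompactSupport φ := hχs.mul_left
    have hφt : tsupport φ ⊆ Ω := by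
      refine subset_trans ?_ (hsub x hx)
      apply subset_inter
      · exact tsupport_mul_subset_right
      · apply closure_minimal _ isClosed_closedBall
        intro y hy
        have : η (x + b - y) ≠ 0 := by
          intro h0; apply hy; simp [hφ, h0]
        have := hηt (subset_tsupport _ this)
        rw [mem_closedBall, dist_zero_right] at this
        rw [mem_closedBall, dist_comm, dist_eq_norm]; exact this
    have key := hw φ hφc hφs hφt j
    have hd : ∀ y, fderiv ℝ φ y (ee j) =
        -(fderiv ℝ η (x + b - y) (ee j)) * χ y + η (x + b - y) * fderiv ℝ χ y (ee j) := by
      intro y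
      have h1 : HasFDerivAt (fun y => η (x + b - y)) (-(fderiv ℝ η (x + b - y))) y := by
        have a := ((hηc.differentiable (by simp)) (x + b - y)).hasFDerivAt
        have a2 : HasFDerivAt (fun y : R2 => x + b - y) (-(ContinuousLinearMap.id ℝ R2)) y :=
          (hasFDerivAt_id y).const_sub (x + b)
        have := a.comp y a2
        simp only [ContinuousLinearMap.comp_neg, ContinuousLinearMap.comp_id] at this
        exact this
      have h2 := ((hχ.differentiable (by simp)) y).hasFDerivAt
      have h3 : HasFDerivAt φ _ y := h1.mul h2
      rw [h3.fderiv]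
      simp; ring
    simp only [hd] at key
    have Cη : Continuous (fun y => η (x + b - y)) := hηx.continuous
    have Cdη : Continuous (fun y => fderiv ℝ η (x + b - y) (ee j)) :=
      ((hηc.continuous_fderiv (by simp)).comp (continuous_const.sub continuous_id)).clm_apply continuous_const
    obtain ⟨B1, hB1⟩ := hηs.exists_bound_of_continuous hηc.continuous
    obtain ⟨B2, hB2⟩ := (hηs.fderiv_apply ℝ (ee j)).exists_bound_of_continuous
      ((hηc.continuous_fderiv (by simp)).clm_apply continuous_const)
    have J1 : IntegrableOn (fun y => fderiv ℝ η (x + b - y) (ee j) * (χ y * f y)) Ω :=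
      i1.bdd_mul (c := B2) Cdη.aestronglyMeasurable (ae_of_all _ fun y => hB2 _)
    have J2 : IntegrableOn (fun y => η (x + b - y) * (f y * fderiv ℝ χ y (ee j))) Ω :=
      (i3 j).bdd_mul (c := B1) Cη.aestronglyMeasurable (ae_of_all _ fun y => hB1 _)
    have J3 : IntegrableOn (fun y => η (x + b - y) * (χ y * g j y)) Ω :=
      (i2 j).bdd_mul (c := B1) Cη.aestronglyMeasurable (ae_of_all _ fun y => hB1 _)
    have L1 : ∫ y, fderiv ℝ η (x + b - y) (ee j) * h y =
        ∫ y in Ω, fderiv ℝ η (x + b - y) (ee j) * (χ y * f y) := by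
      rw [← integral_indicator hΩo.measurableSet]
      congr 1; ext y
      by_cases hy : y ∈ Ω <;> simp [hh, hy]
    have L2 : ∫ y, η (x + b - y) * H j y =
        ∫ y in Ω, (η (x + b - y) * (χ y * g j y) + η (x + b - y) * (f y * fderiv ℝ χ y (ee j))) := by
      rw [← integral_indicator hΩo.measurableSet]
      congr 1; ext y
      by_cases hy : y ∈ Ω <;> simp [hH, hy]; ring
    rw [L1, L2, integral_add J3 J2]
    have K1 : ∫ y in Ω, f y * (-(fderiv ℝ η (x + b - y) (ee j)) * χ y + η (x + b - y) * fderiv ℝ χ y (ee j))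
        = (∫ y in Ω, η (x + b - y) * (f y * fderiv ℝ χ y (ee j))) -
          ∫ y in Ω, fderiv ℝ η (x + b - y) (ee j) * (χ y * f y) := by
      rw [← integral_sub J2 J1]
      congr 1; ext y; ring
    have K2 : ∫ y in Ω, g j y * φ y = ∫ y in Ω, η (x + b - y) * (χ y * g j y) := by
      congr 1; ext y; simp only [hφ]; ring
    rw [K1, K2] at key
    linarith

lemma approx_scalar (Ω : Set R2) (hΩo : IsOpen Ω) (hΩb : Bornology.IsBounded Ω)
    (hΩl : HasLipschitzBoundary Ω) (f : R2 → ℝ) (g : Fin 2 → R2 → ℝ)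
    (hf : IntegrableOn f Ω) (hg : ∀ j, IntegrableOn (g j) Ω) (hw : ScalarWeak Ω f g) (ε : ℝ) (hε : 0 < ε) :
    ∃ F : R2 → ℝ, ContDiff ℝ ∞ F ∧ ∫⁻ x in Ω, ‖F x - f x‖ₑ ≤ ENNReal.ofReal ε ∧
      ∀ j, ∫⁻ x in Ω, ‖fderiv ℝ F x (ee j) - g j x‖ₑ ≤ ENNReal.ofReal ε := by
  obtain ⟨ι, hι, χ, c1, c2, c3, c4⟩ := exists_partition Ω hΩo hΩb hΩl
  set N : ℝ := Fintype.card ι + 1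
  have hN : 0 < N := by positivity
  choose F F1 F2 F3 using fun i => approx_cut Ω hΩo f g hf hg hw (χ i) (c1 i) (c2 i) (c3 i) (ε / N) (by positivity)
  have hsum : ∑ i : ι, ENNReal.ofReal (ε / N) ≤ ENNReal.ofReal ε := by
    rw [← ENNReal.ofReal_sum_of_nonneg (fun _ _ => by positivity)]
    apply ENNReal.ofReal_le_ofReal
    simp only [Finset.sum_const, nsmul_eq_mul, Finset.card_univ]
    rw [mul_div_assoc', div_le_iff₀ hN]
    simp only [N]; nlinarith
  have hχd : ∀ i j, Continuous (fun x => fderiv ℝ (χ i) x (ee j)) := fun i j =>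
    ((c1 i).continuous_fderiv (by simp)).clm_apply continuous_const
  have hFd : ∀ i j, Continuous (fun x => fderiv ℝ (F i) x (ee j)) := fun i j =>
    ((F1 i).continuous_fderiv (by simp)).clm_apply continuous_const
  refine ⟨fun x => ∑ i, F i x, ContDiff.sum fun i _ => F1 i, ?_, ?_⟩
  · refine le_trans ?_ ((Finset.sum_le_sum fun i _ => F2 i).trans hsum)
    rw [← lintegral_finsetSum']
    swap
    · intro i _
      exact (((F1 i).continuous.aestronglyMeasurable).sub
        ((c1 i).continuous.aestronglyMeasurable.mul hf.aestronglyMeasurable)).enorm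
    apply setLIntegral_mono_ae' hΩo.measurableSet
    refine ae_of_all _ fun x hx => ?_
    have : ∑ i, F i x - f x = ∑ i, (F i x - χ i x * f x) := by
      rw [Finset.sum_sub_distrib, ← Finset.sum_mul, c4 x hx, one_mul]
    rw [this]
    exact enorm_sum_le _ _
  · intro j
    refine le_trans ?_ ((Finset.sum_le_sum fun i _ => F3 i j).trans hsum)
    rw [← lintegral_finsetSum']
    swap
    · intro i _
      exact (((hFd i j).aestronglyMeasurable).sub
        (((c1 i).continuous.aestronglyMeasurable.mul (hg j).aestronglyMeasurable).add
         (hf.aestronglyMeasurable.mul (hχd i j).aestronglyMeasurable))).enorm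
    apply setLIntegral_mono_ae' hΩo.measurableSet
    refine ae_of_all _ fun x hx => ?_
    have hd : fderiv ℝ (fun x => ∑ i, F i x) x (ee j) = ∑ i, fderiv ℝ (F i) x (ee j) := by
      rw [fderiv_fun_sum fun i _ => (F1 i).differentiable (by simp) x]
      simp
    have hz : ∑ i, fderiv ℝ (χ i) x (ee j) = 0 := by
      have h1 : (fun x => ∑ i, χ i x) =ᶠ[𝓝 x] fun _ => (1:ℝ) := by
        filter_upwards [hΩo.mem_nhds hx] with y hy using c4 y hy
      have h2 : fderiv ℝ (fun x => ∑ i, χ i x) x (ee j) = 0 := by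
        rw [h1.fderiv_eq]; simp
      rw [fderiv_fun_sum fun i _ => (c1 i).differentiable (by simp) x] at h2
      simpa using h2
    have : ∑ i, fderiv ℝ (F i) x (ee j) - g j x =
        ∑ i, (fderiv ℝ (F i) x (ee j) - (χ i x * g j x + f x * fderiv ℝ (χ i) x (ee j))) := by
      rw [Finset.sum_sub_distrib, Finset.sum_add_distrib, ← Finset.sum_mul, ← Finset.mul_sum, c4 x hx, hz]
      ring
    rw [hd, this]
    exact enorm_sum_le _ _
end

open MeasureTheory Metric Filter Set
open scoped ENNReal NNReal Topology Classical ContDiff Manifold Convolution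
noncomputable section

lemma ibp_lip (F φ : R2 → ℝ) (hF : ContDiff ℝ ∞ F) (L : ℝ≥0) (hφ : LipschitzWith L φ)
    (hφs : HasCompactSupport φ) (v : R2) :
    ∫ x, F x * fderiv ℝ φ x v = - ∫ x, fderiv ℝ F x v * φ x := by
  obtain ⟨R, hR⟩ := hφs.isCompact.isBounded.subset_closedBall (0:R2)
  let bump : ContDiffBump (0:R2) := ⟨|R| + 1, |R| + 2, by positivity, by linarith⟩
  set g : R2 → ℝ := fun x => bump x * F x with hg
  have hgc : ContDiff ℝ ∞ g := bump.contDiff.mul hF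
  have hgs : HasCompactSupport g := bump.hasCompactSupport.mul_right
  obtain ⟨D, hD⟩ := hgc.lipschitzWith_of_hasCompactSupport hgs (by simp)
  have key := hφ.integral_lineDeriv_mul_eq (μ := volume) hD hgs v
  have hnear : ∀ x ∈ tsupport φ, g =ᶠ[𝓝 x] F := by
    intro x hx
    have hx' := hR hx
    have : x ∈ ball (0:R2) (|R| + 1) := by
      rw [mem_closedBall] at hx'; rw [mem_ball]; have := le_abs_self R; linarith
    filter_upwards [isOpen_ball.mem_nhds this] with y hy
    have : bump y = 1 := bump.one_of_mem_closedBall (ball_subset_closedBall hy)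
    simp [hg, this]
  have e1 : ∫ x, lineDeriv ℝ φ x v * g x = ∫ x, F x * fderiv ℝ φ x v := by
    apply integral_congr_ae
    filter_upwards [hφ.ae_differentiableAt (μ := volume)] with x hx
    rw [hx.lineDeriv_eq_fderiv]
    by_cases hxs : x ∈ tsupport φ
    · rw [(hnear x hxs).eq_of_nhds, mul_comm]
    · have : fderiv ℝ φ x = 0 := by
        have h1 : φ =ᶠ[𝓝 x] fun _ => (0:ℝ) := notMem_tsupport_iff_eventuallyEq.1 hxs
        rw [h1.fderiv_eq]; simp
      simp [this]
  have e2 : ∫ x, lineDeriv ℝ g x (-v) * φ x = - ∫ x, fderiv ℝ F x v * φ x := by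
    rw [← integral_neg]
    congr 1; ext x
    by_cases hxs : x ∈ tsupport φ
    · rw [((hgc.differentiable (by simp)) x).lineDeriv_eq_fderiv, (hnear x hxs).fderiv_eq]
      simp
    · rw [image_eq_zero_of_notMem_tsupport hxs]; simp
  rw [← e1, key, e2]

lemma ibp_lip_on (Ω : Set R2) (F φ : R2 → ℝ) (hF : ContDiff ℝ ∞ F) (L : ℝ≥0) (hφ : LipschitzWith L φ)
    (hφs : HasCompactSupport φ) (ht : tsupport φ ⊆ Ω) (v : R2) :
    ∫ x in Ω, F x * fderiv ℝ φ x v = - ∫ x in Ω, fderiv ℝ F x v * φ x := by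
  rw [setIntegral_eq_integral_of_forall_compl_eq_zero, setIntegral_eq_integral_of_forall_compl_eq_zero]
  · exact ibp_lip F φ hF L hφ hφs v
  · intro x hx
    rw [image_eq_zero_of_notMem_tsupport (fun h => hx (ht h))]; simp
  · intro x hx
    have : fderiv ℝ φ x = 0 := by
      have h1 : φ =ᶠ[𝓝 x] fun _ => (0:ℝ) := notMem_tsupport_iff_eventuallyEq.1 (fun h => hx (ht h))
      rw [h1.fderiv_eq]; simp
    simp [this]

lemma mulconv {α : Type*} [MeasurableSpace α] (μ : Measure α) (g : ℕ → α → ℝ) (g0 : α → ℝ)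
    (hg0 : Integrable g0 μ) (hgm : ∀ n, AEStronglyMeasurable (g n) μ)
    (hg : Tendsto (fun n => ∫⁻ x, ‖g n x - g0 x‖ₑ ∂μ) atTop (𝓝 0))
    (m : ℕ → α → ℝ) (m0 : α → ℝ) (C : ℝ) (hm : ∀ n, AEStronglyMeasurable (m n) μ)
    (hC : ∀ n x, |m n x| ≤ C) (hlim : ∀ᵐ x ∂μ, Tendsto (fun n => m n x) atTop (𝓝 (m0 x))) :
    Tendsto (fun n => ∫⁻ x, ‖m n x * g n x - m0 x * g0 x‖ₑ ∂μ) atTop (𝓝 0) := by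
  have hm0 : AEStronglyMeasurable m0 μ := aestronglyMeasurable_of_tendsto_ae _ hm hlim
  have hC0 : ∀ᵐ x ∂μ, |m0 x| ≤ C := by
    filter_upwards [hlim] with x hx
    exact le_of_tendsto hx.abs (Eventually.of_forall fun n => hC n x)
  have h2 : Tendsto (fun n => ∫⁻ x, ‖(m n x - m0 x) * g0 x‖ₑ ∂μ) atTop (𝓝 0) := by
    have := tendsto_lintegral_of_dominated_convergence' (μ := μ)
      (F := fun n x => ‖(m n x - m0 x) * g0 x‖ₑ) (f := fun _ => 0)
      (fun x => ENNReal.ofReal (2 * C) * ‖g0 x‖ₑ)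
      (fun n => (((hm n).sub hm0).mul hg0.aestronglyMeasurable).enorm) ?_ ?_ ?_
    · simpa using this
    · intro n
      filter_upwards [hC0] with x hx
      rw [enorm_mul]
      gcongr
      rw [← ofReal_norm]
      apply ENNReal.ofReal_le_ofReal
      have := norm_sub_le (m n x) (m0 x)
      simp only [Real.norm_eq_abs] at *
      have := hC n x
      linarith
    · rw [lintegral_const_mul' _ _ ENNReal.ofReal_ne_top]
      exact ENNReal.mul_ne_top ENNReal.ofReal_ne_top hg0.2.ne
    · filter_upwards [hlim] with x hx
      have h3 : Tendsto (fun n => (m n x - m0 x) * g0 x) atTop (𝓝 0) := by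
        have := (hx.sub_const (m0 x)).mul_const (g0 x)
        simpa using this
      have := h3.enorm
      simpa using this
  have h1 : Tendsto (fun n => ENNReal.ofReal C * ∫⁻ x, ‖g n x - g0 x‖ₑ ∂μ) atTop (𝓝 0) := by
    have := ENNReal.Tendsto.const_mul hg (a := ENNReal.ofReal C) (Or.inr ENNReal.ofReal_ne_top)
    simpa using this
  have h12 := h1.add h2
  rw [add_zero] at h12
  refine tendsto_of_tendsto_of_tendsto_of_le_of_le tendsto_const_nhds h12 (fun n => zero_le) ?_
  intro n
  dsimp only
  rw [← lintegral_const_mul' _ _ ENNReal.ofReal_ne_top, ← lintegral_add_right']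
  swap
  · exact (((hm n).sub hm0).mul hg0.aestronglyMeasurable).enorm
  apply lintegral_mono
  intro x
  dsimp only
  have : m n x * g n x - m0 x * g0 x = m n x * (g n x - g0 x) + (m n x - m0 x) * g0 x := by ring
  rw [this]
  refine (enorm_add_le _ _).trans ?_
  gcongr
  rw [enorm_mul]
  gcongr
  rw [← ofReal_norm]
  exact ENNReal.ofReal_le_ofReal (hC n x)

structure ApproxSeq (Ω : Set R2) (u : R2 → R2) (G : R2 → Matrix (Fin 2) (Fin 2) ℝ)
    (V : ℕ → Fin 2 → R2 → ℝ) : Prop where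
  smooth : ∀ n i, ContDiff ℝ ∞ (V n i)
  conv : ∀ i, Tendsto (fun n => ∫⁻ x in Ω, ‖V n i x - u x i‖ₑ) atTop (𝓝 0)
  dconv : ∀ i j, Tendsto (fun n => ∫⁻ x in Ω, ‖fderiv ℝ (V n i) x (ee j) - G x i j‖ₑ) atTop (𝓝 0)
  aeconv : ∀ᵐ x ∂(volume.restrict Ω), ∀ i, Tendsto (fun n => V n i x) atTop (𝓝 (u x i))

lemma coord_integrable {Ω : Set R2} {u : R2 → R2} (hu : IntegrableOn u Ω) (i : Fin 2) :
    IntegrableOn (fun x => u x i) Ω :=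
  (EuclideanSpace.proj (𝕜 := ℝ) i : R2 →L[ℝ] ℝ).integrable_comp hu

lemma exists_approxSeq (Ω : Set R2) (hΩo : IsOpen Ω) (hΩb : Bornology.IsBounded Ω)
    (hΩl : HasLipschitzBoundary Ω) (u : R2 → R2) (G : R2 → Matrix (Fin 2) (Fin 2) ℝ)
    (hu : MemW11 Ω u G) : ∃ V, ApproxSeq Ω u G V := by
  have hsw : ∀ i, ScalarWeak Ω (fun x => u x i) (fun j x => G x i j) :=
    fun i φ h1 h2 h3 j => hu.2.2 φ h1 h2 h3 i j
  choose V h1 h2 h3 using fun (n : ℕ) (i : Fin 2) => approx_scalar Ω hΩo hΩb hΩl (fun x => u x i)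
    (fun j x => G x i j) (coord_integrable hu.1 i) (hu.2.1 i) (hsw i) ((1/2)^n) (by positivity)
  have hl : Tendsto (fun n : ℕ => ENNReal.ofReal ((1/2)^n)) atTop (𝓝 0) := by
    have := ENNReal.tendsto_ofReal (tendsto_pow_atTop_nhds_zero_of_lt_one (r := (1/2:ℝ)) (by norm_num) (by norm_num))
    simpa using this
  refine ⟨V, h1, fun i => ?_, fun i j => ?_, ?_⟩
  · exact tendsto_of_tendsto_of_tendsto_of_le_of_le tendsto_const_nhds hl (fun n => zero_le) (fun n => h2 n i)
  · exact tendsto_of_tendsto_of_tendsto_of_le_of_le tendsto_const_nhds hl (fun n => zero_le) (fun n => h3 n i j)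
  · rw [ae_all_iff]
    intro i
    have hmeas : ∀ n, AEMeasurable (fun x => ‖V n i x - u x i‖ₑ) (volume.restrict Ω) := fun n =>
      ((h1 n i).continuous.aestronglyMeasurable.sub (coord_integrable hu.1 i).aestronglyMeasurable).enorm
    have hfin : ∫⁻ x in Ω, ∑' n, ‖V n i x - u x i‖ₑ ≠ ⊤ := by
      rw [lintegral_tsum hmeas]
      refine ne_top_of_le_ne_top ?_ (ENNReal.tsum_le_tsum fun n => h2 n i)
      rw [← ENNReal.ofReal_tsum_of_nonneg (fun n => by positivity)
        (summable_geometric_of_lt_one (by norm_num) (by norm_num))]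
      exact ENNReal.ofReal_ne_top
    filter_upwards [ae_lt_top' (AEMeasurable.ennreal_tsum hmeas) hfin] with x hx
    have := ENNReal.tendsto_atTop_zero_of_tsum_ne_top hx.ne
    rw [tendsto_iff_norm_sub_tendsto_zero]
    have h4 := (ENNReal.tendsto_toReal ENNReal.zero_ne_top).comp this
    simpa [Function.comp_def, toReal_enorm] using h4
end

open MeasureTheory Metric Filter Set
open scoped ENNReal NNReal Topology Classical ContDiff Manifold Convolution
noncomputable section

lemma cont_intOn {Ω : Set R2} (hΩb : Bornology.IsBounded Ω) {f : R2 → ℝ} (hf : Continuous f) :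
    IntegrableOn f Ω :=
  (hf.continuousOn.integrableOn_compact (μ := volume) hΩb.isCompact_closure).mono_set subset_closure

lemma mulconv_int {α : Type*} [MeasurableSpace α] (μ : Measure α) (g : ℕ → α → ℝ) (g0 : α → ℝ)
    (hg0 : Integrable g0 μ) (hgm : ∀ n, Integrable (g n) μ)
    (hg : Tendsto (fun n => ∫⁻ x, ‖g n x - g0 x‖ₑ ∂μ) atTop (𝓝 0))
    (m : ℕ → α → ℝ) (m0 : α → ℝ) (C : ℝ) (hm : ∀ n, AEStronglyMeasurable (m n) μ)
    (hC : ∀ n x, |m n x| ≤ C) (hlim : ∀ᵐ x ∂μ, Tendsto (fun n => m n x) atTop (𝓝 (m0 x))) :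
    (∀ n, Integrable (fun x => m n x * g n x) μ) ∧
    Tendsto (fun n => ∫ x, m n x * g n x ∂μ) atTop (𝓝 (∫ x, m0 x * g0 x ∂μ)) := by
  have h := mulconv μ g g0 hg0 (fun n => (hgm n).1) hg m m0 C hm hC hlim
  have hm0 : AEStronglyMeasurable m0 μ := aestronglyMeasurable_of_tendsto_ae _ hm hlim
  have hi : ∀ n, Integrable (fun x => m n x * g n x) μ := fun n =>
    (hgm n).bdd_mul (c := C) (hm n) (ae_of_all _ (fun x => hC n x))
  exact ⟨hi, tendsto_integral_of_L1 _ (hm0.mul hg0.1) (Eventually.of_forall hi) h⟩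

lemma hasFDerivAt_psi (V : Fin 2 → R2 → ℝ) (hV : ∀ i, ContDiff ℝ ∞ (V i)) (x v : R2) :
    fderiv ℝ (fun x => 1/2 - (1 + (V 0 x)^2 + (V 1 x)^2)⁻¹) x v =
     ∑ i, (2 * V i x * ((1 + (V 0 x)^2 + (V 1 x)^2)^2)⁻¹) * fderiv ℝ (V i) x v := by
  have h0 := ((hV 0).differentiable (by simp) x).hasFDerivAt
  have h1 := ((hV 1).differentiable (by simp) x).hasFDerivAt
  have hp : (1 + (V 0 x)^2 + (V 1 x)^2) ≠ 0 := by positivity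
  have h3 : HasFDerivAt (fun x => 1 + (V 0 x)^2 + (V 1 x)^2) _ x :=
    ((hasFDerivAt_const (1:ℝ) x).add (h0.pow 2)).add (h1.pow 2)
  have h4 : HasFDerivAt (fun x => (1 + (V 0 x)^2 + (V 1 x)^2)⁻¹) _ x :=
    (hasDerivAt_inv hp).comp_hasFDerivAt x h3
  have h5 : HasFDerivAt (fun x => 1/2 - (1 + (V 0 x)^2 + (V 1 x)^2)⁻¹) _ x := h4.const_sub (1/2)
  rw [h5.fderiv, Fin.sum_univ_two]
  simp
  ring

lemma orthog (Ω : Set R2) (hΩo : IsOpen Ω) (hΩb : Bornology.IsBounded Ω)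
    (u : R2 → R2) (G : R2 → Matrix (Fin 2) (Fin 2) ℝ)
    (hu : MemW11 Ω u G) (hS : SphereValued Ω u) (V) (hV : ApproxSeq Ω u G V) (j : Fin 2) :
    ∀ᵐ x ∂(volume.restrict Ω), u x 0 * G x 0 j + u x 1 * G x 1 j = 0 := by
  have hS' : ∀ᵐ x ∂(volume.restrict Ω), (u x 0)^2 + (u x 1)^2 = 1 := by
    filter_upwards [hS] with x hx
    have := EuclideanSpace.norm_sq_eq (u x)
    rw [hx, Fin.sum_univ_two] at this
    simp at this
    linarith
  set m : ℕ → Fin 2 → R2 → ℝ := fun n i x => 2 * V n i x * ((1 + (V n 0 x)^2 + (V n 1 x)^2)^2)⁻¹ with hm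
  set Q : ℕ → R2 → ℝ := fun n x => 1/2 - (1 + (V n 0 x)^2 + (V n 1 x)^2)⁻¹ with hQ
  have hQs : ∀ n, ContDiff ℝ ∞ (Q n) := fun n => by
    apply ContDiff.sub contDiff_const
    apply ContDiff.inv
    · exact (contDiff_const.add ((hV.smooth n 0).pow 2)).add ((hV.smooth n 1).pow 2)
    · intro x; positivity
  have hQb : ∀ n x, |Q n x| ≤ 1 := by
    intro n x
    have h1 : 0 < (1 + (V n 0 x)^2 + (V n 1 x)^2)⁻¹ := by positivity
    have h2 : (1 + (V n 0 x)^2 + (V n 1 x)^2)⁻¹ ≤ 1 := inv_le_one_of_one_le₀ (by nlinarith [sq_nonneg (V n 0 x), sq_nonneg (V n 1 x)])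
    rw [abs_le]; constructor <;> simp only [hQ] <;> linarith
  have hmc : ∀ n i, Continuous (m n i) := by
    intro n i
    have hh := fun i => (hV.smooth n i).continuous
    simp only [hm]
    apply Continuous.mul (by have := hh i; fun_prop)
    apply Continuous.inv₀
    · have := hh 0; have := hh 1; fun_prop
    · intro x; positivity
  have hmb : ∀ n i x, |m n i x| ≤ 1 := by
    intro n i x
    simp only [hm]
    rw [abs_mul, abs_inv, ← div_eq_mul_inv, div_le_one (by positivity)]
    have h3 : (V n i x)^2 ≤ (V n 0 x)^2 + (V n 1 x)^2 := by
      fin_cases i <;> simp <;> positivity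
    have h4 : |2 * V n i x| ≤ 1 + (V n i x)^2 := by
      rw [abs_le]; constructor <;> nlinarith [sq_nonneg (V n i x - 1), sq_nonneg (V n i x + 1)]
    rw [abs_of_nonneg (a := (1 + V n 0 x ^ 2 + V n 1 x ^ 2) ^ 2) (by positivity)]
    nlinarith [sq_nonneg (V n i x)]
  have hGi : ∀ i, Integrable (fun x => (u x i / 2) * G x i j) (volume.restrict Ω) := by
    intro i
    apply (hu.2.1 i j).bdd_mul (c := 1) ((coord_integrable hu.1 i).div_const 2).1
    filter_upwards [hS] with x hx
    have := coord_le_norm (u x) i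
    rw [hx] at this
    rw [Real.norm_eq_abs, abs_div]; simp; linarith
  have hI : Integrable (fun x => (u x 0 / 2) * G x 0 j + (u x 1 / 2) * G x 1 j) (volume.restrict Ω) :=
    (hGi 0).add (hGi 1)
  have := hΩo.ae_eq_zero_of_integral_contDiff_smul_eq_zero (μ := volume) (f := fun x => (u x 0 / 2) * G x 0 j + (u x 1 / 2) * G x 1 j) (IntegrableOn.locallyIntegrableOn hI) ?_
  · filter_upwards [(ae_restrict_iff' hΩo.measurableSet).2 this] with x hx
    linarith
  intro φ h1 h2 h3
  obtain ⟨L, hL⟩ := h1.lipschitzWith_of_hasCompactSupport h2 (by simp)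
  have hφb : ∃ C, ∀ x, |φ x| ≤ C := h2.exists_bound_of_continuous h1.continuous
  obtain ⟨C, hC⟩ := hφb
  have hφc : Continuous (fun x => fderiv ℝ φ x (ee j)) :=
    (h1.continuous_fderiv (by simp)).clm_apply continuous_const
  -- lhs
  have l1 : Tendsto (fun n => ∫ x in Ω, Q n x * fderiv ℝ φ x (ee j)) atTop (𝓝 (∫ x in Ω, 0 * fderiv ℝ φ x (ee j))) := by
    refine (mulconv_int (volume.restrict Ω) (fun _ x => fderiv ℝ φ x (ee j)) _ (cont_intOn hΩb hφc)
      (fun _ => cont_intOn hΩb hφc) (by simp) Q (fun _ => 0) 1 (fun n => (hQs n).continuous.aestronglyMeasurable)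
      hQb ?_).2
    filter_upwards [hS', hV.aeconv] with x hx hx2
    have : Tendsto (fun n => Q n x) atTop (𝓝 (1/2 - (1 + (u x 0)^2 + (u x 1)^2)⁻¹)) := by
      apply Tendsto.const_sub
      apply Tendsto.inv₀
      · exact (((hx2 0).pow 2).const_add 1).add ((hx2 1).pow 2)
      · positivity
    have e : (1/2 - (1 + (u x 0)^2 + (u x 1)^2)⁻¹) = 0 := by
      rw [add_assoc, hx]; norm_num
    rwa [e] at this
  have l2 : ∀ i, (∀ n, Integrable (fun x => (φ x * m n i x) * fderiv ℝ (V n i) x (ee j)) (volume.restrict Ω)) ∧ Tendsto (fun n => ∫ x in Ω, (φ x * m n i x) * fderiv ℝ (V n i) x (ee j)) atTop (𝓝 (∫ x in Ω, (φ x * (u x i / 2)) * G x i j)) := by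
    intro i
    refine (mulconv_int (volume.restrict Ω) (fun n x => fderiv ℝ (V n i) x (ee j)) _ (hu.2.1 i j)
      (fun n => cont_intOn hΩb (((hV.smooth n i).continuous_fderiv (by simp)).clm_apply continuous_const)) (hV.dconv i j) (fun n x => φ x * m n i x) _ C (fun n => (h1.continuous.mul (hmc n i)).aestronglyMeasurable) ?_ ?_)
    · intro n x
      rw [abs_mul]
      have := mul_le_mul (hC x) (hmb n i x) (abs_nonneg _) ((abs_nonneg _).trans (hC x))
      linarith
    filter_upwards [hS', hV.aeconv] with x hx hx2
    apply Tendsto.const_mul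
    have : Tendsto (fun n => m n i x) atTop (𝓝 (2 * u x i * ((1 + (u x 0)^2 + (u x 1)^2)^2)⁻¹)) := by
      apply Tendsto.mul ((hx2 i).const_mul 2)
      apply Tendsto.inv₀
      · exact ((((hx2 0).pow 2).const_add 1).add ((hx2 1).pow 2)).pow 2
      · positivity
    have e : (2 * u x i * ((1 + (u x 0)^2 + (u x 1)^2)^2)⁻¹) = u x i / 2 := by
      rw [add_assoc, hx]; norm_num; ring
    rwa [e] at this
  have key : ∀ n, ∫ x in Ω, Q n x * fderiv ℝ φ x (ee j) =
     -( (∫ x in Ω, (φ x * m n 0 x) * fderiv ℝ (V n 0) x (ee j)) + ∫ x in Ω, (φ x * m n 1 x) * fderiv ℝ (V n 1) x (ee j)) := by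
    intro n
    rw [ibp_lip_on Ω (Q n) φ (hQs n) L hL h2 h3, ← integral_add ((l2 0).1 n) ((l2 1).1 n)]
    congr 2
    ext x
    rw [hasFDerivAt_psi (V n) (hV.smooth n), Fin.sum_univ_two]
    ring
  simp only [key] at l1
  have l3 := ((l2 0).2.add (l2 1).2).neg
  have l4 := tendsto_nhds_unique l1 l3
  have i2 : ∀ i, Integrable (fun x => (φ x * (u x i / 2)) * G x i j) (volume.restrict Ω) := by
    intro i
    have := (hGi i).bdd_mul (c := C) h1.continuous.aestronglyMeasurable (ae_of_all _ hC)
    exact this.congr (ae_of_all _ fun x => by ring)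
  rw [← integral_add (i2 0) (i2 1)] at l4
  simp at l4
  rw [← setIntegral_eq_integral_of_forall_compl_eq_zero (s := Ω)]
  · rw [← neg_eq_zero, ← neg_eq_zero, neg_neg, ← l4]
    congr 1; ext x; simp; ring
  · intro x hx
    rw [image_eq_zero_of_notMem_tsupport (fun h => hx (h3 h))]; simp
end

open MeasureTheory Metric Filter Set
open scoped ENNReal NNReal Topology Classical ContDiff Manifold Convolution
noncomputable section

lemma vol_ball (y : R2) (r : ℝ) (hr : 0 ≤ r) : volume (ball y r) = ENNReal.ofReal (Real.pi * r^2) := by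
  rw [EuclideanSpace.volume_ball_fin_two, mul_comm, ← ENNReal.ofReal_pow hr,
    ENNReal.ofReal_mul Real.pi_pos.le]

lemma inv_norm_int0 (r : ℝ) (hr : 0 < r) :
    IntegrableOn (fun a : R2 => ‖a‖⁻¹) (ball 0 r) ∧ ∫ a in ball (0:R2) r, ‖a‖⁻¹ = 2 * Real.pi * r := by
  have hd : Module.finrank ℝ R2 = 2 := by simp
  constructor
  · rw [integrableOn_fun_norm_addHaar (volume : Measure R2) (f := fun t => t⁻¹), hd]
    have : IntegrableOn (fun _ : ℝ => (1:ℝ)) (Ioo 0 r) := by simp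
    refine this.congr_fun ?_ measurableSet_Ioo
    intro y hy
    have := hy.1.ne'
    simp; field_simp
  · rw [← integral_indicator measurableSet_ball]
    have e : (ball (0:R2) r).indicator (fun a => ‖a‖⁻¹) = fun a : R2 => (Iio r).indicator (fun t : ℝ => t⁻¹) ‖a‖ := by
      ext a; simp [indicator]
    rw [e, integral_fun_norm_addHaar (volume : Measure R2) (fun t => (Iio r).indicator (fun t : ℝ => t⁻¹) t), hd]
    have h1 : ∫ y in Ioi (0:ℝ), y ^ (2 - 1) • (Iio r).indicator (fun t : ℝ => t⁻¹) y = r := by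
      have : ∫ y in Ioi (0:ℝ), y ^ (2 - 1) • (Iio r).indicator (fun t : ℝ => t⁻¹) y = ∫ y in Ioi (0:ℝ), (Iio r).indicator (fun _ => (1:ℝ)) y := by
        apply setIntegral_congr_fun measurableSet_Ioi
        intro y hy
        have : y ≠ 0 := (mem_Ioi.1 hy).ne'
        simp only [indicator]
        split_ifs
        · simp; field_simp
        · simp
      rw [this, setIntegral_indicator measurableSet_Iio, Ioi_inter_Iio]
      simp [hr.le]
    rw [h1, Measure.real, vol_ball _ _ zero_le_one]
    simp [Real.pi_pos.le]; ring

lemma inv_norm_int (y : R2) (r : ℝ) (hr : 0 < r) :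
    IntegrableOn (fun a : R2 => ‖a - y‖⁻¹) (ball y r) ∧
    ∫⁻ a in ball y r, ENNReal.ofReal (‖a - y‖⁻¹) = ENNReal.ofReal (2 * Real.pi * r) := by
  obtain ⟨h1, h2⟩ := inv_norm_int0 r hr
  have h3 := (ofReal_integral_eq_lintegral_ofReal h1 (ae_of_all _ fun x => by positivity))
  have mp := measurePreserving_sub_right (volume : Measure R2) y
  have e : (fun a : R2 => a - y) ⁻¹' (ball 0 r) = ball y r := by
    ext a; simp [dist_eq_norm]
  have h4 : ∫⁻ a in ball y r, ENNReal.ofReal (‖a - y‖⁻¹) = ENNReal.ofReal (2 * Real.pi * r) := by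
    rw [← h2, h3, ← e]
    exact mp.setLIntegral_comp_preimage_emb (measurableEmbedding_subRight y) (fun a => ENNReal.ofReal (‖a‖⁻¹)) _
  refine ⟨⟨by fun_prop, ?_⟩, h4⟩
  rw [hasFiniteIntegral_iff_ofReal (ae_of_all _ fun x => by positivity), h4]
  exact ENNReal.ofReal_lt_top

lemma inv_norm_int2 (y : R2) (r : ℝ) (hr : 0 < r) :
    ∫⁻ a in ball (0:R2) r, ENNReal.ofReal (‖y - a‖⁻¹) ≤ ENNReal.ofReal (3 * Real.pi * r) := by
  calc ∫⁻ a in ball (0:R2) r, ENNReal.ofReal (‖y - a‖⁻¹)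
      ≤ ∫⁻ a in ball (0:R2) r, ((ball y r).indicator (fun a => ENNReal.ofReal (‖a - y‖⁻¹)) a + ENNReal.ofReal r⁻¹) := by
        apply lintegral_mono
        intro a; dsimp only
        by_cases h : a ∈ ball y r
        · rw [indicator_of_mem h, norm_sub_rev]; exact le_self_add
        · rw [indicator_of_notMem h, zero_add]
          apply ENNReal.ofReal_le_ofReal
          rw [mem_ball, dist_eq_norm, norm_sub_rev] at h
          exact inv_anti₀ hr (not_lt.1 h)
    _ ≤ ENNReal.ofReal (2 * Real.pi * r) + ENNReal.ofReal (Real.pi * r) := by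
        rw [lintegral_add_right _ measurable_const]
        gcongr
        · calc _ ≤ ∫⁻ a, (ball y r).indicator (fun a => ENNReal.ofReal (‖a - y‖⁻¹)) a := setLIntegral_le_lintegral _ _
            _ = _ := by rw [lintegral_indicator measurableSet_ball, (inv_norm_int y r hr).2]
        · rw [lintegral_const, Measure.restrict_apply_univ, vol_ball _ _ hr.le, ← ENNReal.ofReal_mul (by positivity)]
          apply ENNReal.ofReal_le_ofReal
          apply le_of_eq; field_simp
    _ = _ := by
        rw [← ENNReal.ofReal_add (by positivity) (by positivity)]; congr 1; ring

lemma choose_a (V : R2 → R2) (hV : ContDiff ℝ ∞ V) (g : R2 → ℝ≥0∞) (hg : Measurable g) (r : ℝ) (hr : 0 < r) :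
    ∃ a ∈ ball (0:R2) r, (∫⁻ x, g x * ENNReal.ofReal (‖V x - a‖⁻¹) ≤ ENNReal.ofReal (3 / r) * ∫⁻ x, g x) ∧
      ∀ x, V x = a → (fderiv ℝ V x).det ≠ 0 := by
  have hVm : Measurable V := hV.continuous.measurable
  have hm : Measurable (fun p : R2 × R2 => g p.2 * ENNReal.ofReal (‖V p.2 - p.1‖⁻¹)) := by fun_prop
  have hF : Measurable (fun a => ∫⁻ x, g x * ENNReal.ofReal (‖V x - a‖⁻¹)) := hm.lintegral_prod_right'
  have hμ : volume (ball (0:R2) r) ≠ 0 := (measure_ball_pos _ _ hr).ne'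
  have hμ' : volume (ball (0:R2) r) ≠ ⊤ := measure_ball_lt_top.ne
  have key := measure_le_setLAverage_pos hμ hμ' hF.aemeasurable
  have sard := addHaar_image_eq_zero_of_det_fderivWithin_eq_zero (volume : Measure R2) (f := V) (f' := fun x => fderiv ℝ V x)
    (s := {x | (fderiv ℝ V x).det = 0}) (fun x _ => ((hV.differentiable (by simp)) x).hasFDerivAt.hasFDerivWithinAt) (fun x hx => hx)
  have : 0 < volume ({x ∈ ball (0:R2) r | (∫⁻ x_1, g x_1 * ENNReal.ofReal ‖V x_1 - x‖⁻¹) ≤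
       ⨍⁻ a in ball 0 r, (∫⁻ x, g x * ENNReal.ofReal ‖V x - a‖⁻¹) ∂volume} \ V '' {x | (fderiv ℝ V x).det = 0}) := by
    rwa [measure_sdiff_null sard]
  obtain ⟨a, ⟨ha1, ha2⟩, ha3⟩ := nonempty_of_measure_ne_zero this.ne'
  refine ⟨a, ha1, ha2.trans ?_, fun x hx h0 => ha3 ⟨x, h0, hx⟩⟩
  rw [setLAverage_eq]
  have h5 : ∫⁻ a in ball (0:R2) r, (∫⁻ x, g x * ENNReal.ofReal ‖V x - a‖⁻¹) ≤ ENNReal.ofReal (3 * Real.pi * r) * ∫⁻ x, g x := by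
    rw [lintegral_lintegral_swap hm.aemeasurable, ← lintegral_const_mul _ hg]
    apply lintegral_mono
    intro x; dsimp only
    rw [lintegral_const_mul _ (by fun_prop), mul_comm]
    gcongr
    exact inv_norm_int2 _ _ hr
  calc _ ≤ (ENNReal.ofReal (3 * Real.pi * r) * ∫⁻ x, g x) / volume (ball (0:R2) r) := by gcongr
    _ = _ := by
      rw [vol_ball _ _ hr.le, div_eq_mul_inv, mul_right_comm, ← ENNReal.ofReal_inv_of_pos (by positivity),
        ← ENNReal.ofReal_mul (by positivity)]
      congr 2
      have := Real.pi_pos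
      field_simp
end

open MeasureTheory Metric Filter Set
open scoped ENNReal NNReal Topology Classical ContDiff Manifold Convolution
noncomputable section

/-- the isometry between the plane and `ℂ` -/
def toC : R2 ≃ₗᵢ[ℝ] ℂ := Complex.orthonormalBasisOneI.repr.symm

lemma toC_apply (z : R2) : toC z = ⟨z 0, z 1⟩ := by
  rw [toC, LinearIsometryEquiv.symm_apply_eq]
  ext i
  fin_cases i <;> simp [Complex.orthonormalBasisOneI]

@[simp] lemma toC_re (z : R2) : (toC z).re = z 0 := by rw [toC_apply]
@[simp] lemma toC_im (z : R2) : (toC z).im = z 1 := by rw [toC_apply]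

def dw (w : R2 → ℂ) (j : Fin 2) (x : R2) : ℂ := fderiv ℝ w x (ee j)

def perp (w : ℂ) : Fin 2 → ℝ := ![-w.im, w.re]

def kap (w : R2 → ℂ) (j : Fin 2) (x : R2) : ℝ := (w x).re * (dw w j x).im - (w x).im * (dw w j x).re

def Pu (w : R2 → ℂ) (x : R2) : R2 := ‖w x‖⁻¹ • toC.symm (w x)

def PG (w : R2 → ℂ) (x : R2) : Matrix (Fin 2) (Fin 2) ℝ := Matrix.of fun i j => perp (w x) i * kap w j x * (‖w x‖^3)⁻¹

def Den (w : R2 → ℂ) (x : R2) : ℝ := (‖dw w 0 x‖ + ‖dw w 1 x‖) * ‖w x‖⁻¹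

def jac (w : R2 → ℂ) (x : R2) : ℝ := (dw w 0 x).re * (dw w 1 x).im - (dw w 0 x).im * (dw w 1 x).re

structure GoodMap (Ω : Set R2) (w : R2 → ℂ) : Prop where
  smooth : ContDiff ℝ ∞ w
  int : IntegrableOn (Den w) Ω
  fin : {x ∈ Ω | w x = 0}.Finite
  nondeg : ∀ x ∈ Ω, w x = 0 → jac w x ≠ 0

def HH (G : R2 → Matrix (Fin 2) (Fin 2) ℝ) (x : R2) : ℝ := 1 + ∑ i, ∑ j, |G x i j|

def DD (u : R2 → R2) (G : R2 → Matrix (Fin 2) (Fin 2) ℝ) (w : R2 → ℂ) (x : R2) : ℝ :=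
  (∑ i, HH G x * |Pu w x i - u x i|) + ∑ i, ∑ j, |PG w x i j - G x i j|

lemma symm_toC_0 (z : ℂ) : toC.symm z 0 = z.re := by rw [← toC_re, LinearIsometryEquiv.apply_symm_apply]
lemma symm_toC_1 (z : ℂ) : toC.symm z 1 = z.im := by rw [← toC_im, LinearIsometryEquiv.apply_symm_apply]

lemma abs_perp_le (w : ℂ) (i : Fin 2) : |perp w i| ≤ ‖w‖ := by
  fin_cases i
  · simpa [perp] using Complex.abs_im_le_norm w
  · simpa [perp] using Complex.abs_re_le_norm w

lemma kap_eq (w : R2 → ℂ) (j : Fin 2) (x : R2) : kap w j x = (starRingEnd ℂ (w x) * dw w j x).im := by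
  simp [kap]; ring

lemma abs_kap_le (w : R2 → ℂ) (j : Fin 2) (x : R2) : |kap w j x| ≤ ‖w x‖ * ‖dw w j x‖ := by
  rw [kap_eq]
  refine (Complex.abs_im_le_norm _).trans ?_
  rw [norm_mul]; simp

lemma abs_Pu_le (w : R2 → ℂ) (x : R2) (i : Fin 2) : |Pu w x i| ≤ 1 := by
  refine (coord_le_norm _ i).trans ?_
  rw [Pu, norm_smul, LinearIsometryEquiv.norm_map, norm_inv, norm_norm]
  exact inv_mul_le_one

lemma abs_PG_le (w : R2 → ℂ) (x : R2) (i j : Fin 2) : |PG w x i j| ≤ ‖dw w j x‖ * ‖w x‖⁻¹ := by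
  simp only [PG, Matrix.of_apply]
  rw [abs_mul, abs_mul, abs_inv, abs_of_nonneg (a := ‖w x‖^3) (by positivity)]
  by_cases h : ‖w x‖ = 0
  · simp [h]
  calc _ ≤ ‖w x‖ * (‖w x‖ * ‖dw w j x‖) * (‖w x‖ ^ 3)⁻¹ := by
        gcongr
        · exact abs_perp_le _ _
        · exact abs_kap_le _ _ _
    _ = _ := by field_simp

lemma abs_PG_le_Den (w : R2 → ℂ) (x : R2) (i j : Fin 2) : |PG w x i j| ≤ Den w x := by
  refine (abs_PG_le w x i j).trans ?_
  unfold Den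
  gcongr
  fin_cases j <;> simp

lemma dw_cont {w : R2 → ℂ} (hw : ContDiff ℝ ∞ w) (j : Fin 2) : Continuous (dw w j) :=
  (hw.continuous_fderiv (by simp)).clm_apply continuous_const

lemma kap_cont {w : R2 → ℂ} (hw : ContDiff ℝ ∞ w) (j : Fin 2) : Continuous (kap w j) := by
  have := dw_cont hw j
  have := hw.continuous
  unfold kap
  fun_prop

lemma perp_cont (i : Fin 2) : Continuous (fun w : ℂ => perp w i) := by
  fin_cases i <;> simp [perp] <;> fun_prop

lemma Pu_meas {w : R2 → ℂ} (hw : ContDiff ℝ ∞ w) : Measurable (Pu w) := by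
  have h1 : Measurable w := hw.continuous.measurable
  have h2 : Measurable (fun x => toC.symm (w x)) := (toC.symm.continuous.comp hw.continuous).measurable
  unfold Pu
  fun_prop

lemma PG_meas {w : R2 → ℂ} (hw : ContDiff ℝ ∞ w) (i j : Fin 2) : Measurable (fun x => PG w x i j) := by
  have h1 : Measurable w := hw.continuous.measurable
  have h2 : Measurable (kap w j) := (kap_cont hw j).measurable
  have h3 : Measurable (fun x => perp (w x) i) := ((perp_cont i).comp hw.continuous).measurable
  simp only [PG, Matrix.of_apply]
  fun_prop

lemma Den_meas {w : R2 → ℂ} (hw : ContDiff ℝ ∞ w) : Measurable (Den w) := by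
  have h1 : Measurable w := hw.continuous.measurable
  have h2 := fun j => (dw_cont hw j).measurable
  have := h2 0
  have := h2 1
  unfold Den
  fun_prop

lemma coord_meas (i : Fin 2) : Measurable (fun x : R2 => x i) :=
  (EuclideanSpace.proj (𝕜 := ℝ) i : R2 →L[ℝ] ℝ).continuous.measurable

end

open MeasureTheory Metric Filter Set
open scoped ENNReal NNReal Topology Classical ContDiff Manifold Convolution
noncomputable section

lemma ee_expand (z : R2) : z = z 0 • ee 0 + z 1 • ee 1 := by
  ext i; fin_cases i <;> simp [ee]

lemma fderiv_expand (w : R2 → ℂ) (x z : R2) : fderiv ℝ w x z = z 0 • dw w 0 x + z 1 • dw w 1 x := by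
  conv_lhs => rw [ee_expand z]
  simp [dw]

lemma fderiv_inj (w : R2 → ℂ) (x : R2) (h : jac w x ≠ 0) (z : R2) (hz : fderiv ℝ w x z = 0) : z = 0 := by
  rw [fderiv_expand] at hz
  have h1 := congrArg Complex.re hz
  have h2 := congrArg Complex.im hz
  simp at h1 h2
  have e0 : z 0 * jac w x = 0 := by unfold jac; linear_combination (dw w 1 x).im * h1 - (dw w 1 x).re * h2
  have e1 : z 1 * jac w x = 0 := by unfold jac; linear_combination (dw w 0 x).re * h2 - (dw w 0 x).im * h1
  have e0 := (mul_eq_zero.1 e0).resolve_right h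
  have e1 := (mul_eq_zero.1 e1).resolve_right h
  rw [ee_expand z, e0, e1]; simp

lemma fderiv_antilip (w : R2 → ℂ) (x : R2) (h : jac w x ≠ 0) : ∃ C : ℝ, 0 < C ∧ ∀ z, ‖z‖ ≤ C * ‖fderiv ℝ w x z‖ := by
  have : LinearMap.ker (fderiv ℝ w x : R2 →ₗ[ℝ] ℂ) = ⊥ := by
    rw [LinearMap.ker_eq_bot']
    exact fderiv_inj w x h
  obtain ⟨K, hK, hK2⟩ := LinearMap.exists_antilipschitzWith _ this
  refine ⟨K, hK, fun z => ?_⟩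
  have := hK2.le_mul_dist z 0
  simpa using this

lemma zero_isolated {w : R2 → ℂ} (hw : ContDiff ℝ ∞ w) (x : R2) (h0 : w x = 0) (h : jac w x ≠ 0) :
    ∀ᶠ z in 𝓝[≠] x, w z ≠ 0 := by
  obtain ⟨C, hC, hC2⟩ := fderiv_antilip w x h
  exact (hw.differentiable (by simp) x).hasFDerivAt.eventually_ne
    ⟨⟨C, hC.le⟩, AntilipschitzWith.of_le_mul_dist fun y z => by
      have := hC2 (y - z)
      rw [map_sub] at this
      rw [dist_eq_norm, dist_eq_norm]; exact this⟩

lemma zeros_finite {w : R2 → ℂ} (hw : ContDiff ℝ ∞ w) (K : Set R2) (hK : IsCompact K)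
    (h : ∀ x ∈ K, w x = 0 → jac w x ≠ 0) : {x ∈ K | w x = 0}.Finite := by
  by_contra hinf
  obtain ⟨x, hx, hacc⟩ := Set.Infinite.exists_accPt_of_subset_isCompact (K := K) hinf hK (fun x hx => hx.1)
  have hcl : IsClosed {x ∈ K | w x = 0} := hK.isClosed.inter (isClosed_singleton.preimage hw.continuous)
  have hx2 : x ∈ {x ∈ K | w x = 0} := hcl.closure_subset_iff.2 subset_rfl (mem_closure_iff_clusterPt.2 hacc.clusterPt)
  have h3 := zero_isolated hw x hx2.2 (h x hx hx2.2)
  rw [accPt_iff_frequently_nhdsNE] at hacc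
  exact hacc (h3.mono fun z hz hz2 => hz hz2.2)

lemma dw_toC (V : R2 → R2) (hV : ContDiff ℝ ∞ V) (a : R2) (j : Fin 2) (x : R2) :
    dw (fun x => toC (V x - a)) j x = toC (fderiv ℝ V x (ee j)) := by
  have h1 := ((hV.differentiable (by simp)) x).hasFDerivAt.sub_const a
  have h2 : HasFDerivAt (fun x => toC (V x - a)) _ x := (toC.toContinuousLinearEquiv : R2 →L[ℝ] ℂ).hasFDerivAt.comp x h1
  rw [dw, h2.fderiv]
  rfl

lemma jac_toC (V : R2 → R2) (hV : ContDiff ℝ ∞ V) (a : R2) (x : R2) :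
    jac (fun x => toC (V x - a)) x = (fderiv ℝ V x).det := by
  have : (fderiv ℝ V x).det = Matrix.det (LinearMap.toMatrix (EuclideanSpace.basisFun (Fin 2) ℝ).toBasis (EuclideanSpace.basisFun (Fin 2) ℝ).toBasis (fderiv ℝ V x : R2 →ₗ[ℝ] R2)) := by
    rw [LinearMap.det_toMatrix]
  rw [this, Matrix.det_fin_two, jac, dw_toC V hV, dw_toC V hV]
  simp [LinearMap.toMatrix_apply]
  ring

end

open MeasureTheory Metric Filter Set
open scoped ENNReal NNReal Topology Classical ContDiff Manifold Convolution
noncomputable section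

lemma HH_int {Ω : Set R2} (hΩb : Bornology.IsBounded Ω) {u : R2 → R2} {G : R2 → Matrix (Fin 2) (Fin 2) ℝ}
    (hu : MemW11 Ω u G) : IntegrableOn (HH G) Ω := by
  unfold HH
  apply Integrable.add (cont_intOn hΩb continuous_const)
  apply integrable_finsetSum; intro i _
  apply integrable_finsetSum; intro j _
  exact (hu.2.1 i j).abs

/-- vector field from components -/
def vecV (V : Fin 2 → R2 → ℝ) (x : R2) : R2 := WithLp.toLp 2 fun i => V i x

lemma vecV_smooth (V : Fin 2 → R2 → ℝ) (hV : ∀ i, ContDiff ℝ ∞ (V i)) : ContDiff ℝ ∞ (vecV V) :=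
  contDiff_euclidean.2 hV

lemma vecV_fderiv (V : Fin 2 → R2 → ℝ) (hV : ∀ i, ContDiff ℝ ∞ (V i)) (x v : R2) (i : Fin 2) :
    fderiv ℝ (vecV V) x v i = fderiv ℝ (V i) x v := by
  have h := ((vecV_smooth V hV).differentiable (by simp) x).hasFDerivAt
  have h2 : HasFDerivAt (V i) _ x := (EuclideanSpace.proj (𝕜 := ℝ) i : R2 →L[ℝ] ℝ).hasFDerivAt.comp x h
  rw [h2.fderiv]; rfl

def SS (V : Fin 2 → R2 → ℝ) (x : R2) : ℝ := ∑ i, ∑ j, |fderiv ℝ (V i) x (ee j)|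

lemma SS_cont (V : Fin 2 → R2 → ℝ) (hV : ∀ i, ContDiff ℝ ∞ (V i)) : Continuous (SS V) := by
  unfold SS
  refine continuous_finsetSum _ fun i _ => continuous_finsetSum _ fun j _ => ?_
  exact (((hV i).continuous_fderiv (by simp)).clm_apply continuous_const).abs

lemma dw_le_SS (V : Fin 2 → R2 → ℝ) (hV : ∀ i, ContDiff ℝ ∞ (V i)) (a x : R2) :
    ‖dw (fun x => toC (vecV V x - a)) 0 x‖ + ‖dw (fun x => toC (vecV V x - a)) 1 x‖ ≤ SS V x := by
  have h : ∀ j, ‖dw (fun x => toC (vecV V x - a)) j x‖ ≤ |fderiv ℝ (V 0) x (ee j)| + |fderiv ℝ (V 1) x (ee j)| := by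
    intro j
    rw [dw_toC _ (vecV_smooth V hV)]
    refine (Complex.norm_le_abs_re_add_abs_im _).trans ?_
    rw [toC_re, toC_im, vecV_fderiv V hV, vecV_fderiv V hV]
  have h0 := h 0
  have h1 := h 1
  simp only [SS, Fin.sum_univ_two]
  linarith

lemma Den_le_SS (V : Fin 2 → R2 → ℝ) (hV : ∀ i, ContDiff ℝ ∞ (V i)) (a x : R2) :
    Den (fun x => toC (vecV V x - a)) x ≤ SS V x * ‖vecV V x - a‖⁻¹ := by
  unfold Den
  dsimp only
  rw [LinearIsometryEquiv.norm_map]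
  gcongr
  exact dw_le_SS V hV a x

lemma PG_expand (V : Fin 2 → R2 → ℝ) (hV : ∀ i, ContDiff ℝ ∞ (V i)) (a x : R2) (i j : Fin 2) :
    PG (fun x => toC (vecV V x - a)) x i j =
      ∑ k, (perp (toC (vecV V x - a)) i * perp (toC (vecV V x - a)) k * (‖vecV V x - a‖^3)⁻¹) * fderiv ℝ (V k) x (ee j) := by
  simp only [PG, Matrix.of_apply, kap, dw_toC _ (vecV_smooth V hV), toC_re, toC_im, vecV_fderiv V hV, LinearIsometryEquiv.norm_map, Fin.sum_univ_two, perp, Matrix.cons_val_zero, Matrix.cons_val_one]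
  ring

lemma goodmap_of_choice {Ω : Set R2} (hΩo : IsOpen Ω) (hΩb : Bornology.IsBounded Ω) (V : Fin 2 → R2 → ℝ) (hV : ∀ i, ContDiff ℝ ∞ (V i)) (a : R2)
    (ha : ‖a‖ ≤ 1/4)
    (hfin : ∫⁻ x, (Ω ∩ {x | ‖vecV V x‖ ≤ 1/2}).indicator (fun x => ENNReal.ofReal (SS V x)) x * ENNReal.ofReal (‖vecV V x - a‖⁻¹) ≠ ⊤)
    (hreg : ∀ x, vecV V x = a → (fderiv ℝ (vecV V) x).det ≠ 0) : GoodMap Ω (fun x => toC (vecV V x - a)) := by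
  have hs : ContDiff ℝ ∞ (fun x => toC (vecV V x - a)) := toC.contDiff.comp ((vecV_smooth V hV).sub contDiff_const)
  have hnd : ∀ x, toC (vecV V x - a) = 0 → jac (fun x => toC (vecV V x - a)) x ≠ 0 := by
    intro x hx
    rw [jac_toC _ (vecV_smooth V hV)]
    apply hreg
    rw [LinearIsometryEquiv.map_eq_zero_iff, sub_eq_zero] at hx
    exact hx
  refine ⟨hs, ?_, ?_, fun x _ => hnd x⟩
  · refine ⟨(Den_meas hs).aestronglyMeasurable, ?_⟩
    rw [hasFiniteIntegral_iff_ofReal (ae_of_all _ fun x => by unfold Den; positivity)]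
    have h4 : ∫⁻ x in Ω, ENNReal.ofReal (4 * SS V x) ≠ ⊤ := by
      have : IntegrableOn (fun x => 4 * SS V x) Ω := cont_intOn hΩb (continuous_const.mul (SS_cont V hV))
      rw [← ofReal_integral_eq_lintegral_ofReal this]
      · exact ENNReal.ofReal_ne_top
      · exact ae_of_all _ fun x => by simp only [SS]; positivity
    refine lt_of_le_of_lt ?_ (ENNReal.add_lt_top.2 ⟨hfin.lt_top, h4.lt_top⟩)
    rw [← lintegral_indicator hΩo.measurableSet, ← lintegral_indicator hΩo.measurableSet]
    have hm : Measurable (fun x => Ω.indicator (fun x => ENNReal.ofReal (4 * SS V x)) x) :=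
      Measurable.indicator (by have := (SS_cont V hV).measurable; fun_prop) hΩo.measurableSet
    rw [← lintegral_add_right _ hm]
    apply lintegral_mono
    intro x; dsimp only
    have hd := Den_le_SS V hV a x
    have hS0 : 0 ≤ SS V x := by simp only [SS]; positivity
    by_cases hx : x ∈ Ω
    · rw [indicator_of_mem hx, indicator_of_mem hx]
      by_cases h2 : ‖vecV V x‖ ≤ 1/2
      · have hxx : x ∈ Ω ∩ {x | ‖vecV V x‖ ≤ 1/2} := ⟨hx, h2⟩
        rw [indicator_of_mem hxx, ← ENNReal.ofReal_mul hS0]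
        exact (ENNReal.ofReal_le_ofReal hd).trans le_self_add
      · refine le_trans (ENNReal.ofReal_le_ofReal (hd.trans ?_)) le_add_self
        have : ‖vecV V x - a‖⁻¹ ≤ 4 := by
          have h3 := norm_sub_norm_le (vecV V x) a
          have : (1/4:ℝ) ≤ ‖vecV V x - a‖ := by linarith
          calc _ ≤ (1/4:ℝ)⁻¹ := inv_anti₀ (by norm_num) this
            _ = 4 := by norm_num
        rw [mul_comm]; gcongr
    · rw [indicator_of_notMem hx]; exact zero_le
  · exact (zeros_finite hs (closure Ω) hΩb.isCompact_closure (fun x _ => hnd x)).subset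
      fun x hx => ⟨subset_closure hx.1, hx.2⟩

end

open MeasureTheory Metric Filter Set
open scoped ENNReal NNReal Topology Classical ContDiff Manifold Convolution
noncomputable section

/-- the multipliers -/
def mm (v : R2) (i k : Fin 2) : ℝ := perp (toC v) i * perp (toC v) k * (‖v‖^3)⁻¹

lemma mm_bound (v : R2) (i k : Fin 2) (hv : 1/4 ≤ ‖v‖) : |mm v i k| ≤ 4 := by
  have hp : 0 < ‖v‖ := by linarith
  unfold mm
  rw [abs_mul, abs_mul, abs_inv, abs_of_nonneg (a := ‖v‖^3) (by positivity)]
  calc _ ≤ ‖v‖ * ‖v‖ * (‖v‖ ^ 3)⁻¹ := by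
        gcongr
        · simpa using abs_perp_le (toC v) i
        · simpa using abs_perp_le (toC v) k
    _ = ‖v‖⁻¹ := by field_simp
    _ ≤ (1/4:ℝ)⁻¹ := inv_anti₀ (by norm_num) hv
    _ = 4 := by norm_num

lemma mm_cont (v : R2) (i k : Fin 2) (hv : v ≠ 0) : ContinuousAt (fun v => mm v i k) v := by
  unfold mm
  have h1 : ∀ i, Continuous (fun v => perp (toC v) i) := fun i => (perp_cont i).comp toC.continuous
  apply ContinuousAt.mul
  · exact ((h1 i).mul (h1 k)).continuousAt
  · apply ContinuousAt.inv₀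
    · fun_prop
    · positivity

lemma mm_meas (i k : Fin 2) : Measurable (fun v => mm v i k) := by
  have h1 : ∀ i, Measurable (fun v => perp (toC v) i) := fun i => ((perp_cont i).comp toC.continuous).measurable
  have := h1 i
  have := h1 k
  unfold mm
  fun_prop

lemma mm_sum (v : R2) (hv : ‖v‖ = 1) (g : Fin 2 → ℝ) (ho : v 0 * g 0 + v 1 * g 1 = 0) (i : Fin 2) :
    ∑ k, mm v i k * g k = g i := by
  have h2 : (v 0)^2 + (v 1)^2 = 1 := by
    have := EuclideanSpace.norm_sq_eq v
    rw [hv, Fin.sum_univ_two] at this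
    simp at this
    linarith
  rw [Fin.sum_univ_two]
  simp only [mm, hv]
  fin_cases i <;> simp [perp]
  · linear_combination g 0 * h2 - v 0 * ho
  · linear_combination g 1 * h2 - v 1 * ho

lemma Mn_conv (Ω : Set R2) (u : R2 → R2) (G : R2 → Matrix (Fin 2) (Fin 2) ℝ)
    (hu : MemW11 Ω u G) (hS : SphereValued Ω u) (V) (hV : ApproxSeq Ω u G V)
    (hvc : ∀ᵐ x ∂(volume.restrict Ω), Tendsto (fun n => vecV (V n) x) atTop (𝓝 (u x))) (hΩo : IsOpen Ω) :
    Tendsto (fun n => ∫⁻ x, (Ω ∩ {x | ‖vecV (V n) x‖ ≤ 1/2}).indicator (fun x => ENNReal.ofReal (SS (V n) x)) x) atTop (𝓝 0) := by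
  set χ : ℕ → R2 → ℝ := fun n => {x | ‖vecV (V n) x‖ ≤ 1/2}.indicator (fun _ => 1) with hχ
  have hset : ∀ n, MeasurableSet {x | ‖vecV (V n) x‖ ≤ 1/2} := fun n =>
    measurableSet_le (vecV_smooth (V n) (hV.smooth n)).continuous.norm.measurable measurable_const
  have hc : ∀ i j, Tendsto (fun n => ∫⁻ x in Ω, ‖χ n x * fderiv ℝ (V n i) x (ee j) - 0 * G x i j‖ₑ) atTop (𝓝 0) := by
    intro i j
    refine mulconv _ _ _ (hu.2.1 i j) (fun n => (((hV.smooth n i).continuous_fderiv (by simp)).clm_apply continuous_const).aestronglyMeasurable) (hV.dconv i j) χ (fun _ => 0) 1 ?_ ?_ ?_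
    · intro n
      exact (measurable_const.indicator (hset n)).aestronglyMeasurable
    · intro n x
      simp only [hχ, indicator]; split_ifs <;> simp
    · filter_upwards [hvc, hS] with x hx hx1
      have h1 := hx.norm
      rw [hx1] at h1
      have h2 := h1.eventually (lt_mem_nhds (show (1/2:ℝ) < 1 by norm_num))
      apply tendsto_const_nhds.congr'
      filter_upwards [h2] with n hn
      simp only [hχ]
      rw [indicator_of_notMem]
      simpa using hn
  have hs := tendsto_finsetSum Finset.univ fun (i : Fin 2) _ => tendsto_finsetSum Finset.univ fun (j : Fin 2) _ => hc i j
  simp only [Finset.sum_const_zero] at hs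
  refine tendsto_of_tendsto_of_tendsto_of_le_of_le tendsto_const_nhds hs (fun n => zero_le) ?_
  intro n
  dsimp only
  have hm : ∀ i j, Measurable (fun x => ‖χ n x * fderiv ℝ (V n i) x (ee j) - 0 * G x i j‖ₑ) := by
    intro i j
    have h1 := (((hV.smooth n i).continuous_fderiv (by simp)).clm_apply (continuous_const (y := ee j))).measurable
    have h2 : Measurable (χ n) := (measurable_const.indicator (hset n))
    simp only [zero_mul, sub_zero]
    exact (h2.mul h1).enorm
  rw [Finset.sum_congr rfl fun i _ => (lintegral_finsetSum _ fun j _ => hm i j).symm,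
    ← lintegral_finsetSum _ fun i _ => Finset.measurable_sum _ fun j _ => hm i j,
    ← lintegral_indicator hΩo.measurableSet]
  apply lintegral_mono
  intro x; dsimp only
  by_cases hx : x ∈ Ω
  · rw [indicator_of_mem hx]
    by_cases h2 : ‖vecV (V n) x‖ ≤ 1/2
    · have hxx : x ∈ Ω ∩ {x | ‖vecV (V n) x‖ ≤ 1/2} := ⟨hx, h2⟩
      rw [indicator_of_mem hxx]
      have : χ n x = 1 := indicator_of_mem (s := {x | ‖vecV (V n) x‖ ≤ 1/2}) h2 _
      simp only [this, one_mul, zero_mul, sub_zero]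
      simp only [SS, Fin.sum_univ_two]
      simp only [← ofReal_norm, Real.norm_eq_abs]
      rw [ENNReal.ofReal_add (by positivity) (by positivity), ENNReal.ofReal_add (by positivity) (by positivity), ENNReal.ofReal_add (by positivity) (by positivity)]
    · rw [indicator_of_notMem (fun h => h2 h.2)]; exact zero_le
  · rw [indicator_of_notMem (fun h => hx h.1)]; exact zero_le

lemma propA (Ω : Set R2) (hΩo : IsOpen Ω) (hΩb : Bornology.IsBounded Ω) (hΩl : HasLipschitzBoundary Ω)
    (u : R2 → R2) (G : R2 → Matrix (Fin 2) (Fin 2) ℝ)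
    (hu : MemW11 Ω u G) (hS : SphereValued Ω u) (ε : ℝ≥0∞) (hε : 0 < ε) :
    ∃ w, GoodMap Ω w ∧ ∫⁻ x in Ω, ENNReal.ofReal (DD u G w x) < ε := by
  obtain ⟨V, hV⟩ := exists_approxSeq Ω hΩo hΩb hΩl u G hu
  have hvc : ∀ᵐ x ∂(volume.restrict Ω), Tendsto (fun n => vecV (V n) x) atTop (𝓝 (u x)) := by
    filter_upwards [hV.aeconv] with x hx
    have h1 : Tendsto (fun n i => V n i x) atTop (𝓝 (fun i => u x i)) := tendsto_pi_nhds.2 hx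
    exact ((PiLp.continuous_toLp 2 (fun _ : Fin 2 => ℝ)).tendsto _).comp h1
  have ho := fun j => orthog Ω hΩo hΩb u G hu hS V hV j
  have hM := Mn_conv Ω u G hu hS V hV hvc hΩo
  set g : ℕ → R2 → ℝ≥0∞ := fun n => (Ω ∩ {x | ‖vecV (V n) x‖ ≤ 1/2}).indicator (fun x => ENNReal.ofReal (SS (V n) x)) with hg
  have hset : ∀ n, MeasurableSet {x | ‖vecV (V n) x‖ ≤ 1/2} := fun n =>
    measurableSet_le (vecV_smooth (V n) (hV.smooth n)).continuous.norm.measurable measurable_const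
  have hgm : ∀ n, Measurable (g n) := fun n => Measurable.indicator
    (by have := (SS_cont (V n) (hV.smooth n)).measurable; fun_prop) (hΩo.measurableSet.inter (hset n))
  have hS0 : ∀ n x, 0 ≤ SS (V n) x := fun n x => by simp only [SS]; positivity
  set M : ℕ → ℝ≥0∞ := fun n => ∫⁻ x, g n x with hMdef
  have hMfin : ∀ n, M n ≠ ⊤ := by
    intro n
    have h4 : ∫⁻ x in Ω, ENNReal.ofReal (SS (V n) x) ≠ ⊤ := by
      rw [← ofReal_integral_eq_lintegral_ofReal (cont_intOn hΩb (SS_cont (V n) (hV.smooth n))) (ae_of_all _ (hS0 n))]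
      exact ENNReal.ofReal_ne_top
    refine ne_top_of_le_ne_top h4 ?_
    rw [← lintegral_indicator hΩo.measurableSet]
    apply lintegral_mono
    exact indicator_le_indicator_of_subset inter_subset_left (fun _ => zero_le)
  have hMr : Tendsto (fun n => (M n).toReal) atTop (𝓝 0) := by
    have := (ENNReal.tendsto_toReal ENNReal.zero_ne_top).comp hM
    rw [ENNReal.toReal_zero] at this
    exact this
  set r0 : ℕ → ℝ := fun n => Real.sqrt (M n).toReal + 1 / ((n:ℝ) + 1)
  have hr0 : ∀ n, 0 < r0 n := fun n => by positivity
  have hr0l : Tendsto r0 atTop (𝓝 0) := by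
    have h1 : Tendsto (fun n => Real.sqrt (M n).toReal) atTop (𝓝 0) := by
      have := hMr.sqrt; simpa using this
    have := h1.add tendsto_one_div_add_atTop_nhds_zero_nat
    rw [add_zero] at this
    exact this
  set r : ℕ → ℝ := fun n => min (1/4) (r0 n)
  have hr : ∀ n, 0 < r n := fun n => lt_min (by norm_num) (hr0 n)
  choose a ha1 ha2 ha3 using fun n => choose_a (vecV (V n)) (vecV_smooth _ (hV.smooth n)) (g n) (hgm n) (r n) (hr n)
  have ha4 : ∀ n, ‖a n‖ ≤ 1/4 := fun n => by
    have := ha1 n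
    rw [mem_ball_zero_iff] at this
    exact this.le.trans (min_le_left _ _)
  have hal : Tendsto a atTop (𝓝 0) := by
    apply squeeze_zero_norm (fun n => ?_) hr0l
    have := ha1 n
    rw [mem_ball_zero_iff] at this
    exact this.le.trans (min_le_right _ _)
  have hrem : Tendsto (fun n => ∫⁻ x, g n x * ENNReal.ofReal (‖vecV (V n) x - a n‖⁻¹)) atTop (𝓝 0) := by
    have hb : Tendsto (fun n => ENNReal.ofReal (12 * (M n).toReal + 3 * Real.sqrt (M n).toReal)) atTop (𝓝 0) := by
      have := ENNReal.tendsto_ofReal ((hMr.const_mul 12).add (hMr.sqrt.const_mul 3))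
      simpa using this
    refine tendsto_of_tendsto_of_tendsto_of_le_of_le tendsto_const_nhds hb (fun n => zero_le) ?_
    intro n
    refine (ha2 n).trans ?_
    change ENNReal.ofReal (3 / r n) * M n ≤ _
    rw [← ENNReal.ofReal_toReal (hMfin n), ← ENNReal.ofReal_mul (by have := hr n; positivity)]
    apply ENNReal.ofReal_le_ofReal
    have hnn : 0 ≤ (M n).toReal := ENNReal.toReal_nonneg
    have hsq : Real.sqrt (M n).toReal * Real.sqrt (M n).toReal = (M n).toReal := Real.mul_self_sqrt hnn
    have hs0 := Real.sqrt_nonneg (M n).toReal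
    rw [div_mul_eq_mul_div, div_le_iff₀ (hr n)]
    rcases min_choice (1/4) (r0 n) with h | h
    · simp only [r, h]; nlinarith
    · simp only [r, h]
      have h1 : Real.sqrt (M n).toReal ≤ r0 n := by
        simp only [r0]
        have : (0:ℝ) ≤ 1 / ((n:ℝ)+1) := by positivity
        linarith
      have h2 : 3 * Real.sqrt (M n).toReal * Real.sqrt (M n).toReal ≤ 3 * Real.sqrt (M n).toReal * r0 n := by gcongr
      have h3 : 0 ≤ 12 * (M n).toReal * r0 n := by have := hr0 n; positivity
      nlinarith
  have hgood : ∀ n, GoodMap Ω (fun x => toC (vecV (V n) x - a n)) := by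
    intro n
    apply goodmap_of_choice hΩo hΩb (V n) (hV.smooth n) (a n) (ha4 n) _ (ha3 n)
    exact ne_top_of_le_ne_top (ENNReal.mul_ne_top ENNReal.ofReal_ne_top (hMfin n)) (ha2 n)
  set W : ℕ → R2 → ℂ := fun n x => toC (vecV (V n) x - a n) with hW
  have hlim : ∀ᵐ x ∂(volume.restrict Ω), Tendsto (fun n => vecV (V n) x - a n) atTop (𝓝 (u x)) := by
    filter_upwards [hvc] with x hx
    have := hx.sub hal
    simpa using this
  -- part 1
  have c1 : ∀ i, Tendsto (fun n => ∫⁻ x in Ω, ‖(Pu (W n) x i - u x i) * HH G x - 0 * HH G x‖ₑ) atTop (𝓝 0) := by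
    intro i
    have hmeas : ∀ n, AEStronglyMeasurable (fun x => Pu (W n) x i - u x i) (volume.restrict Ω) := fun n =>
      (((coord_meas i).comp (Pu_meas (hgood n).smooth)).aestronglyMeasurable).sub (coord_integrable hu.1 i).1
    -- truncate to get an everywhere bound
    have := mulconv (volume.restrict Ω) (fun _ => HH G) (HH G) (HH_int hΩb hu) (fun _ => (HH_int hΩb hu).1) (by simp)
      (fun n x => max (-2) (min 2 (Pu (W n) x i - u x i))) (fun _ => 0) 2 ?_ ?_ ?_
    · refine this.congr fun n => ?_
      apply lintegral_congr_ae
      filter_upwards [hS] with x hx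
      have h1 := abs_Pu_le (W n) x i
      have h2 := coord_le_norm (u x) i
      rw [hx] at h2
      rw [abs_le] at h1 h2
      rw [min_eq_right (by linarith), max_eq_right (by linarith)]
    · intro n
      exact (aemeasurable_const.max (aemeasurable_const.min (hmeas n).aemeasurable)).aestronglyMeasurable
    · intro n x
      rw [abs_le]
      exact ⟨le_max_left _ _, max_le (by norm_num) (min_le_left _ _)⟩
    · filter_upwards [hlim, hS] with x hx hx1
      have h1 : Tendsto (fun n => Pu (W n) x i) atTop (𝓝 (u x i)) := by
        have hn := hx.norm
        rw [hx1] at hn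
        have h3 : Tendsto (fun n => ‖vecV (V n) x - a n‖⁻¹ • (vecV (V n) x - a n)) atTop (𝓝 (u x)) := by
          have := (hn.inv₀ one_ne_zero).smul hx
          simpa using this
        have h4 := ((EuclideanSpace.proj (𝕜 := ℝ) i : R2 →L[ℝ] ℝ).continuous.tendsto _).comp h3
        refine h4.congr fun n => ?_
        simp only [Pu, hW, LinearIsometryEquiv.norm_map, LinearIsometryEquiv.symm_apply_apply]
        rfl
      have h2 := h1.sub_const (u x i)
      rw [sub_self] at h2
      have h3 := (tendsto_const_nhds (x := (-2:ℝ))).max ((tendsto_const_nhds (x := (2:ℝ))).min h2)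
      simpa using h3
  -- part 2
  set χ : ℕ → R2 → ℝ := fun n => {x | ‖vecV (V n) x‖ ≤ 1/2}ᶜ.indicator (fun _ => 1) with hχ
  have c2 : ∀ i j k, Tendsto (fun n => ∫⁻ x in Ω, ‖(χ n x * mm (vecV (V n) x - a n) i k) * fderiv ℝ (V n k) x (ee j) - mm (u x) i k * G x k j‖ₑ) atTop (𝓝 0) := by
    intro i j k
    refine mulconv _ _ _ (hu.2.1 k j) (fun n => (((hV.smooth n k).continuous_fderiv (by simp)).clm_apply continuous_const).aestronglyMeasurable) (hV.dconv k j) (fun n x => χ n x * mm (vecV (V n) x - a n) i k) (fun x => mm (u x) i k) 4 ?_ ?_ ?_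
    · intro n
      apply Measurable.aestronglyMeasurable
      apply Measurable.mul
      · exact measurable_const.indicator (hset n).compl
      · exact (mm_meas i k).comp ((vecV_smooth _ (hV.smooth n)).continuous.measurable.sub_const _)
    · intro n x
      by_cases h : x ∈ {x | ‖vecV (V n) x‖ ≤ 1/2}
      · have : χ n x = 0 := indicator_of_notMem (by simpa using h) _
        rw [this]; simp
      · have : χ n x = 1 := indicator_of_mem h _
        rw [this, one_mul]
        apply mm_bound
        have h3 := norm_sub_norm_le (vecV (V n) x) (a n)
        have := ha4 n
        simp at h
        linarith
    · filter_upwards [hvc, hS, hlim] with x hx hx1 hx2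
      have h1 := hx.norm
      rw [hx1] at h1
      have h2 := h1.eventually (lt_mem_nhds (show (1/2:ℝ) < 1 by norm_num))
      have h3 : Tendsto (fun n => mm (vecV (V n) x - a n) i k) atTop (𝓝 (mm (u x) i k)) :=
        (mm_cont (u x) i k (by rw [← norm_ne_zero_iff, hx1]; simp)).tendsto.comp hx2
      refine h3.congr' ?_
      filter_upwards [h2] with n hn
      have : χ n x = 1 := indicator_of_mem (by simpa using hn) _
      rw [this, one_mul]
  have t1 := tendsto_finsetSum Finset.univ fun (i : Fin 2) _ => c1 i
  have t2 := tendsto_finsetSum Finset.univ fun (i : Fin 2) _ => tendsto_finsetSum Finset.univ fun (j : Fin 2) _ =>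
     (tendsto_finsetSum Finset.univ fun (k : Fin 2) _ => c2 i j k).add hrem
  have t3 := t1.add t2
  simp only [Finset.sum_const_zero, add_zero] at t3
  obtain ⟨n, hn⟩ := (t3.eventually (gt_mem_nhds hε)).exists
  refine ⟨W n, hgood n, lt_of_le_of_lt ?_ hn⟩
  have mA : ∀ i, AEMeasurable (fun x => ‖(Pu (W n) x i - u x i) * HH G x - 0 * HH G x‖ₑ) (volume.restrict Ω) := by
    intro i
    simp only [zero_mul, sub_zero]
    exact (((((coord_meas i).comp (Pu_meas (hgood n).smooth)).aestronglyMeasurable).sub (coord_integrable hu.1 i).1).mul (HH_int hΩb hu).1).enorm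
  have mB : ∀ i j k, AEMeasurable (fun x => ‖(χ n x * mm (vecV (V n) x - a n) i k) * fderiv ℝ (V n k) x (ee j) - mm (u x) i k * G x k j‖ₑ) (volume.restrict Ω) := by
    intro i j k
    apply AEMeasurable.enorm
    apply AEMeasurable.sub
    · apply Measurable.aemeasurable
      apply Measurable.mul
      · apply Measurable.mul
        · exact measurable_const.indicator (hset n).compl
        · exact (mm_meas i k).comp ((vecV_smooth _ (hV.smooth n)).continuous.measurable.sub_const _)
      · exact (((hV.smooth n k).continuous_fderiv (by simp)).clm_apply (continuous_const (y := ee j))).measurable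
    · exact ((mm_meas i k).comp_aemeasurable hu.1.1.aemeasurable).mul (hu.2.1 k j).1.aemeasurable
  have mR : Measurable (fun x => g n x * ENNReal.ofReal (‖vecV (V n) x - a n‖⁻¹)) := by
    have := hgm n
    have := (vecV_smooth _ (hV.smooth n)).continuous.measurable
    fun_prop
  calc ∫⁻ x in Ω, ENNReal.ofReal (DD u G (W n) x)
      ≤ ∫⁻ x in Ω, ((∑ i, ‖(Pu (W n) x i - u x i) * HH G x - 0 * HH G x‖ₑ) + ∑ i, ∑ j, ((∑ k, ‖(χ n x * mm (vecV (V n) x - a n) i k) * fderiv ℝ (V n k) x (ee j) - mm (u x) i k * G x k j‖ₑ) + g n x * ENNReal.ofReal (‖vecV (V n) x - a n‖⁻¹))) := by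
        apply lintegral_mono_ae
        filter_upwards [hS, ho 0, ho 1, ae_restrict_mem hΩo.measurableSet] with x hx ho0 ho1 hxΩ
        have hH0 : 0 ≤ HH G x := by unfold HH; positivity
        have hoj : ∀ j, u x 0 * G x 0 j + u x 1 * G x 1 j = 0 := by
          intro j; fin_cases j
          · exact ho0
          · exact ho1
        unfold DD
        rw [ENNReal.ofReal_add (by positivity) (by positivity), ENNReal.ofReal_sum_of_nonneg (fun i _ => by positivity),
          ENNReal.ofReal_sum_of_nonneg (fun i _ => by positivity)]
        refine add_le_add (Finset.sum_le_sum fun i _ => ?_) (Finset.sum_le_sum fun i _ => ?_)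
        · rw [zero_mul, sub_zero, ← ofReal_norm, Real.norm_eq_abs, abs_mul, abs_of_nonneg hH0, mul_comm]
        rw [ENNReal.ofReal_sum_of_nonneg (fun i _ => by positivity)]
        refine Finset.sum_le_sum fun j _ => ?_
        have e1 := PG_expand (V n) (hV.smooth n) (a n) x i j
        have e2 := mm_sum (u x) hx (fun k => G x k j) (hoj j) i
        by_cases h : ‖vecV (V n) x‖ ≤ 1/2
        · have h0 : χ n x = 0 := indicator_of_notMem (by simpa using h) _
          have hxx : x ∈ Ω ∩ {x | ‖vecV (V n) x‖ ≤ 1/2} := ⟨hxΩ, h⟩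
          have h1 : g n x = ENNReal.ofReal (SS (V n) x) := by simp only [hg]; rw [indicator_of_mem hxx]
          rw [h1, h0, ← ENNReal.ofReal_mul (hS0 n x)]
          have h2 : |PG (W n) x i j - G x i j| ≤ (∑ k, |mm (u x) i k * G x k j|) + SS (V n) x * ‖vecV (V n) x - a n‖⁻¹ := by
            have h3 := (abs_PG_le_Den (W n) x i j).trans (Den_le_SS (V n) (hV.smooth n) (a n) x)
            have h4 := abs_sub (PG (W n) x i j) (G x i j)
            have h5 : |G x i j| ≤ ∑ k, |mm (u x) i k * G x k j| := by
              rw [← e2]; exact Finset.abs_sum_le_sum_abs _ _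
            linarith
          refine (ENNReal.ofReal_le_ofReal h2).trans ?_
          rw [ENNReal.ofReal_add (by positivity) (mul_nonneg (hS0 n x) (by positivity)), ENNReal.ofReal_sum_of_nonneg (fun i _ => by positivity)]
          gcongr with k
          rw [← ofReal_norm]
          simp
        · have h0 : χ n x = 1 := indicator_of_mem h _
          refine le_trans ?_ le_self_add
          have h2 : |PG (W n) x i j - G x i j| ≤ (∑ k, |(χ n x * mm (vecV (V n) x - a n) i k) * fderiv ℝ (V n k) x (ee j) - mm (u x) i k * G x k j|) := by
            simp only [h0, one_mul]
            rw [← e2, e1, ← Finset.sum_sub_distrib]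
            exact Finset.abs_sum_le_sum_abs _ _
          refine (ENNReal.ofReal_le_ofReal h2).trans ?_
          rw [ENNReal.ofReal_sum_of_nonneg (fun i _ => by positivity)]
          gcongr with k
          rw [← ofReal_norm, Real.norm_eq_abs]
    _ = (∑ i, ∫⁻ x in Ω, ‖(Pu (W n) x i - u x i) * HH G x - 0 * HH G x‖ₑ) + ∑ i, ∑ j, ((∑ k, ∫⁻ x in Ω, ‖(χ n x * mm (vecV (V n) x - a n) i k) * fderiv ℝ (V n k) x (ee j) - mm (u x) i k * G x k j‖ₑ) + ∫⁻ x in Ω, g n x * ENNReal.ofReal (‖vecV (V n) x - a n‖⁻¹)) := by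
        have mS : ∀ i j, AEMeasurable (fun x => (∑ k, ‖(χ n x * mm (vecV (V n) x - a n) i k) * fderiv ℝ (V n k) x (ee j) - mm (u x) i k * G x k j‖ₑ) + g n x * ENNReal.ofReal (‖vecV (V n) x - a n‖⁻¹)) (volume.restrict Ω) := by
          intro i j
          exact (Finset.aemeasurable_fun_sum _ fun k _ => mB i j k).add mR.aemeasurable
        rw [lintegral_add_left' (Finset.aemeasurable_fun_sum _ fun i _ => mA i), lintegral_finsetSum' _ fun i _ => mA i]
        congr 1
        rw [lintegral_finsetSum' _ fun i _ => Finset.aemeasurable_fun_sum _ fun j _ => mS i j]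
        refine Finset.sum_congr rfl fun i _ => ?_
        rw [lintegral_finsetSum' _ fun j _ => mS i j]
        refine Finset.sum_congr rfl fun j _ => ?_
        rw [lintegral_add_right _ mR, lintegral_finsetSum' _ fun k _ => mB i j k]
    _ ≤ _ := by
        gcongr
        exact Measure.restrict_le_self
end

open MeasureTheory Metric Filter Set
open scoped ENNReal NNReal Topology Classical ContDiff Manifold Convolution
noncomputable section

def tau (σ : Bool) : R2 ≃ₗᵢ[ℝ] ℂ := if σ then toC else toC.trans Complex.conjLIE

lemma jac_decomp (w : R2 → ℂ) (p : R2) (h : jac w p ≠ 0) :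
    ∃ (σ : Bool) (α β : ℂ), ‖β‖ < ‖α‖ ∧ ∀ z, fderiv ℝ w p z = α * tau σ z + β * starRingEnd ℂ (tau σ z) := by
  set a0 : ℂ := (dw w 0 p - Complex.I * dw w 1 p) / 2 with ha
  set b0 : ℂ := (dw w 0 p + Complex.I * dw w 1 p) / 2 with hb
  have hd : ‖a0‖^2 - ‖b0‖^2 = jac w p := by
    rw [← Complex.normSq_eq_norm_sq, ← Complex.normSq_eq_norm_sq, Complex.normSq_apply, Complex.normSq_apply, ha, hb]
    simp [jac]
    ring
  have hf : ∀ z, fderiv ℝ w p z = a0 * toC z + b0 * starRingEnd ℂ (toC z) := by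
    intro z
    rw [fderiv_expand, ha, hb]
    apply Complex.ext <;> simp <;> ring
  rcases lt_or_gt_of_ne h with h | h
  · refine ⟨false, b0, a0, ?_, fun z => ?_⟩
    · rw [← sq_lt_sq₀ (norm_nonneg _) (norm_nonneg _)]; linarith
    · rw [hf]; simp [tau]; ring
  · refine ⟨true, a0, b0, ?_, fun z => ?_⟩
    · rw [← sq_lt_sq₀ (norm_nonneg _) (norm_nonneg _)]; linarith
    · rw [hf]; simp [tau]

def bump0 : ContDiffBump (0:R2) := ⟨1/2, 1, by norm_num, by norm_num⟩

def chi (p : R2) (s : ℝ) (z : R2) : ℝ := bump0 (s⁻¹ • (z - p))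

lemma chi_smooth (p : R2) (s : ℝ) : ContDiff ℝ ∞ (chi p s) :=
  bump0.contDiff.comp ((contDiff_id.sub contDiff_const).const_smul s⁻¹)

lemma chi_nonneg (p : R2) (s : ℝ) (z : R2) : 0 ≤ chi p s z := bump0.nonneg
lemma chi_le (p : R2) (s : ℝ) (z : R2) : chi p s z ≤ 1 := bump0.le_one

lemma chi_one (p : R2) (s : ℝ) (hs : 0 < s) (z : R2) (hz : ‖z - p‖ ≤ s / 2) : chi p s z = 1 := by
  apply bump0.one_of_mem_closedBall
  rw [mem_closedBall_zero_iff, norm_smul, norm_inv, Real.norm_of_nonneg hs.le]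
  change _ ≤ (1/2:ℝ)
  rw [inv_mul_le_iff₀ hs]; linarith

lemma chi_zero (p : R2) (s : ℝ) (hs : 0 < s) (z : R2) (hz : s ≤ ‖z - p‖) : chi p s z = 0 := by
  apply bump0.zero_of_le_dist
  rw [dist_zero_right, norm_smul, norm_inv, Real.norm_of_nonneg hs.le]
  change (1:ℝ) ≤ _
  rw [le_inv_mul_iff₀ hs]; linarith

lemma chi_deriv : ∃ C : ℝ, 0 < C ∧ ∀ (p : R2) (s : ℝ) (_ : 0 < s) (z v : R2), ‖v‖ ≤ 1 → |fderiv ℝ (chi p s) z v| ≤ C / s := by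
  have hc : Continuous (fderiv ℝ (bump0 : R2 → ℝ)) := (bump0.contDiff (n := ⊤)).continuous_fderiv (by simp)
  have hcs : HasCompactSupport (fderiv ℝ (bump0 : R2 → ℝ)) := bump0.hasCompactSupport.fderiv ℝ
  obtain ⟨C, hC⟩ := hcs.exists_bound_of_continuous hc
  refine ⟨|C| + 1, by positivity, fun p s hs z v hv => ?_⟩
  have h1 : HasFDerivAt (fun z : R2 => s⁻¹ • (z - p)) (s⁻¹ • ContinuousLinearMap.id ℝ R2) z :=
    ((hasFDerivAt_id z).sub_const p).const_smul s⁻¹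
  have h2 : HasFDerivAt (chi p s) _ z :=
    ((bump0.contDiff (n := ⊤)).differentiable (by simp) (s⁻¹ • (z - p))).hasFDerivAt.comp z h1
  rw [h2.fderiv]
  simp only [ContinuousLinearMap.comp_apply, ContinuousLinearMap.smul_apply, ContinuousLinearMap.id_apply, map_smul, smul_eq_mul]
  rw [abs_mul, abs_inv, abs_of_pos hs, div_eq_inv_mul]
  gcongr
  have h3 := (fderiv ℝ (bump0 : R2 → ℝ) (s⁻¹ • (z - p))).le_opNorm v
  have h4 := hC (s⁻¹ • (z - p))
  rw [Real.norm_eq_abs] at h3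
  have h5 := le_abs_self C
  have h6 : ‖fderiv ℝ (bump0 : R2 → ℝ) (s⁻¹ • (z - p))‖ * ‖v‖ ≤ ‖fderiv ℝ (bump0 : R2 → ℝ) (s⁻¹ • (z - p))‖ * 1 := by gcongr
  linarith

/-- the modified map -/
def modB (w : R2 → ℂ) (α : ℂ) (σ : Bool) (p q : R2) (s : ℝ) (z : R2) : ℂ :=
  α * tau σ (z - q) * (chi p s z : ℂ) + w z * ((1 - chi p s z : ℝ) : ℂ)

def modE (θ : ℝ) (p : R2) (s : ℝ) (z : R2) : ℂ := Complex.exp ((-θ * chi p s z : ℝ) * Complex.I)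

def modW (w : R2 → ℂ) (α : ℂ) (θ : ℝ) (σ : Bool) (p q : R2) (s : ℝ) (z : R2) : ℂ :=
  modE θ p s z * modB w α σ p q s z

lemma modE_norm (θ : ℝ) (p : R2) (s : ℝ) (z : R2) : ‖modE θ p s z‖ = 1 := Complex.norm_exp_ofReal_mul_I _

lemma ofReal_hasFDeriv {f : R2 → ℝ} {f' : R2 →L[ℝ] ℝ} {z : R2} (h : HasFDerivAt f f' z) :
    HasFDerivAt (fun z => (f z : ℂ)) (Complex.ofRealCLM.comp f') z :=
  Complex.ofRealCLM.hasFDerivAt.comp z h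

lemma modE_deriv (θ : ℝ) (p : R2) (s : ℝ) (z : R2) : ∃ L : R2 →L[ℝ] ℂ, HasFDerivAt (modE θ p s) L z ∧
    ∀ v, L v = modE θ p s z * ((-θ * fderiv ℝ (chi p s) z v : ℝ) * Complex.I) := by
  have h1 := ((chi_smooth p s).differentiable (by simp) z).hasFDerivAt
  have h2 := (ofReal_hasFDeriv (h1.const_mul (-θ))).mul_const Complex.I
  have h3 : HasFDerivAt (modE θ p s) _ z := h2.cexp
  refine ⟨_, h3, fun v => ?_⟩
  simp [modE]
  ring

lemma modB_deriv (w : R2 → ℂ) (hw : ContDiff ℝ ∞ w) (α : ℂ) (σ : Bool) (p q : R2) (s : ℝ) (z : R2) :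
    ∃ L : R2 →L[ℝ] ℂ, HasFDerivAt (modB w α σ p q s) L z ∧
    ∀ v, L v = α * tau σ v * (chi p s z : ℂ) + fderiv ℝ w z v * ((1 - chi p s z : ℝ) : ℂ)
      + (α * tau σ (z - q) - w z) * ((fderiv ℝ (chi p s) z v : ℝ) : ℂ) := by
  have h1 := ((chi_smooth p s).differentiable (by simp) z).hasFDerivAt
  have h2 := (hw.differentiable (by simp) z).hasFDerivAt
  have h3 : HasFDerivAt (fun z => tau σ (z - q)) (((tau σ).toContinuousLinearEquiv : R2 →L[ℝ] ℂ).comp (ContinuousLinearMap.id ℝ R2)) z :=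
    ((tau σ).toContinuousLinearEquiv : R2 →L[ℝ] ℂ).hasFDerivAt.comp z ((hasFDerivAt_id z).sub_const q)
  have h4 : HasFDerivAt (modB w α σ p q s) _ z :=
    ((h3.const_mul α).mul (ofReal_hasFDeriv h1)).add (h2.mul (ofReal_hasFDeriv (h1.const_sub 1)))
  refine ⟨_, h4, fun v => ?_⟩
  simp
  ring

lemma tau_smooth (σ : Bool) : ContDiff ℝ ∞ (tau σ) := (tau σ).contDiff

lemma modW_smooth (w : R2 → ℂ) (hw : ContDiff ℝ ∞ w) (α : ℂ) (θ : ℝ) (σ : Bool) (p q : R2) (s : ℝ) :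
    ContDiff ℝ ∞ (modW w α θ σ p q s) := by
  have hc := chi_smooth p s
  have ho : ∀ {f : R2 → ℝ}, ContDiff ℝ ∞ f → ContDiff ℝ ∞ (fun z => (f z : ℂ)) := fun hf => Complex.ofRealCLM.contDiff.comp hf
  apply ContDiff.mul
  · apply ContDiff.cexp
    exact (ho (contDiff_const.mul hc)).mul contDiff_const
  · apply ContDiff.add
    · exact (contDiff_const.mul ((tau_smooth σ).comp (contDiff_id.sub contDiff_const))).mul (ho hc)
    · exact hw.mul (ho (contDiff_const.sub hc))

lemma modW_dw_le (w : R2 → ℂ) (hw : ContDiff ℝ ∞ w) (α : ℂ) (θ : ℝ) (σ : Bool) (p q : R2) (s : ℝ) (z : R2) (j : Fin 2)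
    (D K S : ℝ) (hD : |fderiv ℝ (chi p s) z (ee j)| ≤ D) (hK : ‖dw w j z‖ ≤ K) (hS1 : ‖α‖ * ‖z - q‖ ≤ S) (hS2 : ‖w z‖ ≤ S) :
    ‖dw (modW w α θ σ p q s) j z‖ ≤ |θ| * D * (2 * S) + (‖α‖ + K + 2 * S * D) := by
  obtain ⟨L1, h1, h1'⟩ := modE_deriv θ p s z
  obtain ⟨L2, h2, h2'⟩ := modB_deriv w hw α σ p q s z
  have h3 : HasFDerivAt (modW w α θ σ p q s) _ z := h1.mul h2
  have hc0 := chi_nonneg p s z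
  have hc1 := chi_le p s z
  have hee : ‖ee j‖ = 1 := by simp [ee]
  have hD0 : 0 ≤ D := (abs_nonneg _).trans hD
  have hS0 : 0 ≤ S := (norm_nonneg _).trans hS2
  have hK0 : 0 ≤ K := (norm_nonneg _).trans hK
  have hat : ‖α * tau σ (z - q)‖ ≤ S := by rw [norm_mul, LinearIsometryEquiv.norm_map]; exact hS1
  rw [dw, h3.fderiv]
  simp only [ContinuousLinearMap.add_apply, ContinuousLinearMap.smul_apply, smul_eq_mul]
  rw [h1', h2']
  have n1 : ‖modB w α σ p q s z‖ ≤ 2 * S := by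
    unfold modB
    refine (norm_add_le _ _).trans ?_
    rw [norm_mul _ (chi p s z : ℂ), norm_mul (w z), Complex.norm_real, Complex.norm_real, Real.norm_of_nonneg hc0, Real.norm_of_nonneg (by linarith)]
    have a1 : ‖α * tau σ (z - q)‖ * chi p s z ≤ S * 1 := by gcongr
    have a2 : ‖w z‖ * (1 - chi p s z) ≤ S * 1 := by gcongr; linarith
    linarith
  refine (norm_add_le _ _).trans ?_
  rw [add_comm]
  apply add_le_add
  · rw [norm_mul, norm_mul (modE θ p s z), modE_norm, one_mul, norm_mul, Complex.norm_I, mul_one, Complex.norm_real, Real.norm_eq_abs, abs_mul, abs_neg, mul_comm]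
    gcongr
  · rw [norm_mul, modE_norm, one_mul]
    refine (norm_add_le _ _).trans ?_
    apply add_le_add
    · refine (norm_add_le _ _).trans ?_
      rw [norm_mul _ (chi p s z : ℂ), norm_mul _ ((1 - chi p s z : ℝ) : ℂ), Complex.norm_real, Complex.norm_real, Real.norm_of_nonneg hc0, Real.norm_of_nonneg (by linarith), norm_mul, LinearIsometryEquiv.norm_map, hee, mul_one]
      have a1 : ‖α‖ * chi p s z ≤ ‖α‖ * 1 := by gcongr
      have a2 : ‖fderiv ℝ w z (ee j)‖ * (1 - chi p s z) ≤ K * 1 := by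
        gcongr
        · exact hK
        · linarith
      linarith
    · rw [norm_mul, Complex.norm_real]
      gcongr
      · have := norm_sub_le (α * tau σ (z - q)) (w z)
        linarith
      · exact hD

end

open MeasureTheory Metric Filter Set
open scoped ENNReal NNReal Topology Classical ContDiff Manifold Convolution
noncomputable section

lemma modB_lower (w : R2 → ℂ) (α β : ℂ) (hαβ : ‖β‖ < ‖α‖) (σ : Bool) (p q : R2) (s : ℝ) (hs : 0 < s) (z : R2)
    (hw : ‖w z - (α * tau σ (z - p) + β * starRingEnd ℂ (tau σ (z - p)))‖ ≤ (‖α‖ - ‖β‖) / 4 * ‖z - p‖)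
    (hq1 : ‖q - p‖ ≤ s / 8) (hq2 : ‖α‖ * ‖q - p‖ ≤ (‖α‖ - ‖β‖) * s / 8) :
    (‖α‖ - ‖β‖) / 4 * ‖z - q‖ ≤ ‖modB w α σ p q s z‖ := by
  have hb := norm_nonneg β
  rcases le_or_gt (‖z - p‖) (s / 2) with h | h
  · have h1 := chi_one p s hs z h
    simp only [modB, h1, Complex.ofReal_one, mul_one, sub_self, Complex.ofReal_zero, mul_zero, add_zero]
    rw [norm_mul, LinearIsometryEquiv.norm_map]
    gcongr
    linarith
  · set t := chi p s z with ht
    have t0 : 0 ≤ t := chi_nonneg p s z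
    have t1 : t ≤ 1 := chi_le p s z
    set e := w z - (α * tau σ (z - p) + β * starRingEnd ℂ (tau σ (z - p))) with he
    have hz : z - q = (z - p) - (q - p) := by abel
    have key : α * tau σ (z - p) = modB w α σ p q s z - ((1 - t : ℝ) : ℂ) * (β * starRingEnd ℂ (tau σ (z - p)))
        - ((1 - t : ℝ) : ℂ) * e + (t : ℂ) * (α * tau σ (q - p)) := by
      rw [modB, ← ht, hz, map_sub (tau σ) (z - p) (q - p), he]
      push_cast
      ring
    have n0 : ‖α‖ * ‖z - p‖ = ‖α * tau σ (z - p)‖ := by rw [norm_mul, LinearIsometryEquiv.norm_map]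
    have n1 : ‖((1 - t : ℝ) : ℂ) * (β * starRingEnd ℂ (tau σ (z - p)))‖ ≤ 1 * (‖β‖ * ‖z - p‖) := by
      rw [norm_mul, norm_mul, Complex.norm_real, Real.norm_of_nonneg (by linarith), RCLike.norm_conj, LinearIsometryEquiv.norm_map]
      gcongr; linarith
    have n2 : ‖((1 - t : ℝ) : ℂ) * e‖ ≤ 1 * ((‖α‖ - ‖β‖) / 4 * ‖z - p‖) := by
      rw [norm_mul, Complex.norm_real, Real.norm_of_nonneg (by linarith)]
      gcongr; linarith
    have n3 : ‖(t : ℂ) * (α * tau σ (q - p))‖ ≤ 1 * ((‖α‖ - ‖β‖) * s / 8) := by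
      rw [norm_mul, norm_mul, Complex.norm_real, Real.norm_of_nonneg (by linarith), LinearIsometryEquiv.norm_map]
      gcongr
    have n4 : ‖z - q‖ ≤ ‖z - p‖ + ‖q - p‖ := by rw [hz]; exact norm_sub_le _ _
    have n5 : ‖α * tau σ (z - p)‖ ≤ ‖modB w α σ p q s z‖ + 1 * (‖β‖ * ‖z - p‖) + 1 * ((‖α‖ - ‖β‖) / 4 * ‖z - p‖) + 1 * ((‖α‖ - ‖β‖) * s / 8) := by
      rw [key]
      refine (norm_add_le _ _).trans (add_le_add ?_ n3)
      refine (norm_sub_le _ _).trans (add_le_add ?_ n2)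
      exact (norm_sub_le _ _).trans (add_le_add le_rfl n1)
    rw [← n0] at n5
    have hc : 0 < ‖α‖ - ‖β‖ := by linarith
    have n6 : (‖α‖ - ‖β‖) * ‖z - q‖ ≤ (‖α‖ - ‖β‖) * (‖z - p‖ * (5/4)) := by
      gcongr; linarith
    have n7 : (‖α‖ - ‖β‖) * s ≤ (‖α‖ - ‖β‖) * (2 * ‖z - p‖) := by gcongr; linarith
    have n8 : 0 ≤ (‖α‖ - ‖β‖) * ‖z - p‖ := by positivity
    nlinarith

lemma exp_arg (α : ℂ) : Complex.exp ((-α.arg : ℝ) * Complex.I) * α = (‖α‖ : ℂ) := by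
  have h := Complex.norm_mul_exp_arg_mul_I α
  calc Complex.exp ((-α.arg : ℝ) * Complex.I) * α = Complex.exp ((-α.arg : ℝ) * Complex.I) * (‖α‖ * Complex.exp (α.arg * Complex.I)) := by rw [h]
    _ = ‖α‖ * (Complex.exp ((-α.arg : ℝ) * Complex.I) * Complex.exp (α.arg * Complex.I)) := by ring
    _ = _ := by rw [← Complex.exp_add]; simp

lemma local_mod (w : R2 → ℂ) (hw : ContDiff ℝ ∞ w) (p : R2) (h0 : w p = 0) (hj : jac w p ≠ 0) :
    ∃ (σ : Bool) (c : ℝ), 0 < c ∧ ∀ ε : ℝ, 0 < ε → ∃ s0 : ℝ, 0 < s0 ∧ ∀ s : ℝ, 0 < s → s ≤ s0 → ∃ ρ : ℝ, 0 < ρ ∧ ∀ q : R2, ‖q - p‖ < ρ →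
      ∃ w' : R2 → ℂ, ContDiff ℝ ∞ w' ∧ (∀ z, s ≤ ‖z - p‖ → w' z = w z) ∧ (∀ z, ‖z - p‖ < s → w' z = 0 → z = q) ∧
        (∃ ρ' : ℝ, 0 < ρ' ∧ ball q ρ' ⊆ ball p s ∧ ∀ z ∈ ball q ρ', w' z = (c : ℂ) * tau σ (z - q)) ∧
        ∫⁻ z in ball p s, ENNReal.ofReal (Den w' z) ≤ ENNReal.ofReal ε := by
  obtain ⟨σ, α, β, hαβ, hd⟩ := jac_decomp w p hj
  have hα : 0 < ‖α‖ := (norm_nonneg _).trans_lt hαβ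
  set c0 := ‖α‖ - ‖β‖ with hc0
  have hc0p : 0 < c0 := by rw [hc0]; linarith
  refine ⟨σ, ‖α‖, hα, fun ε hε => ?_⟩
  obtain ⟨C, hC, hchi⟩ := chi_deriv
  obtain ⟨K0, hK0⟩ := (isCompact_closedBall p 1).exists_bound_of_continuousOn (dw_cont hw 0).continuousOn
  obtain ⟨K1, hK1⟩ := (isCompact_closedBall p 1).exists_bound_of_continuousOn (dw_cont hw 1).continuousOn
  set K := max |K0| |K1| with hK
  have hKj : ∀ z ∈ closedBall p 1, ∀ j, ‖dw w j z‖ ≤ K := by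
    intro z hz j
    fin_cases j
    · exact (hK0 z hz).trans ((le_abs_self _).trans (le_max_left _ _))
    · exact (hK1 z hz).trans ((le_abs_self _).trans (le_max_right _ _))
  have hK0' : 0 ≤ K := (abs_nonneg K0).trans (le_max_left _ _)
  have hlo : ∃ r > 0, ∀ z, ‖z - p‖ ≤ r → ‖w z - (α * tau σ (z - p) + β * starRingEnd ℂ (tau σ (z - p)))‖ ≤ c0 / 4 * ‖z - p‖ := by
    have h1 := (hw.differentiable (by simp) p).hasFDerivAt
    have h2 := h1.isLittleO.def (show 0 < c0 / 4 by positivity)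
    obtain ⟨r, hr, h3⟩ := Metric.eventually_nhds_iff.1 h2
    refine ⟨r / 2, by positivity, fun z hz => ?_⟩
    have := h3 (y := z) (by rw [dist_eq_norm]; linarith)
    rwa [h0, sub_zero, hd] at this
  obtain ⟨r, hr, hlo⟩ := hlo
  set M : ℝ := |α.arg| * (6 * C * ‖α‖) + (‖α‖ + K + 6 * C * ‖α‖) with hM
  have hMp : 0 < M := by positivity
  refine ⟨min (min r 1) (ε * c0 / (32 * Real.pi * M)), by positivity, fun s hs hs0 => ?_⟩
  have hsr : s ≤ r := hs0.trans ((min_le_left _ _).trans (min_le_left _ _))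
  have hs1 : s ≤ 1 := hs0.trans ((min_le_left _ _).trans (min_le_right _ _))
  have hse : s ≤ ε * c0 / (32 * Real.pi * M) := hs0.trans (min_le_right _ _)
  refine ⟨min (s / 8) (c0 * s / (8 * ‖α‖)), by positivity, fun q hq => ?_⟩
  have hq1 : ‖q - p‖ ≤ s / 8 := hq.le.trans (min_le_left _ _)
  have hq2 : ‖α‖ * ‖q - p‖ ≤ c0 * s / 8 := by
    have := hq.le.trans (min_le_right _ _)
    rw [le_div_iff₀ (by positivity)] at this
    linarith
  have low : ∀ z, ‖z - p‖ < s → c0 / 4 * ‖z - q‖ ≤ ‖modW w α α.arg σ p q s z‖ := by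
    intro z hz
    rw [modW, norm_mul, modE_norm, one_mul]
    exact modB_lower w α β hαβ σ p q s hs z (hlo z (hz.le.trans hsr)) hq1 hq2
  have hzq : ∀ z, ‖z - q‖ ≤ ‖z - p‖ + ‖q - p‖ := by
    intro z
    have : z - q = (z - p) - (q - p) := by abel
    rw [this]; exact norm_sub_le _ _
  have hzp : ∀ z, ‖z - p‖ ≤ ‖z - q‖ + ‖q - p‖ := by
    intro z
    have : z - p = (z - q) + (q - p) := by abel
    rw [this]; exact norm_add_le _ _
  have up : ∀ z, ‖z - p‖ < s → ∀ j, ‖dw (modW w α α.arg σ p q s) j z‖ ≤ M := by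
    intro z hz j
    have e1 : ‖w z‖ ≤ 3 * ‖α‖ * s := by
      have a1 := hlo z (hz.le.trans hsr)
      have a2 : ‖w z‖ ≤ ‖w z - (α * tau σ (z - p) + β * starRingEnd ℂ (tau σ (z - p)))‖ + (‖α‖ * ‖z - p‖ + ‖β‖ * ‖z - p‖) := by
        have := norm_add_le (w z - (α * tau σ (z - p) + β * starRingEnd ℂ (tau σ (z - p)))) (α * tau σ (z - p) + β * starRingEnd ℂ (tau σ (z - p)))
        rw [sub_add_cancel] at this
        refine this.trans (add_le_add le_rfl ((norm_add_le _ _).trans ?_))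
        rw [norm_mul, norm_mul, RCLike.norm_conj, LinearIsometryEquiv.norm_map]
      have hb := norm_nonneg β
      calc ‖w z‖ ≤ c0 / 4 * ‖z - p‖ + (‖α‖ * ‖z - p‖ + ‖β‖ * ‖z - p‖) := by linarith
        _ = (c0 / 4 + ‖α‖ + ‖β‖) * ‖z - p‖ := by ring
        _ ≤ (3 * ‖α‖) * s := by gcongr; rw [hc0]; linarith
    have e2 : ‖α‖ * ‖z - q‖ ≤ 3 * ‖α‖ * s := by
      have := hzq z
      calc ‖α‖ * ‖z - q‖ ≤ ‖α‖ * (3 * s) := by gcongr; linarith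
        _ = _ := by ring
    have := modW_dw_le w hw α α.arg σ p q s z j (C / s) K (3 * ‖α‖ * s) (hchi p s hs z _ (by simp [ee])) (hKj z (by rw [mem_closedBall, dist_eq_norm]; linarith) j) e2 e1
    refine this.trans (le_of_eq ?_)
    rw [hM]; field_simp
    ring
  refine ⟨modW w α α.arg σ p q s, modW_smooth w hw α _ σ p q s, ?_, ?_, ?_, ?_⟩
  · intro z hz
    have := chi_zero p s hs z hz
    simp [modW, modE, modB, this]
  · intro z hz h
    have h1 := low z hz
    rw [h, norm_zero] at h1
    have : ‖z - q‖ ≤ 0 := by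
      by_contra h2
      push Not at h2
      have : 0 < c0 / 4 * ‖z - q‖ := by positivity
      linarith
    exact sub_eq_zero.1 (norm_le_zero_iff.1 this)
  · refine ⟨s / 4, by positivity, ?_, ?_⟩
    · intro z hz
      rw [mem_ball, dist_eq_norm] at hz ⊢
      have := hzp z
      linarith
    · intro z hz
      rw [mem_ball, dist_eq_norm] at hz
      have h1 := chi_one p s hs z (by have := hzp z; linarith)
      rw [modW, modE, modB, h1, ← exp_arg]
      simp
      ring
  · have hsub : ball p s ⊆ ball q (2 * s) := by
      intro z hz
      rw [mem_ball, dist_eq_norm] at hz ⊢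
      have := hzq z
      linarith
    calc ∫⁻ z in ball p s, ENNReal.ofReal (Den (modW w α α.arg σ p q s) z)
        ≤ ∫⁻ z in ball p s, ENNReal.ofReal (8 * M / c0) * ENNReal.ofReal (‖z - q‖⁻¹) := by
          apply setLIntegral_mono' measurableSet_ball
          intro z hz
          rw [mem_ball, dist_eq_norm] at hz
          rw [← ENNReal.ofReal_mul (by positivity)]
          apply ENNReal.ofReal_le_ofReal
          have b1 := low z hz
          rcases eq_or_ne z q with h | h
          · subst h
            have : modW w α α.arg σ p z s z = 0 := by
              have hc := chi_one p s hs z (by linarith)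
              simp [modW, modB, hc]
            simp [Den, this]
          · have hzz : 0 < ‖z - q‖ := norm_pos_iff.2 (sub_ne_zero.2 h)
            have b2 : ‖modW w α α.arg σ p q s z‖⁻¹ ≤ (c0 / 4 * ‖z - q‖)⁻¹ := inv_anti₀ (by positivity) b1
            calc Den (modW w α α.arg σ p q s) z ≤ (M + M) * (c0 / 4 * ‖z - q‖)⁻¹ := by
                  unfold Den
                  gcongr
                  · exact up z hz 0
                  · exact up z hz 1
              _ = _ := by field_simp; norm_num
      _ ≤ ∫⁻ z in ball q (2 * s), ENNReal.ofReal (8 * M / c0) * ENNReal.ofReal (‖z - q‖⁻¹) := lintegral_mono_set hsub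
      _ = ENNReal.ofReal (8 * M / c0) * ENNReal.ofReal (2 * Real.pi * (2 * s)) := by
          rw [lintegral_const_mul' _ _ ENNReal.ofReal_ne_top, (inv_norm_int q (2 * s) (by positivity)).2]
      _ ≤ ENNReal.ofReal ε := by
          rw [← ENNReal.ofReal_mul (by positivity)]
          apply ENNReal.ofReal_le_ofReal
          rw [le_div_iff₀ (by positivity)] at hse
          rw [div_mul_eq_mul_div, div_le_iff₀ hc0p]
          linarith

end

open MeasureTheory Metric Filter Set
open scoped ENNReal NNReal Topology Classical ContDiff Manifold Convolution
noncomputable section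

def Std (w : R2 → ℂ) (a : R2) : Prop :=
  ∃ (σ : Bool) (c ρ : ℝ), 0 < c ∧ 0 < ρ ∧ ∀ z ∈ ball a ρ, w z = (c : ℂ) * tau σ (z - a)

def Gen3 (A : Set R2) : Prop :=
  ∀ a ∈ A, ∀ b ∈ A, ∀ c ∈ A, a ≠ b → a ≠ c → b ≠ c → ¬ Collinear ℝ ({a, b, c} : Set R2)

lemma line_null (a b : R2) : volume (affineSpan ℝ ({a, b} : Set R2) : Set R2) = 0 := by
  apply Measure.addHaar_affineSubspace
  intro h
  have h1 := collinear_iff_finrank_le_one.1 (collinear_pair ℝ a b)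
  rw [← direction_affineSpan, h, AffineSubspace.direction_top, finrank_top] at h1
  simp at h1

lemma gen3_insert (A : Set R2) (hA : Gen3 A) (q : R2)
    (hq : ∀ a ∈ A, ∀ b ∈ A, q ∉ affineSpan ℝ ({a, b} : Set R2)) : Gen3 (insert q A) := by
  intro a ha b hb c hc hab hac hbc hcol
  have ma : a ∈ ({a, b, c} : Set R2) := by simp
  have mb : b ∈ ({a, b, c} : Set R2) := by simp
  have mc : c ∈ ({a, b, c} : Set R2) := by simp
  rcases ha with rfl | ha
  · rcases hb with rfl | hb
    · exact hab rfl
    · rcases hc with rfl | hc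
      · exact hac rfl
      · exact hq b hb c hc (hcol.mem_affineSpan_of_mem_of_ne mb mc ma hbc)
  · rcases hb with rfl | hb
    · rcases hc with rfl | hc
      · exact hbc rfl
      · exact hq a ha c hc (hcol.mem_affineSpan_of_mem_of_ne ma mc mb hac)
    · rcases hc with rfl | hc
      · exact hq a ha b hb (hcol.mem_affineSpan_of_mem_of_ne ma mb mc hab)
      · exact hA a ha b hb c hc hab hac hbc hcol

lemma exists_avoid (A : Set R2) (hA : A.Finite) (p : R2) (ρ : ℝ) (hρ : 0 < ρ) :
    ∃ q, ‖q - p‖ < ρ ∧ ∀ a ∈ A, ∀ b ∈ A, q ∉ affineSpan ℝ ({a, b} : Set R2) := by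
  have h0 : volume (⋃ a ∈ A, ⋃ b ∈ A, (affineSpan ℝ ({a, b} : Set R2) : Set R2)) = 0 := by
    rw [measure_biUnion_null_iff hA.countable]
    intro a _
    rw [measure_biUnion_null_iff hA.countable]
    intro b _
    exact line_null a b
  by_contra h
  push Not at h
  have hsub : ball p ρ ⊆ ⋃ a ∈ A, ⋃ b ∈ A, (affineSpan ℝ ({a, b} : Set R2) : Set R2) := by
    intro q hq
    rw [mem_ball, dist_eq_norm] at hq
    obtain ⟨a, ha, b, hb, h1⟩ := h q hq
    simp only [mem_iUnion]
    exact ⟨a, ha, b, hb, h1⟩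
  have h1 := measure_mono_null hsub h0
  exact (measure_ball_pos volume p hρ).ne' h1

lemma dw_congr {w w' : R2 → ℂ} {x : R2} (h : w' =ᶠ[𝓝 x] w) (j : Fin 2) : dw w' j x = dw w j x := by
  rw [dw, dw, h.fderiv_eq]

lemma jac_congr {w w' : R2 → ℂ} {x : R2} (h : w' =ᶠ[𝓝 x] w) : jac w' x = jac w x := by
  rw [jac, jac, dw_congr h, dw_congr h]

lemma Den_congr {w w' : R2 → ℂ} {x : R2} (h : w' =ᶠ[𝓝 x] w) : Den w' x = Den w x := by
  rw [Den, Den, dw_congr h, dw_congr h, h.eq_of_nhds]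

lemma DD_congr (u : R2 → R2) (G : R2 → Matrix (Fin 2) (Fin 2) ℝ) {w w' : R2 → ℂ} {x : R2} (h : w' =ᶠ[𝓝 x] w) : DD u G w' x = DD u G w x := by
  have h1 : Pu w' x = Pu w x := by rw [Pu, Pu, h.eq_of_nhds]
  have h2 : PG w' x = PG w x := by simp only [PG, kap, dw_congr h, h.eq_of_nhds]
  rw [DD, DD, h1, h2]

lemma DD_le (u : R2 → R2) (G : R2 → Matrix (Fin 2) (Fin 2) ℝ) (w : R2 → ℂ) (x : R2) (hu : ‖u x‖ = 1) :
    DD u G w x ≤ 5 * HH G x + 4 * Den w x := by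
  have hH : HH G x = 1 + ∑ i, ∑ j, |G x i j| := rfl
  have hH0 : 0 ≤ HH G x := by rw [hH]; positivity
  have h1 : ∀ i, HH G x * |Pu w x i - u x i| ≤ HH G x * 2 := by
    intro i
    have a1 := abs_Pu_le w x i
    have a2 := coord_le_norm (u x) i
    have := abs_sub (Pu w x i) (u x i)
    gcongr
    linarith
  have h2 : ∀ i j, |PG w x i j - G x i j| ≤ Den w x + |G x i j| := fun i j =>
    (abs_sub _ _).trans (add_le_add (abs_PG_le_Den w x i j) le_rfl)
  have e1 := h1 0
  have e2 := h1 1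
  have f1 := h2 0 0
  have f2 := h2 0 1
  have f3 := h2 1 0
  have f4 := h2 1 1
  simp only [DD, Fin.sum_univ_two] at *
  linarith

lemma propB_step (Ω : Set R2) (hΩo : IsOpen Ω) (hΩb : Bornology.IsBounded Ω)
    (u : R2 → R2) (G : R2 → Matrix (Fin 2) (Fin 2) ℝ)
    (hu : MemW11 Ω u G) (hS : SphereValued Ω u) (ε : ℝ≥0∞) (w : R2 → ℂ) (hw : GoodMap Ω w)
    (hI : ∫⁻ x in Ω, ENNReal.ofReal (DD u G w x) < ε) (A : Set R2) (hA : A ⊆ {x ∈ Ω | w x = 0}) (hA2 : ∀ a ∈ A, Std w a)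
    (hA3 : Gen3 A) (p : R2) (hp : p ∈ Ω) (hp0 : w p = 0) (hpA : p ∉ A) :
    ∃ w' q, GoodMap Ω w' ∧ ∫⁻ x in Ω, ENNReal.ofReal (DD u G w' x) < ε ∧ q ∉ {x ∈ Ω | w x = 0} \ {p} ∧
      {x ∈ Ω | w' x = 0} = insert q ({x ∈ Ω | w x = 0} \ {p}) ∧ (∀ a ∈ insert q A, Std w' a) ∧ Gen3 (insert q A) := by
  set Z := {x ∈ Ω | w x = 0} with hZ
  have hZf : Z.Finite := hw.fin
  obtain ⟨η, hη, hIη⟩ := ENNReal.lt_iff_exists_add_pos_lt.1 hI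
  obtain ⟨σ, c, hc, hloc⟩ := local_mod w hw.smooth p hp0 (hw.nondeg p hp hp0)
  obtain ⟨s0, hs0, hloc⟩ := hloc (η / 8) (by positivity)
  -- absolute continuity
  have hHf : ∫⁻ x, ENNReal.ofReal (5 * HH G x) ∂(volume.restrict Ω) ≠ ⊤ := by
    have := ((HH_int hΩb hu).const_mul 5).lintegral_lt_top
    exact this.ne
  obtain ⟨δ, hδ, hac⟩ := exists_pos_setLIntegral_lt_of_measure_lt hHf (ε := ENNReal.ofReal (η / 2)) (by simp [hη])
  have ev1 : ∀ᶠ s : ℝ in 𝓝[>] 0, ENNReal.ofReal (Real.pi * s ^ 2) < δ := by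
    have hc : Continuous fun s : ℝ => ENNReal.ofReal (Real.pi * s ^ 2) := ENNReal.continuous_ofReal.comp (by fun_prop)
    have := hc.tendsto 0
    simp only [ne_eq, OfNat.ofNat_ne_zero, not_false_eq_true, zero_pow, mul_zero, ENNReal.ofReal_zero] at this
    exact (this.mono_left nhdsWithin_le_nhds).eventually (gt_mem_nhds hδ)
  have ev2 : ∀ᶠ s : ℝ in 𝓝[>] 0, closedBall p s ⊆ Ω ∩ (Z \ {p})ᶜ := by
    have : Ω ∩ (Z \ {p})ᶜ ∈ 𝓝 p := by
      apply IsOpen.mem_nhds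
      · exact hΩo.inter (hZf.subset sdiff_subset).isClosed.isOpen_compl
      · exact ⟨hp, by simp⟩
    obtain ⟨r, hr, hr2⟩ := Metric.nhds_basis_closedBall.mem_iff.1 this
    filter_upwards [Ioo_mem_nhdsGT hr] with s hs
    exact (closedBall_subset_closedBall hs.2.le).trans hr2
  obtain ⟨s, ⟨hs1, hs2⟩, hs3, hs4⟩ := ((ev1.and ev2).and (Ioo_mem_nhdsGT hs0)).exists
  obtain ⟨ρ, hρ, hloc⟩ := hloc s hs3 hs4.le
  obtain ⟨q, hq1, hq2⟩ := exists_avoid A (hZf.subset hA) p (min ρ s) (by positivity)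
  obtain ⟨w', hw's, hw1, hw2, ⟨ρ', hρ', hw3, hw4⟩, hw5⟩ := hloc q (hq1.trans_le (min_le_left _ _))
  have hqs : ‖q - p‖ < s := hq1.trans_le (min_le_right _ _)
  have hqcb : q ∈ closedBall p s := by rw [mem_closedBall, dist_eq_norm]; exact hqs.le
  have hq0 : w' q = 0 := by rw [hw4 q (mem_ball_self hρ')]; simp
  have hcongr : ∀ x, x ∉ closedBall p s → w' =ᶠ[𝓝 x] w := by
    intro x hx
    filter_upwards [isClosed_closedBall.isOpen_compl.mem_nhds hx] with z hz
    apply hw1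
    rw [mem_compl_iff, mem_closedBall, dist_eq_norm] at hz
    linarith
  have hout : ∀ x ∈ Z \ {p}, x ∉ closedBall p s := fun x hx hx2 => (hs2 hx2).2 hx
  have hqZ : q ∉ Z \ {p} := (hs2 hqcb).2
  have hZ' : {x ∈ Ω | w' x = 0} = insert q (Z \ {p}) := by
    ext x
    constructor
    · rintro ⟨hx1, hx2⟩
      rcases lt_or_ge ‖x - p‖ s with h | h
      · left; exact hw2 x h hx2
      · right
        refine ⟨⟨hx1, by rw [← hw1 x h]; exact hx2⟩, ?_⟩
        rintro rfl
        simp at h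
        linarith
    · rintro (rfl | hx)
      · exact ⟨(hs2 hqcb).1, hq0⟩
      · refine ⟨hx.1.1, ?_⟩
        rw [(hcongr x (hout x hx)).eq_of_nhds]
        exact hx.1.2
  have hStdq : Std w' q := ⟨σ, c, ρ', hc, hρ', hw4⟩
  have hAZ : A ⊆ Z \ {p} := fun a ha => ⟨hA ha, fun h => hpA (h ▸ ha)⟩
  -- splitting of integrals
  have hsplit : ∀ f g : R2 → ℝ≥0∞, (∀ x, x ∉ closedBall p s → f x = g x) →
      ∫⁻ x in Ω, f x ≤ (∫⁻ x in Ω ∩ ball p s, f x) + ∫⁻ x in Ω, g x := by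
    intro f g hfg
    rw [← lintegral_inter_add_sdiff f Ω (measurableSet_ball (x := p) (ε := s))]
    refine add_le_add le_rfl ?_
    have hsph : ∀ᵐ x ∂(volume.restrict (Ω \ ball p s)), x ∉ sphere p s :=
      ae_restrict_of_ae (measure_eq_zero_iff_ae_notMem.1 (Measure.addHaar_sphere volume p s))
    calc ∫⁻ x in Ω \ ball p s, f x = ∫⁻ x in Ω \ ball p s, g x := by
          apply lintegral_congr_ae
          filter_upwards [hsph, ae_restrict_mem (hΩo.measurableSet.diff measurableSet_ball)] with x hx hx2
          apply hfg
          intro h3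
          rw [← ball_union_sphere] at h3
          exact h3.elim hx2.2 hx
      _ ≤ _ := lintegral_mono_set sdiff_subset
  have hDen : ∫⁻ x in Ω ∩ ball p s, ENNReal.ofReal (Den w' x) ≤ ENNReal.ofReal (η / 8) :=
    (lintegral_mono_set inter_subset_right).trans hw5
  have hHH : ∫⁻ x in Ω ∩ ball p s, ENNReal.ofReal (5 * HH G x) < ENNReal.ofReal (η / 2) := by
    have := hac (ball p s) ?_
    · rwa [Measure.restrict_restrict measurableSet_ball, inter_comm] at this
    · exact (Measure.restrict_apply_le _ _).trans_lt (by rw [vol_ball p s hs3.le]; exact hs1)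
  have hgood : GoodMap Ω w' := by
    refine ⟨hw's, ?_, ?_, ?_⟩
    · refine ⟨(Den_meas hw's).aestronglyMeasurable, ?_⟩
      rw [hasFiniteIntegral_iff_ofReal (ae_of_all _ fun x => by unfold Den; positivity)]
      refine (hsplit _ (fun x => ENNReal.ofReal (Den w x)) fun x hx => by rw [Den_congr (hcongr x hx)]).trans_lt ?_
      apply ENNReal.add_lt_top.2 ⟨hDen.trans_lt ENNReal.ofReal_lt_top, hw.int.lintegral_lt_top⟩
    · rw [hZ']; exact (hZf.subset sdiff_subset).insert q
    · intro x hx hx0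
      have hxZ : x ∈ insert q (Z \ {p}) := by rw [← hZ']; exact ⟨hx, hx0⟩
      rcases hxZ with rfl | hxZ
      · have hev : w' =ᶠ[𝓝 x] fun z => (c : ℂ) * tau σ (z - x) := by
          filter_upwards [ball_mem_nhds x hρ'] with z hz using hw4 z hz
        have hd : ∀ j, dw (fun z => (c : ℂ) * tau σ (z - x)) j x = c * tau σ (ee j) := by
          intro j
          have h3 : HasFDerivAt (fun z => tau σ (z - x)) (((tau σ).toContinuousLinearEquiv : R2 →L[ℝ] ℂ).comp (ContinuousLinearMap.id ℝ R2)) x :=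
            ((tau σ).toContinuousLinearEquiv : R2 →L[ℝ] ℂ).hasFDerivAt.comp x ((hasFDerivAt_id x).sub_const x)
          have h4 := h3.const_mul (c : ℂ)
          rw [dw, h4.fderiv]
          simp
        rw [jac_congr hev, jac, hd, hd]
        cases σ <;> simp [tau, hc.ne']
      · rw [jac_congr (hcongr x (hout x hxZ))]
        exact hw.nondeg x hx hxZ.1.2
  refine ⟨w', q, hgood, ?_, hqZ, hZ', ?_, gen3_insert A hA3 q hq2⟩
  · refine lt_of_le_of_lt ?_ hIη
    refine (hsplit _ (fun x => ENNReal.ofReal (DD u G w x)) fun x hx => by rw [DD_congr u G (hcongr x hx)]).trans ?_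
    rw [add_comm]
    gcongr
    calc ∫⁻ x in Ω ∩ ball p s, ENNReal.ofReal (DD u G w' x) ≤ ∫⁻ x in Ω ∩ ball p s, (ENNReal.ofReal (5 * HH G x) + 4 * ENNReal.ofReal (Den w' x)) := by
          apply lintegral_mono_ae
          filter_upwards [ae_restrict_of_ae_restrict_of_subset inter_subset_left hS] with x hx
          have h4 : (4 : ℝ≥0∞) * ENNReal.ofReal (Den w' x) = ENNReal.ofReal (4 * Den w' x) := by
            rw [ENNReal.ofReal_mul (by norm_num)]; simp
          rw [h4, ← ENNReal.ofReal_add]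
          · exact ENNReal.ofReal_le_ofReal (DD_le u G w' x hx)
          · unfold HH; positivity
          · unfold Den; positivity
      _ = (∫⁻ x in Ω ∩ ball p s, ENNReal.ofReal (5 * HH G x)) + 4 * ∫⁻ x in Ω ∩ ball p s, ENNReal.ofReal (Den w' x) := by
          rw [lintegral_add_right _ ((Den_meas hw's).ennreal_ofReal.const_mul 4), lintegral_const_mul' _ _ (by simp)]
      _ ≤ ENNReal.ofReal (η / 2) + 4 * ENNReal.ofReal (η / 8) := by gcongr
      _ = η := by
          have h4 : (4 : ℝ≥0∞) * ENNReal.ofReal (η / 8) = ENNReal.ofReal (4 * (η / 8)) := by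
            rw [ENNReal.ofReal_mul (by norm_num)]; simp
          rw [h4, ← ENNReal.ofReal_add (by positivity) (by positivity)]
          have : (η / 2 + 4 * (η / 8) : ℝ) = η := by ring
          rw [this]; simp
  · rintro a (rfl | ha)
    · exact hStdq
    · obtain ⟨σ', c', r, h1, h2, h3⟩ := hA2 a ha
      have hev := hcongr a (hout a (hAZ ha))
      obtain ⟨r', hr', h4⟩ := Metric.eventually_nhds_iff_ball.1 hev
      refine ⟨σ', c', min r r', h1, by positivity, fun z hz => ?_⟩
      rw [h4 z (ball_subset_ball (min_le_right _ _) hz), h3 z (ball_subset_ball (min_le_left _ _) hz)]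

lemma propB_ind (Ω : Set R2) (hΩo : IsOpen Ω) (hΩb : Bornology.IsBounded Ω)
    (u : R2 → R2) (G : R2 → Matrix (Fin 2) (Fin 2) ℝ)
    (hu : MemW11 Ω u G) (hS : SphereValued Ω u) (ε : ℝ≥0∞) (n : ℕ) : ∀ (w : R2 → ℂ) (_ : GoodMap Ω w)
    (_ : ∫⁻ x in Ω, ENNReal.ofReal (DD u G w x) < ε) (A : Set R2) (_ : A ⊆ {x ∈ Ω | w x = 0}) (_ : ∀ a ∈ A, Std w a)
    (_ : Gen3 A) (_ : ({x ∈ Ω | w x = 0} \ A).ncard = n),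
    ∃ w', GoodMap Ω w' ∧ ∫⁻ x in Ω, ENNReal.ofReal (DD u G w' x) < ε ∧ 
      (∀ a ∈ Ω, w' a = 0 → Std w' a) ∧ Gen3 {x ∈ Ω | w' x = 0} := by
  induction n with
  | zero =>
    intro w hw hI A hA hA2 hA3 hn
    rw [Set.ncard_eq_zero (hw.fin.subset sdiff_subset), sdiff_eq_empty] at hn
    have : A = {x ∈ Ω | w x = 0} := hA.antisymm hn
    refine ⟨w, hw, hI, fun a ha ha0 => hA2 a (hn ⟨ha, ha0⟩), this ▸ hA3⟩
  | succ n ih =>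
    intro w hw hI A hA hA2 hA3 hn
    have hne : ({x ∈ Ω | w x = 0} \ A).Nonempty := by
      rw [← Set.ncard_pos (hw.fin.subset sdiff_subset)]; omega
    obtain ⟨p, ⟨hp, hp0⟩, hpA⟩ := hne
    obtain ⟨w', q, g1, g2, g3, g4, g5, g6⟩ := propB_step Ω hΩo hΩb u G hu hS ε w hw hI A hA hA2 hA3 p hp hp0 hpA
    refine ih w' g1 g2 (insert q A) ?_ g5 g6 ?_
    · rw [g4]
      exact insert_subset_insert fun a ha => ⟨hA ha, fun h => hpA (h ▸ ha)⟩
    · rw [g4]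
      have : insert q ({x ∈ Ω | w x = 0} \ {p}) \ insert q A = ({x ∈ Ω | w x = 0} \ A) \ {p} := by
        ext x
        constructor
        · rintro ⟨h1 | h1, h2⟩
          · exact absurd (Or.inl h1) h2
          · exact ⟨⟨h1.1, fun h => h2 (Or.inr h)⟩, h1.2⟩
        · rintro ⟨⟨h1, h2⟩, h3⟩
          refine ⟨Or.inr ⟨h1, h3⟩, ?_⟩
          rintro (h | h)
          · exact g3 (h ▸ ⟨h1, h3⟩)
          · exact h2 h
      have hm : p ∈ ({x ∈ Ω | w x = 0} \ A) := ⟨⟨hp, hp0⟩, hpA⟩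
      rw [this, Set.ncard_sdiff_singleton_of_mem hm]
      omega

lemma propB (Ω : Set R2) (hΩo : IsOpen Ω) (hΩb : Bornology.IsBounded Ω) (hΩl : HasLipschitzBoundary Ω)
    (u : R2 → R2) (G : R2 → Matrix (Fin 2) (Fin 2) ℝ)
    (hu : MemW11 Ω u G) (hS : SphereValued Ω u) (ε : ℝ≥0∞) (hε : 0 < ε) :
    ∃ w', GoodMap Ω w' ∧ ∫⁻ x in Ω, ENNReal.ofReal (DD u G w' x) < ε ∧ 
      (∀ a ∈ Ω, w' a = 0 → Std w' a) ∧ Gen3 {x ∈ Ω | w' x = 0} := by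
  obtain ⟨w, h1, h2⟩ := propA Ω hΩo hΩb hΩl u G hu hS ε hε
  exact propB_ind Ω hΩo hΩb u G hu hS ε _ w h1 h2 ∅ (empty_subset _) (by simp) (by simp [Gen3]) rfl

end

open MeasureTheory Metric Filter Set
open scoped ENNReal NNReal Topology Classical ContDiff Manifold Convolution
noncomputable section

def wc (w : R2 → ℂ) (i : Fin 2) (x : R2) : ℝ := toC.symm (w x) i

lemma wc0 (w : R2 → ℂ) (x : R2) : wc w 0 x = (w x).re := symm_toC_0 _
lemma wc1 (w : R2 → ℂ) (x : R2) : wc w 1 x = (w x).im := symm_toC_1 _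

lemma wc_smooth {w : R2 → ℂ} (hw : ContDiff ℝ ∞ w) (i : Fin 2) : ContDiff ℝ ∞ (wc w i) := by
  have h1 : ContDiff ℝ ∞ (fun x => toC.symm (w x)) := toC.symm.contDiff.comp hw
  exact contDiff_euclidean.1 h1 i

lemma wc_deriv {w : R2 → ℂ} (hw : ContDiff ℝ ∞ w) (i : Fin 2) (x v : R2) :
    fderiv ℝ (wc w i) x v = toC.symm (fderiv ℝ w x v) i := by
  have h1 := (hw.differentiable (by simp) x).hasFDerivAt
  have h2 : HasFDerivAt (fun x => toC.symm (w x)) ((toC.symm.toContinuousLinearEquiv : ℂ →L[ℝ] R2).comp (fderiv ℝ w x)) x :=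
    (toC.symm.toContinuousLinearEquiv : ℂ →L[ℝ] R2).hasFDerivAt.comp x h1
  have h3 := (EuclideanSpace.proj (𝕜 := ℝ) i : R2 →L[ℝ] ℝ).hasFDerivAt.comp x h2
  have h4 : HasFDerivAt (wc w i) _ x := h3
  rw [h4.fderiv]
  rfl

def Nd (w : R2 → ℂ) (δ : ℝ) (x : R2) : ℝ := ‖w x‖ ^ 2 + δ ^ 2

lemma Nd_eq (w : R2 → ℂ) (δ : ℝ) (x : R2) : Nd w δ x = wc w 0 x ^ 2 + wc w 1 x ^ 2 + δ ^ 2 := by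
  rw [Nd, wc0, wc1, ← Complex.normSq_eq_norm_sq, Complex.normSq_apply]; ring

lemma Nd_pos (w : R2 → ℂ) {δ : ℝ} (hδ : 0 < δ) (x : R2) : 0 < Nd w δ x := by unfold Nd; positivity

lemma Nd_smooth {w : R2 → ℂ} (hw : ContDiff ℝ ∞ w) (δ : ℝ) : ContDiff ℝ ∞ (Nd w δ) := by
  have : Nd w δ = fun x => wc w 0 x ^ 2 + wc w 1 x ^ 2 + δ ^ 2 := by ext x; exact Nd_eq w δ x
  rw [this]
  have h0 := wc_smooth hw 0
  have h1 := wc_smooth hw 1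
  fun_prop

lemma Nd_deriv {w : R2 → ℂ} (hw : ContDiff ℝ ∞ w) (δ : ℝ) (x : R2) : ∃ L : R2 →L[ℝ] ℝ, HasFDerivAt (Nd w δ) L x ∧
    ∀ v, L v = 2 * (wc w 0 x * fderiv ℝ (wc w 0) x v + wc w 1 x * fderiv ℝ (wc w 1) x v) := by
  have : Nd w δ = fun x => wc w 0 x ^ 2 + wc w 1 x ^ 2 + δ ^ 2 := by ext x; exact Nd_eq w δ x
  rw [this]
  have h0 := ((wc_smooth hw 0).differentiable (by simp) x).hasFDerivAt
  have h1 := ((wc_smooth hw 1).differentiable (by simp) x).hasFDerivAt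
  refine ⟨_, ((h0.pow 2).add (h1.pow 2)).add_const _, fun v => ?_⟩
  simp
  ring

/-- regularised components of `w/|w|` -/
def Fr (w : R2 → ℂ) (δ : ℝ) (i : Fin 2) (x : R2) : ℝ := wc w i x * (√(Nd w δ x))⁻¹

lemma Fr_smooth {w : R2 → ℂ} (hw : ContDiff ℝ ∞ w) {δ : ℝ} (hδ : 0 < δ) (i : Fin 2) : ContDiff ℝ ∞ (Fr w δ i) := by
  apply (wc_smooth hw i).mul
  apply ContDiff.inv
  · exact (Nd_smooth hw δ).sqrt fun x => (Nd_pos w hδ x).ne'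
  · intro x
    exact (Real.sqrt_pos.2 (Nd_pos w hδ x)).ne'

lemma Fr_deriv {w : R2 → ℂ} (hw : ContDiff ℝ ∞ w) {δ : ℝ} (hδ : 0 < δ) (i : Fin 2) (x v : R2) :
    fderiv ℝ (Fr w δ i) x v = fderiv ℝ (wc w i) x v * (√(Nd w δ x))⁻¹ -
      wc w i x * (wc w 0 x * fderiv ℝ (wc w 0) x v + wc w 1 x * fderiv ℝ (wc w 1) x v) * (√(Nd w δ x) ^ 3)⁻¹ := by
  obtain ⟨L, h1, h2⟩ := Nd_deriv hw δ x
  have hp := Nd_pos w hδ x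
  have hs := Real.sqrt_pos.2 hp
  have h3 := h1.sqrt hp.ne'
  have h4 := (hasDerivAt_inv hs.ne').comp_hasFDerivAt x h3
  have h5 : HasFDerivAt (Fr w δ i) _ x := ((wc_smooth hw i).differentiable (by simp) x).hasFDerivAt.mul h4
  rw [h5.fderiv]
  simp [h2]
  field_simp
  ring

lemma seq_pos (k : ℕ) : (0:ℝ) < 1 / (k + 1) := by positivity

lemma seq_tendsto : Tendsto (fun k : ℕ => (1:ℝ) / (k + 1)) atTop (𝓝 0) := tendsto_one_div_add_atTop_nhds_zero_nat

lemma Nd_tendsto (w : R2 → ℂ) (x : R2) : Tendsto (fun k : ℕ => Nd w (1 / (k + 1)) x) atTop (𝓝 (‖w x‖ ^ 2)) := by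
  have := (seq_tendsto.pow 2).const_add (‖w x‖ ^ 2)
  simpa [Nd] using this

lemma sqNd_tendsto (w : R2 → ℂ) (x : R2) : Tendsto (fun k : ℕ => √(Nd w (1 / (k + 1)) x)) atTop (𝓝 (‖w x‖)) := by
  have := (Nd_tendsto w x).sqrt
  rwa [Real.sqrt_sq (norm_nonneg _)] at this

lemma norm_le_sqNd (w : R2 → ℂ) (δ : ℝ) (x : R2) : ‖w x‖ ≤ √(Nd w δ x) := by
  apply Real.le_sqrt_of_sq_le; unfold Nd; nlinarith [sq_nonneg δ]

lemma wc_le (w : R2 → ℂ) (i : Fin 2) (x : R2) : |wc w i x| ≤ ‖w x‖ := by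
  rw [wc]; refine (coord_le_norm _ i).trans ?_; rw [LinearIsometryEquiv.norm_map]

lemma wcd_le {w : R2 → ℂ} (hw : ContDiff ℝ ∞ w) (i j : Fin 2) (x : R2) : |fderiv ℝ (wc w i) x (ee j)| ≤ ‖dw w j x‖ := by
  rw [wc_deriv hw]; refine (coord_le_norm _ i).trans ?_; rw [LinearIsometryEquiv.norm_map, dw]

lemma Fr_le (w : R2 → ℂ) {δ : ℝ} (hδ : 0 < δ) (i : Fin 2) (x : R2) : |Fr w δ i x| ≤ 1 := by
  have hs := Real.sqrt_pos.2 (Nd_pos w hδ x)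
  rw [Fr, abs_mul, abs_inv, abs_of_pos hs, ← div_eq_mul_inv, div_le_one hs]
  exact (wc_le w i x).trans (norm_le_sqNd w δ x)

lemma Fr_deriv_le {w : R2 → ℂ} (hw : ContDiff ℝ ∞ w) {δ : ℝ} (hδ : 0 < δ) (i j : Fin 2) (x : R2) (hx : w x ≠ 0) :
    |fderiv ℝ (Fr w δ i) x (ee j)| ≤ 3 * Den w x := by
  have hs := Real.sqrt_pos.2 (Nd_pos w hδ x)
  have hn := norm_le_sqNd w δ x
  have hwp : 0 < ‖w x‖ := norm_pos_iff.2 hx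
  have key : ‖dw w j x‖ * ‖w x‖⁻¹ ≤ Den w x := by
    unfold Den; gcongr; fin_cases j <;> simp
  set S := √(Nd w δ x) with hS
  have hSi : S⁻¹ ≤ ‖w x‖⁻¹ := inv_anti₀ hwp hn
  have t1 : |fderiv ℝ (wc w i) x (ee j) * S⁻¹| ≤ ‖dw w j x‖ * ‖w x‖⁻¹ := by
    rw [abs_mul, abs_of_pos (inv_pos.2 hs)]
    gcongr; exact wcd_le hw i j x
  have t2 : |wc w i x * (wc w 0 x * fderiv ℝ (wc w 0) x (ee j) + wc w 1 x * fderiv ℝ (wc w 1) x (ee j)) * (S ^ 3)⁻¹| ≤ 2 * (‖dw w j x‖ * ‖w x‖⁻¹) := by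
    have t3 : |wc w 0 x * fderiv ℝ (wc w 0) x (ee j) + wc w 1 x * fderiv ℝ (wc w 1) x (ee j)| ≤ 2 * (S * ‖dw w j x‖) := by
      refine (abs_add_le _ _).trans ?_
      rw [abs_mul, abs_mul, two_mul]
      gcongr
      · exact (wc_le w 0 x).trans hn
      · exact wcd_le hw 0 j x
      · exact (wc_le w 1 x).trans hn
      · exact wcd_le hw 1 j x
    rw [abs_mul, abs_mul, abs_of_pos (a := (S^3)⁻¹) (by positivity)]
    calc _ ≤ S * (2 * (S * ‖dw w j x‖)) * (S ^ 3)⁻¹ := by gcongr; exact (wc_le w i x).trans hn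
      _ = 2 * (‖dw w j x‖ * S⁻¹) := by field_simp
      _ ≤ _ := by gcongr
  rw [Fr_deriv hw hδ]
  refine (abs_sub _ _).trans ?_
  linarith

lemma Fr_tendsto (w : R2 → ℂ) (i : Fin 2) (x : R2) (hx : w x ≠ 0) :
    Tendsto (fun k : ℕ => Fr w (1 / (k + 1)) i x) atTop (𝓝 (Pu w x i)) := by
  have h := ((sqNd_tendsto w x).inv₀ (norm_ne_zero_iff.2 hx)).const_mul (wc w i x)
  have : Pu w x i = wc w i x * ‖w x‖⁻¹ := by simp [Pu, wc]; ring
  rw [this]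
  exact h

lemma Fr_deriv_tendsto {w : R2 → ℂ} (hw : ContDiff ℝ ∞ w) (i j : Fin 2) (x : R2) (hx : w x ≠ 0) :
    Tendsto (fun k : ℕ => fderiv ℝ (Fr w (1 / (k + 1)) i) x (ee j)) atTop (𝓝 (PG w x i j)) := by
  have hn := norm_ne_zero_iff.2 hx
  have h1 := ((sqNd_tendsto w x).inv₀ hn).const_mul (fderiv ℝ (wc w i) x (ee j))
  have h2 := (((sqNd_tendsto w x).pow 3).inv₀ (pow_ne_zero 3 hn)).const_mul (wc w i x * (wc w 0 x * fderiv ℝ (wc w 0) x (ee j) + wc w 1 x * fderiv ℝ (wc w 1) x (ee j)))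
  have h3 := h1.sub h2
  have e : ∀ k : ℕ, fderiv ℝ (Fr w (1 / (k + 1)) i) x (ee j) = _ := fun k => Fr_deriv hw (seq_pos k) i x (ee j)
  simp only [e]
  have e2 : PG w x i j = fderiv ℝ (wc w i) x (ee j) * ‖w x‖⁻¹ -
      wc w i x * (wc w 0 x * fderiv ℝ (wc w 0) x (ee j) + wc w 1 x * fderiv ℝ (wc w 1) x (ee j)) * (‖w x‖ ^ 3)⁻¹ := by
    have hsq : ‖w x‖ ^ 2 = wc w 0 x ^ 2 + wc w 1 x ^ 2 := by
      have := Nd_eq w 0 x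
      simpa [Nd] using this
    have d0 : fderiv ℝ (wc w 0) x (ee j) = (dw w j x).re := by rw [wc_deriv hw, symm_toC_0, dw]
    have d1 : fderiv ℝ (wc w 1) x (ee j) = (dw w j x).im := by rw [wc_deriv hw, symm_toC_1, dw]
    have e3 : ∀ t : ℝ, t * ‖w x‖⁻¹ = t * (wc w 0 x ^ 2 + wc w 1 x ^ 2) * (‖w x‖ ^ 3)⁻¹ := by
      intro t
      rw [← hsq]; field_simp
    rw [e3, ← sub_mul, PG, Matrix.of_apply]
    congr 1
    fin_cases i <;> simp [perp, kap, d0, d1, wc0, wc1] <;> ring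
  rw [e2]
  exact h3

lemma ae_ne_zero {Ω : Set R2} (hΩo : IsOpen Ω) {w : R2 → ℂ} (hw : GoodMap Ω w) : ∀ᵐ x ∂(volume.restrict Ω), w x ≠ 0 := by
  have h := measure_eq_zero_iff_ae_notMem.1 (hw.fin.measure_zero volume)
  filter_upwards [ae_restrict_of_ae h, ae_restrict_mem hΩo.measurableSet] with x hx hx2 h0
  exact hx ⟨hx2, h0⟩

lemma vol_fin {Ω : Set R2} (hΩb : Bornology.IsBounded Ω) : IsFiniteMeasure (volume.restrict Ω) :=
  ⟨by rw [Measure.restrict_apply_univ]; exact hΩb.measure_lt_top⟩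

lemma good_w11 {Ω : Set R2} (hΩo : IsOpen Ω) (hΩb : Bornology.IsBounded Ω) {w : R2 → ℂ} (hw : GoodMap Ω w) :
    MemW11 Ω (Pu w) (PG w) := by
  have := vol_fin hΩb
  refine ⟨?_, fun i j => ?_, ?_⟩
  · refine Integrable.of_bound (Pu_meas hw.smooth).aestronglyMeasurable 1 (ae_of_all _ fun x => ?_)
    rw [Pu, norm_smul, LinearIsometryEquiv.norm_map, norm_inv, norm_norm]
    exact inv_mul_le_one
  · exact hw.int.mono' (PG_meas hw.smooth i j).aestronglyMeasurable (ae_of_all _ fun x => abs_PG_le_Den w x i j)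
  · intro φ hφ hφc hφs i j
    have hφc0 : Continuous φ := hφ.continuous
    have hdc : Continuous fun x => fderiv ℝ φ x (ee j) := (hφ.continuous_fderiv (by simp)).clm_apply continuous_const
    obtain ⟨L, hL⟩ := hφ.lipschitzWith_of_hasCompactSupport hφc (by simp)
    obtain ⟨C, hC⟩ := hφc.exists_bound_of_continuous hφc0
    have hae := ae_ne_zero hΩo hw
    have key : ∀ k : ℕ, (∫ x in Ω, Fr w (1 / (k + 1)) i x * fderiv ℝ φ x (ee j)) = - ∫ x in Ω, fderiv ℝ (Fr w (1 / (k + 1)) i) x (ee j) * φ x :=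
      fun k => ibp_lip_on Ω _ φ (Fr_smooth hw.smooth (seq_pos k) i) L hL hφc hφs (ee j)
    have l1 : Tendsto (fun k : ℕ => ∫ x in Ω, Fr w (1 / (k + 1)) i x * fderiv ℝ φ x (ee j)) atTop (𝓝 (∫ x in Ω, Pu w x i * fderiv ℝ φ x (ee j))) := by
      apply tendsto_integral_of_dominated_convergence (fun x => |fderiv ℝ φ x (ee j)|)
      · intro k
        exact ((Fr_smooth hw.smooth (seq_pos k) i).continuous.mul hdc).aestronglyMeasurable
      · exact (cont_intOn hΩb hdc).abs
      · intro k
        refine ae_of_all _ fun x => ?_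
        rw [Real.norm_eq_abs, abs_mul]
        exact mul_le_of_le_one_left (abs_nonneg _) (Fr_le w (seq_pos k) i x)
      · filter_upwards [hae] with x hx
        exact (Fr_tendsto w i x hx).mul_const _
    have l2 : Tendsto (fun k : ℕ => ∫ x in Ω, fderiv ℝ (Fr w (1 / (k + 1)) i) x (ee j) * φ x) atTop (𝓝 (∫ x in Ω, PG w x i j * φ x)) := by
      apply tendsto_integral_of_dominated_convergence (fun x => 3 * Den w x * C)
      · intro k
        exact ((((Fr_smooth hw.smooth (seq_pos k) i).continuous_fderiv (by simp)).clm_apply continuous_const).mul hφc0).aestronglyMeasurable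
      · exact (hw.int.const_mul 3).mul_const C
      · intro k
        filter_upwards [hae] with x hx
        rw [norm_mul]
        have h1 := Fr_deriv_le hw.smooth (seq_pos k) i j x hx
        have h2 := hC x
        have h3 : 0 ≤ Den w x := by unfold Den; positivity
        rw [Real.norm_eq_abs (fderiv _ _ _ _)]
        gcongr
      · filter_upwards [hae] with x hx
        exact (Fr_deriv_tendsto hw.smooth i j x hx).mul_const _
    have l3 := l2.neg
    simp only [← key] at l3
    exact tendsto_nhds_unique l1 l3

lemma good_sphere {Ω : Set R2} (hΩo : IsOpen Ω) {w : R2 → ℂ} (hw : GoodMap Ω w) : SphereValued Ω (Pu w) := by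
  filter_upwards [ae_ne_zero hΩo hw] with x hx
  rw [Pu, norm_smul, LinearIsometryEquiv.norm_map, norm_inv, norm_norm]
  exact inv_mul_cancel₀ (norm_ne_zero_iff.2 hx)

end

open MeasureTheory Metric Filter Set
open scoped ENNReal NNReal Topology Classical ContDiff Manifold Convolution
noncomputable section

lemma snd_symm {f : R2 → ℝ} (hf : ContDiff ℝ ∞ f) (x u v : R2) :
    fderiv ℝ (fun y => fderiv ℝ f y u) x v = fderiv ℝ (fun y => fderiv ℝ f y v) x u := by
  have hd : DifferentiableAt ℝ (fderiv ℝ f) x := ((hf.fderiv_right (m := 1) (by norm_cast)).differentiable (by simp)) x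
  have h1 : ∀ u, fderiv ℝ (fun y => fderiv ℝ f y u) x = (fderiv ℝ (fderiv ℝ f) x).flip u := by
    intro u
    have := hd.hasFDerivAt.clm_apply (hasFDerivAt_const u x)
    rw [this.fderiv]
    simp
  rw [h1, h1]
  simp only [ContinuousLinearMap.flip_apply]
  have hs : IsSymmSndFDerivAt ℝ f x := hf.contDiffAt.isSymmSndFDerivAt (by simp; norm_cast)
  exact hs.eq v u

def pd (f : R2 → ℝ) (j : Fin 2) (x : R2) : ℝ := fderiv ℝ f x (ee j)

lemma pd_smooth {f : R2 → ℝ} (hf : ContDiff ℝ ∞ f) (j : Fin 2) : ContDiff ℝ ∞ (pd f j) :=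
  (hf.fderiv_right (m := ∞) (by simp)).clm_apply contDiff_const

lemma kap_eq2 {w : R2 → ℂ} (hw : ContDiff ℝ ∞ w) (j : Fin 2) :
    kap w j = fun x => wc w 0 x * pd (wc w 1) j x - wc w 1 x * pd (wc w 0) j x := by
  ext x
  rw [pd, pd, wc_deriv hw, wc_deriv hw, symm_toC_0, symm_toC_1, kap, wc0, wc1, dw]

lemma kap_smooth {w : R2 → ℂ} (hw : ContDiff ℝ ∞ w) (j : Fin 2) : ContDiff ℝ ∞ (kap w j) := by
  rw [kap_eq2 hw]
  have h0 := wc_smooth hw 0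
  have h1 := wc_smooth hw 1
  exact (h0.mul (pd_smooth h1 j)).sub (h1.mul (pd_smooth h0 j))

lemma kap_deriv {w : R2 → ℂ} (hw : ContDiff ℝ ∞ w) (j l : Fin 2) (x : R2) :
    pd (kap w j) l x = pd (wc w 0) l x * pd (wc w 1) j x + wc w 0 x * pd (pd (wc w 1) j) l x
      - pd (wc w 1) l x * pd (wc w 0) j x - wc w 1 x * pd (pd (wc w 0) j) l x := by
  have h0 := wc_smooth hw 0
  have h1 := wc_smooth hw 1
  have d : ∀ {f : R2 → ℝ}, ContDiff ℝ ∞ f → HasFDerivAt f (fderiv ℝ f x) x := fun hf => (hf.differentiable (by simp) x).hasFDerivAt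
  have h3 := ((d h0).mul (d (pd_smooth h1 j))).sub ((d h1).mul (d (pd_smooth h0 j)))
  rw [pd, kap_eq2 hw]
  erw [h3.fderiv]
  simp [pd]
  ring

/-- regularised current -/
def lamd (w : R2 → ℂ) (δ : ℝ) (j : Fin 2) (x : R2) : ℝ := kap w j x * (Nd w δ x)⁻¹

lemma lamd_smooth {w : R2 → ℂ} (hw : ContDiff ℝ ∞ w) {δ : ℝ} (hδ : 0 < δ) (j : Fin 2) : ContDiff ℝ ∞ (lamd w δ j) :=
  (kap_smooth hw j).mul ((Nd_smooth hw δ).inv fun x => (Nd_pos w hδ x).ne')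

lemma lamd_deriv {w : R2 → ℂ} (hw : ContDiff ℝ ∞ w) {δ : ℝ} (hδ : 0 < δ) (j l : Fin 2) (x : R2) :
    pd (lamd w δ j) l x = pd (kap w j) l x * (Nd w δ x)⁻¹ - kap w j x *
      (2 * (wc w 0 x * pd (wc w 0) l x + wc w 1 x * pd (wc w 1) l x)) * (Nd w δ x ^ 2)⁻¹ := by
  obtain ⟨L, h1, h2⟩ := Nd_deriv hw δ x
  have hp := Nd_pos w hδ x
  have h4 := (hasDerivAt_inv hp.ne').comp_hasFDerivAt x h1
  have h5 : HasFDerivAt (lamd w δ j) _ x := ((kap_smooth hw j).differentiable (by simp) x).hasFDerivAt.mul h4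
  rw [pd, h5.fderiv]
  simp [h2, pd]
  ring

lemma lamd_div {w : R2 → ℂ} (hw : ContDiff ℝ ∞ w) {δ : ℝ} (hδ : 0 < δ) (x : R2) :
    pd (lamd w δ 0) 1 x - pd (lamd w δ 1) 0 x = - (2 * jac w x * δ ^ 2 * (Nd w δ x ^ 2)⁻¹) := by
  have hp := (Nd_pos w hδ x).ne'
  have hN := Nd_eq w δ x
  have s0 : pd (pd (wc w 0) 0) 1 x = pd (pd (wc w 0) 1) 0 x := snd_symm (wc_smooth hw 0) x _ _
  have s1 : pd (pd (wc w 1) 0) 1 x = pd (pd (wc w 1) 1) 0 x := snd_symm (wc_smooth hw 1) x _ _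
  have e : ∀ j, (dw w j x).re = pd (wc w 0) j x ∧ (dw w j x).im = pd (wc w 1) j x := by
    intro j
    rw [pd, pd, wc_deriv hw, wc_deriv hw, symm_toC_0, symm_toC_1, dw]
    exact ⟨rfl, rfl⟩
  rw [lamd_deriv hw hδ, lamd_deriv hw hδ, kap_deriv hw, kap_deriv hw, kap_eq2 hw, kap_eq2 hw, jac, (e 0).1, (e 0).2, (e 1).1, (e 1).2, s0, s1]
  field_simp
  rw [hN]
  ring

lemma int_profile : Integrable (fun y : R2 => ((1 + ‖y‖ ^ 2) ^ 2)⁻¹) ∧ ∫ y : R2, ((1 + ‖y‖ ^ 2) ^ 2)⁻¹ = Real.pi := by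
  constructor
  · have h := integrable_rpow_neg_one_add_norm_sq (E := R2) (μ := volume) (r := 4) (by simp; norm_num)
    refine h.congr (ae_of_all _ fun y => ?_)
    dsimp only
    rw [show (-4 / 2 : ℝ) = -((2:ℕ):ℝ) by norm_num, Real.rpow_neg (by positivity), Real.rpow_natCast]
  · have h := integral_fun_norm_addHaar (E := R2) volume (fun r : ℝ => ((1 + r ^ 2) ^ 2)⁻¹)
    rw [h]
    have hv : volume.real (ball (0:R2) 1) = Real.pi := by
      rw [measureReal_def, vol_ball 0 1 zero_le_one, ENNReal.toReal_ofReal (by positivity)]; simp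
    have hI : ∫ y in Ioi (0:ℝ), y ^ (Module.finrank ℝ R2 - 1) • ((1 + y ^ 2) ^ 2)⁻¹ = 1 / 2 := by
      have hd : ∀ y ∈ Ioi (0:ℝ), HasDerivAt (fun y : ℝ => -(1/2) * (1 + y ^ 2)⁻¹) (y ^ (Module.finrank ℝ R2 - 1) • ((1 + y ^ 2) ^ 2)⁻¹) y := by
        intro y _
        have h1 : HasDerivAt (fun y : ℝ => 1 + y ^ 2) (2 * y) y := by
          simpa using ((hasDerivAt_id y).pow 2).const_add 1
        have h2 := (h1.inv (by positivity)).const_mul (-(1/2))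
        refine h2.congr_deriv ?_
        simp
        field_simp
      have hc : ContinuousWithinAt (fun y : ℝ => -(1/2) * (1 + y ^ 2)⁻¹) (Ici 0) 0 := by
        apply Continuous.continuousWithinAt
        have : ∀ y : ℝ, 1 + y ^ 2 ≠ 0 := fun y => by positivity
        fun_prop (disch := assumption)
      have ht : Tendsto (fun y : ℝ => -(1/2) * (1 + y ^ 2)⁻¹) atTop (𝓝 0) := by
        have h1 : Tendsto (fun y : ℝ => 1 + y ^ 2) atTop atTop := tendsto_atTop_add_const_left _ _ (tendsto_pow_atTop (by norm_num))
        have h2 := h1.inv_tendsto_atTop.const_mul (-(1/2))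
        rw [mul_zero] at h2
        exact h2
      have := integral_Ioi_of_hasDerivAt_of_nonneg hc hd (fun y hy => by have : (0:ℝ) < y := hy; positivity) ht
      rw [this]; norm_num
    rw [hI, hv]
    simp
    ring

lemma concentrate (φ : R2 → ℝ) (hφ : Continuous φ) (C : ℝ) (hC : ∀ x, |φ x| ≤ C) (q : R2) (r c : ℝ) (hr : 0 < r) (hc : 0 < c) :
    Tendsto (fun k : ℕ => ∫ z in ball q r, φ z * (c ^ 2 * (1 / (k + 1) : ℝ) ^ 2 * ((c ^ 2 * ‖z - q‖ ^ 2 + (1 / (k + 1) : ℝ) ^ 2) ^ 2)⁻¹))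
      atTop (𝓝 (Real.pi * φ q)) := by
  have e : ∀ k : ℕ, ∫ z in ball q r, φ z * (c ^ 2 * (1 / (k + 1) : ℝ) ^ 2 * ((c ^ 2 * ‖z - q‖ ^ 2 + (1 / (k + 1) : ℝ) ^ 2) ^ 2)⁻¹)
      = ∫ y : R2, (ball (0:R2) (r * c * (k + 1))).indicator (fun y => φ (q + ((1 / (k + 1) : ℝ) / c) • y) * ((1 + ‖y‖ ^ 2) ^ 2)⁻¹) y := by
    intro k
    set δ : ℝ := 1 / (k + 1) with hδ
    have hδp : 0 < δ := seq_pos k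
    rw [← integral_indicator measurableSet_ball, ← integral_add_left_eq_self _ q]
    have hs := Measure.integral_comp_smul (volume : Measure R2) (fun x => (ball q r).indicator (fun z => φ z * (c ^ 2 * δ ^ 2 * ((c ^ 2 * ‖z - q‖ ^ 2 + δ ^ 2) ^ 2)⁻¹)) (q + x)) (δ / c)
    have hf : Module.finrank ℝ R2 = 2 := by simp
    rw [hf, abs_of_pos (by positivity), smul_eq_mul, eq_comm, inv_mul_eq_iff_eq_mul₀ (by positivity)] at hs
    rw [hs, ← integral_const_mul]
    apply integral_congr_ae
    refine ae_of_all _ fun y => ?_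
    dsimp only
    by_cases hy : y ∈ ball (0:R2) (r * c * (k + 1))
    · have hy2 : q + (δ / c) • y ∈ ball q r := by
        rw [mem_ball_zero_iff] at hy
        rw [mem_ball, dist_eq_norm, add_sub_cancel_left, norm_smul, Real.norm_of_nonneg (by positivity)]
        rw [hδ]; field_simp
        linarith
      rw [indicator_of_mem hy, indicator_of_mem hy2, add_sub_cancel_left, norm_smul, Real.norm_of_nonneg (by positivity)]
      have : (c ^ 2 * (δ / c * ‖y‖) ^ 2 + δ ^ 2) = δ ^ 2 * (1 + ‖y‖ ^ 2) := by field_simp; ring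
      rw [this]
      field_simp
    · have hy2 : q + (δ / c) • y ∉ ball q r := by
        rw [mem_ball_zero_iff] at hy
        rw [mem_ball, dist_eq_norm, add_sub_cancel_left, norm_smul, Real.norm_of_nonneg (by positivity)]
        rw [hδ]; field_simp
        linarith
      rw [indicator_of_notMem hy, indicator_of_notMem hy2, mul_zero]
  simp only [e]
  have hlim : Real.pi * φ q = ∫ y : R2, φ q * ((1 + ‖y‖ ^ 2) ^ 2)⁻¹ := by
    rw [integral_const_mul, int_profile.2, mul_comm]
  rw [hlim]
  apply tendsto_integral_of_dominated_convergence (fun y => C * ((1 + ‖y‖ ^ 2) ^ 2)⁻¹)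
  · intro k
    apply AEStronglyMeasurable.indicator _ measurableSet_ball
    apply Continuous.aestronglyMeasurable
    have : ∀ y : R2, (1 + ‖y‖ ^ 2) ^ 2 ≠ 0 := fun y => by positivity
    fun_prop (disch := assumption)
  · exact int_profile.1.const_mul C
  · intro k
    refine ae_of_all _ fun y => ?_
    refine (norm_indicator_le_norm_self _ _).trans ?_
    rw [norm_mul, Real.norm_of_nonneg (r := ((1 + ‖y‖ ^ 2) ^ 2)⁻¹) (by positivity)]
    gcongr
    exact hC _
  · refine ae_of_all _ fun y => ?_
    have hev : ∀ᶠ k : ℕ in atTop, φ (q + ((1 / (k + 1) : ℝ) / c) • y) * ((1 + ‖y‖ ^ 2) ^ 2)⁻¹ = (ball (0:R2) (r * c * (k + 1))).indicator (fun y => φ (q + ((1 / (k + 1) : ℝ) / c) • y) * ((1 + ‖y‖ ^ 2) ^ 2)⁻¹) y := by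
      have ht : Tendsto (fun k : ℕ => r * c * ((k:ℝ) + 1)) atTop atTop :=
        (tendsto_atTop_add_const_right _ _ tendsto_natCast_atTop_atTop).const_mul_atTop (by positivity)
      filter_upwards [ht.eventually_gt_atTop ‖y‖] with k hk
      rw [indicator_of_mem]
      rwa [mem_ball_zero_iff]
    refine Tendsto.congr' hev ?_
    apply Tendsto.mul_const
    have h1 : Tendsto (fun k : ℕ => q + ((1 / (k + 1) : ℝ) / c) • y) atTop (𝓝 (q + ((0:ℝ) / c) • y)) :=
      ((seq_tendsto.div_const c).smul_const y).const_add q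
    rw [zero_div, zero_smul, add_zero] at h1
    exact (hφ.tendsto q).comp h1

end

open MeasureTheory Metric Filter Set
open scoped ENNReal NNReal Topology Classical ContDiff Manifold Convolution
noncomputable section

def sg (σ : Bool) : ℝ := if σ then 1 else -1

lemma jac_std {w : R2 → ℂ} {a : R2} {σ : Bool} {c r : ℝ} (h : ∀ z ∈ ball a r, w z = (c : ℂ) * tau σ (z - a)) (x : R2) (hx : x ∈ ball a r) :
    jac w x = sg σ * c ^ 2 := by
  have hev : w =ᶠ[𝓝 x] fun z => (c : ℂ) * tau σ (z - a) := by
    filter_upwards [isOpen_ball.mem_nhds hx] with z hz using h z hz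
  have hd : ∀ j, dw (fun z => (c : ℂ) * tau σ (z - a)) j x = c * tau σ (ee j) := by
    intro j
    have h3 : HasFDerivAt (fun z => tau σ (z - a)) (((tau σ).toContinuousLinearEquiv : R2 →L[ℝ] ℂ).comp (ContinuousLinearMap.id ℝ R2)) x :=
      ((tau σ).toContinuousLinearEquiv : R2 →L[ℝ] ℂ).hasFDerivAt.comp x ((hasFDerivAt_id x).sub_const a)
    have h4 := h3.const_mul (c : ℂ)
    rw [dw, h4.fderiv]
    simp
  rw [jac_congr hev, jac, hd, hd]
  cases σ <;> simp [tau, sg] <;> ring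

lemma vortex_data {Ω : Set R2} (hΩo : IsOpen Ω) {w : R2 → ℂ} (hw : GoodMap Ω w) (hStd : ∀ a ∈ Ω, w a = 0 → Std w a) (ε : ℝ) (hε : 0 < ε) :
    ∃ (σ : R2 → Bool) (c : R2 → ℝ) (r : ℝ), 0 < r ∧ r < ε ∧ ∀ a ∈ {x ∈ Ω | w x = 0}, 0 < c a ∧ closedBall a r ⊆ Ω ∧
      (∀ z ∈ ball a r, w z = (c a : ℂ) * tau (σ a) (z - a)) ∧ ∀ b ∈ {x ∈ Ω | w x = 0}, a ≠ b → Disjoint (closedBall a r) (closedBall b r) := by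
  have h : ∀ a, ∃ (σ : Bool) (c ρ : ℝ), a ∈ {x ∈ Ω | w x = 0} → 0 < c ∧ 0 < ρ ∧ ∀ z ∈ ball a ρ, w z = (c : ℂ) * tau σ (z - a) := by
    intro a
    by_cases ha : a ∈ {x ∈ Ω | w x = 0}
    · obtain ⟨σ, c, ρ, h⟩ := hStd a ha.1 ha.2
      exact ⟨σ, c, ρ, fun _ => h⟩
    · exact ⟨true, 1, 1, fun h => absurd h ha⟩
  choose σ c ρ h using h
  have ev : ∀ᶠ r : ℝ in 𝓝[>] 0, ∀ a ∈ {x ∈ Ω | w x = 0}, (closedBall a r ⊆ Ω ∧ r < ρ a) ∧ ∀ b ∈ {x ∈ Ω | w x = 0}, a ≠ b → Disjoint (closedBall a r) (closedBall b r) := by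
    rw [eventually_all_finite hw.fin]
    intro a ha
    refine Eventually.and (Eventually.and ?_ ?_) ?_
    · obtain ⟨r, hr, hr2⟩ := Metric.nhds_basis_closedBall.mem_iff.1 (hΩo.mem_nhds ha.1)
      filter_upwards [Ioo_mem_nhdsGT hr] with s hs
      exact (closedBall_subset_closedBall hs.2.le).trans hr2
    · filter_upwards [Ioo_mem_nhdsGT (h a ha).2.1] with s hs using hs.2
    · rw [eventually_all_finite hw.fin]
      intro b hb
      by_cases hab : a = b
      · simp [hab]
      · have : 0 < dist a b / 2 := by have := dist_pos.2 hab; positivity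
        filter_upwards [Ioo_mem_nhdsGT this] with s hs _
        apply closedBall_disjoint_closedBall
        linarith [hs.2]
  obtain ⟨r, hr, hr1, hr2⟩ := (ev.and (Ioo_mem_nhdsGT hε)).exists
  refine ⟨σ, c, r, hr1, hr2, fun a ha => ⟨(h a ha).1, (hr a ha).1.1, fun z hz => (h a ha).2.2 z (ball_subset_ball (hr a ha).1.2.le hz), (hr a ha).2⟩⟩

lemma lamVec_good (w : R2 → ℂ) (x : R2) (hx : w x ≠ 0) :
    lambdaVec (Pu w) (PG w) x 0 = -(1/2) * (kap w 1 x * (‖w x‖ ^ 2)⁻¹) ∧ lambdaVec (Pu w) (PG w) x 1 = (1/2) * (kap w 0 x * (‖w x‖ ^ 2)⁻¹) := by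
  have hn := norm_ne_zero_iff.2 hx
  have hsq : ‖w x‖ ^ 2 = (w x).re ^ 2 + (w x).im ^ 2 := by
    rw [← Complex.normSq_eq_norm_sq, Complex.normSq_apply]; ring
  constructor
  · have : lambdaVec (Pu w) (PG w) x 0 = -(1/2) * (kap w 1 x * (((w x).re ^ 2 + (w x).im ^ 2) * (‖w x‖ ^ 4)⁻¹)) := by
      simp [lambdaVec, Pu, PG, perp, symm_toC_0, symm_toC_1]
      field_simp
      ring
    rw [this, ← hsq]; field_simp
  · have : lambdaVec (Pu w) (PG w) x 1 = (1/2) * (kap w 0 x * (((w x).re ^ 2 + (w x).im ^ 2) * (‖w x‖ ^ 4)⁻¹)) := by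
      simp [lambdaVec, Pu, PG, perp, symm_toC_0, symm_toC_1]
      field_simp
    rw [this, ← hsq]; field_simp

lemma lamd_le (w : R2 → ℂ) {δ : ℝ} (hδ : 0 < δ) (j : Fin 2) (x : R2) (hx : w x ≠ 0) : |lamd w δ j x| ≤ Den w x := by
  have hwp : 0 < ‖w x‖ := norm_pos_iff.2 hx
  have key : ‖dw w j x‖ * ‖w x‖⁻¹ ≤ Den w x := by
    unfold Den; gcongr; fin_cases j <;> simp
  have hN := Nd_pos w hδ x
  have hN2 : ‖w x‖ ^ 2 ≤ Nd w δ x := by unfold Nd; nlinarith [sq_nonneg δ]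
  rw [lamd, abs_mul, abs_of_pos (inv_pos.2 hN)]
  calc _ ≤ ‖w x‖ * ‖dw w j x‖ * (‖w x‖ ^ 2)⁻¹ := by
        gcongr
        exact abs_kap_le w j x
    _ = ‖dw w j x‖ * ‖w x‖⁻¹ := by field_simp
    _ ≤ _ := key

lemma lamd_tendsto (w : R2 → ℂ) (j : Fin 2) (x : R2) (hx : w x ≠ 0) :
    Tendsto (fun k : ℕ => lamd w (1 / (k + 1)) j x) atTop (𝓝 (kap w j x * (‖w x‖ ^ 2)⁻¹)) :=
  ((Nd_tendsto w x).inv₀ (pow_ne_zero 2 (norm_ne_zero_iff.2 hx))).const_mul _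

lemma fd_meas (φ : R2 → ℝ) (v : R2) : Measurable fun x => fderiv ℝ φ x v := measurable_fderiv_apply_const ℝ φ v

lemma fd_le {φ : R2 → ℝ} {L : ℝ≥0} (hφ : LipschitzWith L φ) (x : R2) (j : Fin 2) : |fderiv ℝ φ x (ee j)| ≤ L := by
  have h := (fderiv ℝ φ x).le_opNorm (ee j)
  have h2 := norm_fderiv_le_of_lipschitz ℝ hφ (x₀ := x)
  have h3 : ‖ee j‖ = 1 := by simp [ee]
  rw [h3, mul_one] at h
  exact h.trans h2

lemma jac_cont {w : R2 → ℂ} (hw : ContDiff ℝ ∞ w) : Continuous (jac w) := by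
  have h0 := dw_cont hw 0
  have h1 := dw_cont hw 1
  unfold jac
  fun_prop

lemma det_reg {Ω : Set R2} (hΩb : Bornology.IsBounded Ω) {w : R2 → ℂ} (hw : ContDiff ℝ ∞ w) {δ : ℝ} (hδ : 0 < δ)
    (φ : R2 → ℝ) (L : ℝ≥0) (hφ : LipschitzWith L φ) (hφc : HasCompactSupport φ) (hφs : tsupport φ ⊆ Ω) :
    ∫ x in Ω, (1/2) * (lamd w δ 0 x * fderiv ℝ φ x (ee 1) - lamd w δ 1 x * fderiv ℝ φ x (ee 0)) =
      ∫ x in Ω, φ x * (jac w x * δ ^ 2 * (Nd w δ x ^ 2)⁻¹) := by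
  have i1 := ibp_lip_on Ω _ φ (lamd_smooth hw hδ 0) L hφ hφc hφs (ee 1)
  have i2 := ibp_lip_on Ω _ φ (lamd_smooth hw hδ 1) L hφ hφc hφs (ee 0)
  have int1 : ∀ j l : Fin 2, IntegrableOn (fun x => lamd w δ j x * fderiv ℝ φ x (ee l)) Ω := by
    intro j l
    refine (cont_intOn hΩb (lamd_smooth hw hδ j).continuous).mul_bdd (c := L) (fd_meas φ _).aestronglyMeasurable (ae_of_all _ fun x => fd_le hφ x l)
  have int2 : ∀ j l : Fin 2, IntegrableOn (fun x => fderiv ℝ (lamd w δ j) x (ee l) * φ x) Ω := by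
    intro j l
    exact cont_intOn hΩb (((pd_smooth (lamd_smooth hw hδ j) l).continuous).mul hφ.continuous)
  rw [integral_const_mul, integral_sub (int1 0 1) (int1 1 0), i1, i2]
  rw [sub_neg_eq_add, neg_add_eq_sub, ← integral_sub (int2 1 0) (int2 0 1), ← integral_const_mul]
  apply integral_congr_ae
  refine ae_of_all _ fun x => ?_
  dsimp only
  have hd := lamd_div hw hδ x
  simp only [pd] at hd
  linear_combination (-(1/2) * φ x) * hd

lemma det_compact {Ω : Set R2} (hΩo : IsOpen Ω) (hΩb : Bornology.IsBounded Ω) {w : R2 → ℂ} (hw : GoodMap Ω w)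
    (σ : R2 → Bool) (c : R2 → ℝ) (r : ℝ) (hr : 0 < r) (hv : ∀ a ∈ {x ∈ Ω | w x = 0}, 0 < c a ∧ closedBall a r ⊆ Ω ∧
      (∀ z ∈ ball a r, w z = (c a : ℂ) * tau (σ a) (z - a)) ∧ ∀ b ∈ {x ∈ Ω | w x = 0}, a ≠ b → Disjoint (closedBall a r) (closedBall b r))
    (φ : R2 → ℝ) (L : ℝ≥0) (hφ : LipschitzWith L φ) (hφc : HasCompactSupport φ) (hφs : tsupport φ ⊆ Ω) :
    detPairing Ω (Pu w) (PG w) φ = ∑ a ∈ hw.fin.toFinset, Real.pi * (sg (σ a) * φ a) := by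
  have hws := hw.smooth
  obtain ⟨C, hC⟩ := hφc.exists_bound_of_continuous hφ.continuous
  have hae := ae_ne_zero hΩo hw
  have l1 : Tendsto (fun k : ℕ => ∫ x in Ω, (1/2) * (lamd w (1 / (k + 1)) 0 x * fderiv ℝ φ x (ee 1) - lamd w (1 / (k + 1)) 1 x * fderiv ℝ φ x (ee 0)))
      atTop (𝓝 (detPairing Ω (Pu w) (PG w) φ)) := by
    unfold detPairing
    apply tendsto_integral_of_dominated_convergence (fun x => Den w x * L)
    · intro k
      have m0 := (lamd_smooth hws (seq_pos k) 0).continuous.measurable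
      have m1 := (lamd_smooth hws (seq_pos k) 1).continuous.measurable
      exact (((m0.mul (fd_meas φ _)).sub (m1.mul (fd_meas φ _))).const_mul _).aestronglyMeasurable
    · exact hw.int.mul_const _
    · intro k
      filter_upwards [hae] with x hx
      have a0 := lamd_le w (seq_pos k) 0 x hx
      have a1 := lamd_le w (seq_pos k) 1 x hx
      have b0 := fd_le hφ x 0
      have b1 := fd_le hφ x 1
      rw [norm_mul, Real.norm_eq_abs, Real.norm_eq_abs, abs_of_pos (by norm_num : (0:ℝ) < 1/2)]
      have c0 : |lamd w (1 / (k + 1)) 0 x * fderiv ℝ φ x (ee 1)| ≤ Den w x * L := by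
        rw [abs_mul]; gcongr; exact (abs_nonneg _).trans a0
      have c1 : |lamd w (1 / (k + 1)) 1 x * fderiv ℝ φ x (ee 0)| ≤ Den w x * L := by
        rw [abs_mul]; gcongr; exact (abs_nonneg _).trans a0
      have := abs_sub (lamd w (1 / (k + 1)) 0 x * fderiv ℝ φ x (ee 1)) (lamd w (1 / (k + 1)) 1 x * fderiv ℝ φ x (ee 0))
      linarith
    · filter_upwards [hae] with x hx
      have t0 := (lamd_tendsto w 0 x hx).mul_const (fderiv ℝ φ x (ee 1))
      have t1 := (lamd_tendsto w 1 x hx).mul_const (fderiv ℝ φ x (ee 0))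
      have t := (t0.sub t1).const_mul (1/2)
      have e : ∑ j, lambdaVec (Pu w) (PG w) x j * fderiv ℝ φ x (EuclideanSpace.single j 1) = (1/2) * (kap w 0 x * (‖w x‖ ^ 2)⁻¹ * fderiv ℝ φ x (ee 1) - kap w 1 x * (‖w x‖ ^ 2)⁻¹ * fderiv ℝ φ x (ee 0)) := by
        rw [Fin.sum_univ_two, (lamVec_good w x hx).1, (lamVec_good w x hx).2]
        ring
      rw [e]
      exact t
  have hreg : ∀ k : ℕ, _ := fun k => det_reg hΩb hws (seq_pos k) φ L hφ hφc hφs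
  simp only [hreg] at l1
  refine tendsto_nhds_unique l1 ?_
  set Z := hw.fin.toFinset with hZ
  have hZm : ∀ a, a ∈ Z ↔ a ∈ {x ∈ Ω | w x = 0} := fun a => by rw [hZ, Set.Finite.mem_toFinset]
  set U := ⋃ a ∈ Z, ball a r with hU
  have hUo : IsOpen U := isOpen_biUnion fun a _ => isOpen_ball
  have hUΩ : U ⊆ Ω := iUnion₂_subset fun a ha => ball_subset_closedBall.trans (hv a ((hZm a).1 ha)).2.1
  have hcont : ∀ k : ℕ, Continuous fun x => φ x * (jac w x * (1 / (k + 1) : ℝ) ^ 2 * (Nd w (1 / (k + 1)) x ^ 2)⁻¹) := by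
    intro k
    refine hφ.continuous.mul (((jac_cont hws).mul continuous_const).mul (Continuous.inv₀ ((Nd_smooth hws _).continuous.pow 2) ?_))
    intro x
    exact pow_ne_zero 2 (Nd_pos w (seq_pos k) x).ne'
  have hsplit : ∀ k : ℕ, ∫ x in Ω, φ x * (jac w x * (1 / (k + 1) : ℝ) ^ 2 * (Nd w (1 / (k + 1)) x ^ 2)⁻¹) =
      (∑ a ∈ Z, ∫ x in ball a r, φ x * (jac w x * (1 / (k + 1) : ℝ) ^ 2 * (Nd w (1 / (k + 1)) x ^ 2)⁻¹)) +
      ∫ x in Ω \ U, φ x * (jac w x * (1 / (k + 1) : ℝ) ^ 2 * (Nd w (1 / (k + 1)) x ^ 2)⁻¹) := by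
    intro k
    have hi := cont_intOn hΩb (hcont k)
    rw [← integral_biUnion_finset Z (fun a _ => measurableSet_ball), ← setIntegral_union disjoint_sdiff_right (hΩo.measurableSet.diff hUo.measurableSet), union_sdiff_cancel hUΩ]
    · exact hi.mono_set hUΩ
    · exact hi.mono_set sdiff_subset
    · intro a ha b hb hab
      exact ((hv a ((hZm a).1 ha)).2.2.2 b ((hZm b).1 hb) hab).mono ball_subset_closedBall ball_subset_closedBall
    · intro a ha
      exact hi.mono_set (ball_subset_closedBall.trans (hv a ((hZm a).1 ha)).2.1)
  simp only [hsplit]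
  rw [← add_zero (∑ a ∈ Z, _)]
  apply Tendsto.add
  · apply tendsto_finsetSum
    intro a ha
    obtain ⟨v1, v2, v3, v4⟩ := hv a ((hZm a).1 ha)
    have h := (concentrate φ hφ.continuous C hC a r (c a) hr v1).const_mul (sg (σ a))
    have e1 : sg (σ a) * (Real.pi * φ a) = Real.pi * (sg (σ a) * φ a) := by ring
    rw [e1] at h
    refine h.congr fun k => ?_
    rw [← integral_const_mul]
    apply setIntegral_congr_fun measurableSet_ball
    intro z hz
    dsimp only
    rw [jac_std v3 z hz, Nd, v3 z hz, norm_mul, LinearIsometryEquiv.norm_map, Complex.norm_real, Real.norm_of_nonneg v1.le, mul_pow]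
    ring
  · have hK : IsCompact (tsupport φ \ U) := hφc.isCompact.diff hUo
    have hne : ∀ x ∈ Ω \ U, w x ≠ 0 := by
      intro x hx h0
      apply hx.2
      rw [hU]
      simp only [mem_iUnion]
      exact ⟨x, (hZm x).2 ⟨hx.1, h0⟩, mem_ball_self hr⟩
    have hne2 : ∀ x ∈ tsupport φ \ U, w x ≠ 0 := fun x hx => hne x ⟨hφs hx.1, hx.2⟩
    obtain ⟨B, hB⟩ := hK.exists_bound_of_continuousOn (f := fun x => ‖w x‖⁻¹)
      (ContinuousOn.inv₀ hws.continuous.norm.continuousOn fun x hx => norm_ne_zero_iff.2 (hne2 x hx))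
    have hz : (0:ℝ) = ∫ x in Ω \ U, (0:ℝ) := by simp
    rw [hz]
    apply tendsto_integral_of_dominated_convergence (fun x => |φ x * jac w x| * ((B ^ 2) ^ 2))
    · intro k
      exact (hcont k).aestronglyMeasurable
    · have hc : Continuous fun x => |φ x * jac w x| * ((B ^ 2) ^ 2) := ((hφ.continuous.mul (jac_cont hws)).abs).mul continuous_const
      exact (cont_intOn hΩb hc).mono_set sdiff_subset
    · intro k
      filter_upwards [ae_restrict_mem (hΩo.measurableSet.diff hUo.measurableSet)] with x hx
      by_cases hxs : x ∈ tsupport φ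
      · have hwx := hne x hx
        have hwp : 0 < ‖w x‖ := norm_pos_iff.2 hwx
        have hb := hB x ⟨hxs, hx.2⟩
        rw [norm_inv, norm_norm] at hb
        have hN := Nd_pos w (seq_pos k) x
        have hN2 : ‖w x‖ ^ 2 ≤ Nd w (1 / (k + 1)) x := by unfold Nd; nlinarith [sq_nonneg ((1:ℝ) / (k + 1))]
        have hN3 : (Nd w (1 / (k + 1)) x)⁻¹ ≤ B ^ 2 := by
          calc (Nd w (1 / (k + 1)) x)⁻¹ ≤ (‖w x‖ ^ 2)⁻¹ := inv_anti₀ (by positivity) hN2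
            _ = (‖w x‖⁻¹) ^ 2 := by rw [inv_pow]
            _ ≤ _ := by gcongr
        have hd1 : (1 / (k + 1) : ℝ) ^ 2 ≤ 1 := by
          apply pow_le_one₀ (seq_pos k).le
          rw [div_le_one (by positivity)]
          linarith [(Nat.cast_nonneg k : (0:ℝ) ≤ k)]
        have e : φ x * (jac w x * (1 / (k + 1) : ℝ) ^ 2 * (Nd w (1 / (k + 1)) x ^ 2)⁻¹) = (φ x * jac w x) * ((1 / (k + 1) : ℝ) ^ 2 * ((Nd w (1 / (k + 1)) x)⁻¹) ^ 2) := by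
          rw [inv_pow]; ring
        rw [e, norm_mul, Real.norm_eq_abs, Real.norm_of_nonneg (by positivity)]
        gcongr
        calc (1 / (k + 1) : ℝ) ^ 2 * ((Nd w (1 / (k + 1)) x)⁻¹) ^ 2 ≤ 1 * (B ^ 2) ^ 2 := by gcongr
          _ = _ := one_mul _
      · rw [image_eq_zero_of_notMem_tsupport hxs]; simp
    · filter_upwards [ae_restrict_mem (hΩo.measurableSet.diff hUo.measurableSet)] with x hx
      have hwx := norm_ne_zero_iff.2 (hne x hx)
      have t1 := ((Nd_tendsto w x).pow 2).inv₀ (pow_ne_zero 2 (pow_ne_zero 2 hwx))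
      have t2 := (((seq_tendsto.pow 2).const_mul (jac w x)).mul t1).const_mul (φ x)
      simpa using t2

end

open MeasureTheory Metric Filter Set
open scoped ENNReal NNReal Topology Classical ContDiff Manifold Convolution
noncomputable section

lemma lam_le (u : R2 → R2) (G : R2 → Matrix (Fin 2) (Fin 2) ℝ) (x : R2) (hx : ‖u x‖ = 1) (j : Fin 2) :
    |lambdaVec u G x j| ≤ HH G x := by
  have h0 : |u x 0| ≤ 1 := hx ▸ coord_le_norm (u x) 0
  have h1 : |u x 1| ≤ 1 := hx ▸ coord_le_norm (u x) 1
  have key : ∀ a b p q : ℝ, |a| ≤ 1 → |b| ≤ 1 → |a * p| ≤ |p| ∧ |b * q| ≤ |q| := by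
    intro a b p q ha hb
    rw [abs_mul, abs_mul]
    exact ⟨mul_le_of_le_one_left (abs_nonneg _) ha, mul_le_of_le_one_left (abs_nonneg _) hb⟩
  have n00 := abs_nonneg (G x 0 0)
  have n01 := abs_nonneg (G x 0 1)
  have n10 := abs_nonneg (G x 1 0)
  have n11 := abs_nonneg (G x 1 1)
  simp only [HH, Fin.sum_univ_two]
  fin_cases j
  · obtain ⟨k1, k2⟩ := key _ _ (G x 1 1) (G x 0 1) h0 h1
    simp only [lambdaVec, Fin.zero_eta, Matrix.cons_val_zero]
    rw [abs_le] at k1 k2 ⊢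
    constructor <;> nlinarith
  · obtain ⟨k1, k2⟩ := key _ _ (G x 1 0) (G x 0 0) h0 h1
    simp only [lambdaVec, Fin.mk_one, Matrix.cons_val_one, Matrix.cons_val_zero]
    rw [abs_le] at k1 k2 ⊢
    constructor <;> nlinarith

lemma lam_int {Ω : Set R2} (hΩb : Bornology.IsBounded Ω) {u : R2 → R2} {G : R2 → Matrix (Fin 2) (Fin 2) ℝ}
    (hu : MemW11 Ω u G) (hS : SphereValued Ω u) (j : Fin 2) : IntegrableOn (fun x => lambdaVec u G x j) Ω := by
  refine Integrable.mono' (HH_int hΩb hu) ?_ (hS.mono fun x hx => lam_le u G x hx j)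
  have m := fun i => (coord_integrable hu.1 i).aestronglyMeasurable
  have mG := fun i j => (hu.2.1 i j).aestronglyMeasurable
  fin_cases j
  · simp only [lambdaVec, Fin.zero_eta, Matrix.cons_val_zero]
    exact (((m 0).neg.mul (mG 1 1)).add ((m 1).mul (mG 0 1))).const_mul _
  · simp only [lambdaVec, Fin.mk_one, Matrix.cons_val_one, Matrix.cons_val_zero]
    exact (((m 0).mul (mG 1 0)).sub ((m 1).mul (mG 0 0))).const_mul _

lemma fd_le_on {Ω : Set R2} (hΩo : IsOpen Ω) {φ : R2 → ℝ} {L : ℝ≥0} (hφ : LipschitzOnWith L φ (closure Ω)) {x : R2} (hx : x ∈ Ω) (j : Fin 2) :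
    |fderiv ℝ φ x (ee j)| ≤ L := by
  have h := (fderiv ℝ φ x).le_opNorm (ee j)
  have h2 := norm_fderiv_le_of_lipschitzOn ℝ (mem_of_superset (hΩo.mem_nhds hx) subset_closure) hφ
  have h3 : ‖ee j‖ = 1 := by simp [ee]
  rw [h3, mul_one] at h
  exact h.trans h2

lemma pair_int {Ω : Set R2} (hΩo : IsOpen Ω) (hΩb : Bornology.IsBounded Ω) {u : R2 → R2} {G : R2 → Matrix (Fin 2) (Fin 2) ℝ}
    (hu : MemW11 Ω u G) (hS : SphereValued Ω u) {φ : R2 → ℝ} {L : ℝ≥0} (hφ : LipschitzOnWith L φ (closure Ω)) (j : Fin 2) :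
    IntegrableOn (fun x => lambdaVec u G x j * fderiv ℝ φ x (ee j)) Ω :=
  (lam_int hΩb hu hS j).mul_bdd (c := L) (fd_meas φ _).aestronglyMeasurable
    (ae_restrict_of_forall_mem hΩo.measurableSet fun _ hx => fd_le_on hΩo hφ hx j)

lemma lip0_bound {Ω : Set R2} (hΩo : IsOpen Ω) (hΩb : Bornology.IsBounded Ω) {φ : R2 → ℝ} {L : ℝ≥0}
    (hφ : LipschitzOnWith L φ (closure Ω)) (h0 : ∀ p ∈ frontier Ω, φ p = 0) {x : R2} (hx : x ∈ Ω) :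
    |φ x| ≤ L * infDist x Ωᶜ := by
  have hne : Ω ≠ univ := by
    rintro rfl
    exact NormedSpace.unbounded_univ ℝ R2 hΩb
  obtain ⟨z, hz, hz2⟩ := exists_mem_frontier_infDist_compl_eq_dist hx hne
  rw [hz2]
  have := hφ.dist_le_mul x (subset_closure hx) z (frontier_subset_closure hz)
  rwa [h0 z hz, Real.dist_eq, sub_zero] at this

lemma lip0_approx {Ω : Set R2} (hΩo : IsOpen Ω) (hΩb : Bornology.IsBounded Ω) {φ : R2 → ℝ} {L : ℝ≥0}
    (hφ : LipschitzOnWith L φ (closure Ω)) (h0 : ∀ p ∈ frontier Ω, φ p = 0) :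
    ∃ (M : ℝ≥0) (ψ : ℕ → R2 → ℝ), (∀ k, LipschitzWith M (ψ k) ∧ HasCompactSupport (ψ k) ∧ tsupport (ψ k) ⊆ Ω) ∧
      ∀ x ∈ Ω, ∀ᶠ k in atTop, ψ k =ᶠ[𝓝 x] φ := by
  have hne : (Ωᶜ).Nonempty := by
    rw [nonempty_compl]
    rintro rfl
    exact NormedSpace.unbounded_univ ℝ R2 hΩb
  obtain ⟨g, hg, hgφ⟩ := hφ.extend_real
  set K : ℝ := 2 * (L + 1) with hK
  set d : R2 → ℝ := fun x => infDist x Ωᶜ with hd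
  have dpos : ∀ x, 0 < d x → x ∈ Ω := by
    intro x hx
    by_contra h
    simp [hd, infDist_zero_of_mem (show x ∈ Ωᶜ from h)] at hx
  have dL : LipschitzWith 1 d := lipschitz_infDist_pt _
  set h : ℕ → R2 → ℝ := fun k x => K * max (d x - 1 / ((k:ℝ) + 1)) 0 with hh
  have hKp : 0 < K := by positivity
  have hL : ∀ k, LipschitzWith (‖K‖₊ * 1) (h k) := by
    intro k
    have e1 : LipschitzWith 1 (fun x => d x - 1 / ((k:ℝ) + 1)) := by
      intro x y
      rw [edist_sub_right]
      exact dL x y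
    have := (lipschitzWith_smul K).comp (e1.max_const 0)
    exact this
  have hnn : ∀ k x, 0 ≤ h k x := fun k x => by positivity
  refine ⟨max (‖K‖₊ * 1) (max (‖K‖₊ * 1) L), fun k x => max (-h k x) (min (h k x) (g x)), fun k => ?_, fun x hx => ?_⟩
  · have sub : tsupport (fun x => max (-h k x) (min (h k x) (g x))) ⊆ {x | 1 / ((k:ℝ) + 1) ≤ d x} := by
      refine closure_minimal ?_ (isClosed_le continuous_const dL.continuous)
      intro x hx
      by_contra hc
      apply hx
      simp only [mem_ofPred_eq, not_le] at hc
      have : h k x = 0 := by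
        simp only [hh]
        rw [max_eq_right (by linarith), mul_zero]
      simp [this]
    have sub2 : tsupport (fun x => max (-h k x) (min (h k x) (g x))) ⊆ Ω := fun x hx =>
      dpos x (lt_of_lt_of_le (by positivity) (sub hx))
    refine ⟨(hL k).neg.max ((hL k).min hg), ?_, sub2⟩
    exact isCompact_of_isClosed_isBounded (isClosed_tsupport _) (hΩb.subset sub2)
  · have hdx : 0 < d x := (hΩo.isClosed_compl.notMem_iff_infDist_pos hne).1 (by simpa using hx)
    have t : Tendsto (fun k : ℕ => 2 * (1 / ((k:ℝ) + 1))) atTop (𝓝 (2 * 0)) := tendsto_one_div_add_atTop_nhds_zero_nat.const_mul 2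
    rw [mul_zero] at t
    filter_upwards [t.eventually (gt_mem_nhds hdx)] with k hk
    filter_upwards [dL.continuous.continuousAt.eventually (lt_mem_nhds hk), hΩo.mem_nhds hx] with y hy hyΩ
    have b := lip0_bound hΩo hΩb hφ h0 hyΩ
    have e : g y = φ y := (hgφ (subset_closure hyΩ)).symm
    have hb : |φ y| ≤ h k y := by
      refine b.trans ?_
      simp only [hh]
      have p : 0 < 1 / ((k:ℝ) + 1) := by positivity
      rw [max_eq_left (by linarith)]
      have Ln : (0:ℝ) ≤ L := L.2
      change L * d y ≤ _
      nlinarith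
    rw [abs_le] at hb
    rw [e, min_eq_right hb.2, max_eq_right hb.1]

lemma det_lip0 {Ω : Set R2} (hΩo : IsOpen Ω) (hΩb : Bornology.IsBounded Ω) {w : R2 → ℂ} (hw : GoodMap Ω w)
    (σ : R2 → Bool) (c : R2 → ℝ) (r : ℝ) (hr : 0 < r) (hv : ∀ a ∈ {x ∈ Ω | w x = 0}, 0 < c a ∧ closedBall a r ⊆ Ω ∧
      (∀ z ∈ ball a r, w z = (c a : ℂ) * tau (σ a) (z - a)) ∧ ∀ b ∈ {x ∈ Ω | w x = 0}, a ≠ b → Disjoint (closedBall a r) (closedBall b r))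
    (φ : R2 → ℝ) (hφ : MemLip0 Ω φ) :
    detPairing Ω (Pu w) (PG w) φ = ∑ a ∈ hw.fin.toFinset, Real.pi * (sg (σ a) * φ a) := by
  obtain ⟨⟨L, hL⟩, h0⟩ := hφ
  obtain ⟨M, ψ, hψ, hev⟩ := lip0_approx hΩo hΩb hL h0
  have hW := good_w11 hΩo hΩb hw
  have hSp := good_sphere hΩo hw
  have T1 : Tendsto (fun k => detPairing Ω (Pu w) (PG w) (ψ k)) atTop (𝓝 (detPairing Ω (Pu w) (PG w) φ)) := by
    refine tendsto_integral_of_dominated_convergence (fun x => ∑ j, |lambdaVec (Pu w) (PG w) x j| * M) ?_ ?_ ?_ ?_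
    · intro k
      exact (integrable_finsetSum _ fun j _ => pair_int hΩo hΩb hW hSp ((hψ k).1.lipschitzOnWith) j).aestronglyMeasurable
    · exact integrable_finsetSum _ fun j _ => (lam_int hΩb hW hSp j).abs.mul_const _
    · intro k
      refine ae_of_all _ fun x => ?_
      refine (norm_sum_le _ _).trans (Finset.sum_le_sum fun j _ => ?_)
      rw [norm_mul]
      exact mul_le_mul_of_nonneg_left (fd_le (hψ k).1 x j) (abs_nonneg _)
    · refine ae_restrict_of_forall_mem hΩo.measurableSet fun x hx => ?_
      refine Tendsto.congr' ?_ tendsto_const_nhds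
      filter_upwards [hev x hx] with k hk
      rw [hk.fderiv_eq]
  have T2 : Tendsto (fun k => detPairing Ω (Pu w) (PG w) (ψ k)) atTop (𝓝 (∑ a ∈ hw.fin.toFinset, Real.pi * (sg (σ a) * φ a))) := by
    have e : (fun k => detPairing Ω (Pu w) (PG w) (ψ k)) = fun k => ∑ a ∈ hw.fin.toFinset, Real.pi * (sg (σ a) * ψ k a) := by
      funext k
      exact det_compact hΩo hΩb hw σ c r hr hv (ψ k) M (hψ k).1 (hψ k).2.1 (hψ k).2.2
    rw [e]
    refine tendsto_finsetSum _ fun a ha => ?_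
    refine Tendsto.congr' ?_ tendsto_const_nhds
    have haΩ : a ∈ Ω := ((Set.Finite.mem_toFinset _).1 ha).1
    filter_upwards [hev a haΩ] with k hk
    rw [hk.eq_of_nhds]
  exact tendsto_nhds_unique T1 T2
end

open MeasureTheory Metric Filter Set
open scoped ENNReal NNReal Topology Classical ContDiff Manifold Convolution
noncomputable section

lemma HH_ge (G : R2 → Matrix (Fin 2) (Fin 2) ℝ) (x : R2) : 1 ≤ HH G x ∧ ∀ i j, |G x i j| ≤ HH G x := by
  have n00 := abs_nonneg (G x 0 0)
  have n01 := abs_nonneg (G x 0 1)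
  have n10 := abs_nonneg (G x 1 0)
  have n11 := abs_nonneg (G x 1 1)
  simp only [HH, Fin.sum_univ_two]
  refine ⟨by linarith, fun i j => ?_⟩
  fin_cases i <;> fin_cases j <;> simp only [Fin.zero_eta, Fin.mk_one] <;> linarith

lemma DD_nonneg' (u : R2 → R2) (G : R2 → Matrix (Fin 2) (Fin 2) ℝ) (w : R2 → ℂ) (x : R2) : 0 ≤ DD u G w x := by
  have := (HH_ge G x).1
  unfold DD
  positivity

lemma DD_intOn {Ω : Set R2} (hΩb : Bornology.IsBounded Ω) {u : R2 → R2} {G : R2 → Matrix (Fin 2) (Fin 2) ℝ}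
    (hu : MemW11 Ω u G) {w : R2 → ℂ} (hw : GoodMap Ω w) (h : ∫⁻ x in Ω, ENNReal.ofReal (DD u G w x) < ⊤) :
    IntegrableOn (DD u G w) Ω := by
  refine ⟨?_, (hasFiniteIntegral_iff_ofReal (ae_of_all _ (DD_nonneg' u G w))).2 h⟩
  have mH := (HH_int hΩb hu).aestronglyMeasurable
  have m := fun i => (coord_integrable hu.1 i).aestronglyMeasurable
  have mG := fun i j => (hu.2.1 i j).aestronglyMeasurable
  have mP : ∀ i, Measurable (fun x => Pu w x i) := fun i => (coord_meas i).comp (Pu_meas hw.smooth)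
  have mPG := fun i j => PG_meas hw.smooth i j
  have t1 : ∀ i, AEStronglyMeasurable (fun x => HH G x * |Pu w x i - u x i|) (volume.restrict Ω) := fun i =>
    mH.mul (((mP i).aestronglyMeasurable.sub (m i)).norm)
  have t2 : ∀ i j, AEStronglyMeasurable (fun x => |PG w x i j - G x i j|) (volume.restrict Ω) := fun i j =>
    ((mPG i j).aestronglyMeasurable.sub (mG i j)).norm
  have e : DD u G w = fun x => (HH G x * |Pu w x 0 - u x 0| + HH G x * |Pu w x 1 - u x 1|) +
      ((|PG w x 0 0 - G x 0 0| + |PG w x 0 1 - G x 0 1|) + (|PG w x 1 0 - G x 1 0| + |PG w x 1 1 - G x 1 1|)) := by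
    funext x
    simp only [DD, Fin.sum_univ_two]
  rw [e]
  exact ((t1 0).add (t1 1)).add (((t2 0 0).add (t2 0 1)).add ((t2 1 0).add (t2 1 1)))

lemma norm_le_DD (u : R2 → R2) (G : R2 → Matrix (Fin 2) (Fin 2) ℝ) (w : R2 → ℂ) (x : R2) :
    ‖u x - Pu w x‖ + frob (G x - PG w x) ≤ DD u G w x := by
  have h1 := (HH_ge G x).1
  refine add_le_add ?_ ?_
  · have e : ‖u x - Pu w x‖ ≤ ∑ i, |Pu w x i - u x i| := by
      rw [EuclideanSpace.norm_eq]
      apply Real.sqrt_le_iff.2 ⟨by positivity, ?_⟩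
      simp only [Fin.sum_univ_two, PiLp.sub_apply, Real.norm_eq_abs, abs_sub_comm (u x _)]
      nlinarith [abs_nonneg (Pu w x 0 - u x 0), abs_nonneg (Pu w x 1 - u x 1),
        mul_nonneg (abs_nonneg (Pu w x 0 - u x 0)) (abs_nonneg (Pu w x 1 - u x 1))]
    refine e.trans (Finset.sum_le_sum fun i _ => ?_)
    exact le_mul_of_one_le_left (abs_nonneg _) h1
  · unfold frob
    apply Real.sqrt_le_iff.2 ⟨by positivity, ?_⟩
    simp only [Fin.sum_univ_two, Matrix.sub_apply]
    have key : ∀ a b c d : ℝ, a^2+b^2+(c^2+d^2) ≤ (|a|+|b|+(|c|+|d|))^2 := by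
      intro a b c d
      rw [← sq_abs a, ← sq_abs b, ← sq_abs c, ← sq_abs d]
      have := abs_nonneg a
      have := abs_nonneg b
      have := abs_nonneg c
      have := abs_nonneg d
      have : 0 ≤ |a| * |b| + |a| * |c| + |a| * |d| + |b| * |c| + |b| * |d| + |c| * |d| := by positivity
      nlinarith
    have := key (G x 0 0 - PG w x 0 0) (G x 0 1 - PG w x 0 1) (G x 1 0 - PG w x 1 0) (G x 1 1 - PG w x 1 1)
    simpa only [abs_sub_comm (G x _ _)] using this

lemma lam_diff_le (u : R2 → R2) (G : R2 → Matrix (Fin 2) (Fin 2) ℝ) (w : R2 → ℂ) (x : R2) (j : Fin 2) :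
    |lambdaVec u G x j - lambdaVec (Pu w) (PG w) x j| ≤ DD u G w x := by
  have key : ∀ i k j, |u x i * G x k j - Pu w x i * PG w x k j| ≤ HH G x * |Pu w x i - u x i| + |PG w x k j - G x k j| := by
    intro i k j
    have : u x i * G x k j - Pu w x i * PG w x k j = -(G x k j * (Pu w x i - u x i)) - Pu w x i * (PG w x k j - G x k j) := by ring
    rw [this]
    refine (abs_sub _ _).trans ?_
    rw [abs_neg, abs_mul, abs_mul]
    refine add_le_add (mul_le_mul_of_nonneg_right ((HH_ge G x).2 k j) (abs_nonneg _)) ?_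
    exact mul_le_of_le_one_left (abs_nonneg _) (abs_Pu_le w x i)
  have hH := (HH_ge G x).1
  have p : ∀ i, 0 ≤ HH G x * |Pu w x i - u x i| := fun i => by positivity
  have p0 := p 0
  have p1 := p 1
  have n00 := abs_nonneg (PG w x 0 0 - G x 0 0)
  have n01 := abs_nonneg (PG w x 0 1 - G x 0 1)
  have n10 := abs_nonneg (PG w x 1 0 - G x 1 0)
  have n11 := abs_nonneg (PG w x 1 1 - G x 1 1)
  simp only [DD, Fin.sum_univ_two]
  fin_cases j
  · have k1 := key 0 1 1
    have k2 := key 1 0 1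
    simp only [lambdaVec, Fin.zero_eta, Matrix.cons_val_zero]
    rw [abs_le] at k1 k2 ⊢
    constructor <;> linarith
  · have k1 := key 0 1 0
    have k2 := key 1 0 0
    simp only [lambdaVec, Fin.mk_one, Matrix.cons_val_one, Matrix.cons_val_zero]
    rw [abs_le] at k1 k2 ⊢
    constructor <;> linarith

lemma flat_le {Ω : Set R2} (hΩo : IsOpen Ω) (hΩb : Bornology.IsBounded Ω) {u : R2 → R2} {G : R2 → Matrix (Fin 2) (Fin 2) ℝ}
    (hu : MemW11 Ω u G) (hS : SphereValued Ω u) {w : R2 → ℂ} (hw : GoodMap Ω w) (hD : IntegrableOn (DD u G w) Ω) :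
    flatNorm Ω 1 (fun φ => detPairing Ω u G φ - detPairing Ω (Pu w) (PG w) φ) ≤ ENNReal.ofReal (2 * ∫ x in Ω, DD u G w x) := by
  refine iSup₂_le fun φ hφ => ENNReal.ofReal_le_ofReal ?_
  obtain ⟨hL, -, -⟩ := hφ
  have i1 := integrable_finsetSum Finset.univ fun j _ => pair_int hΩo hΩb hu hS hL j
  have i2 := integrable_finsetSum Finset.univ fun j _ => pair_int hΩo hΩb (good_w11 hΩo hΩb hw) (good_sphere hΩo hw) hL j
  unfold detPairing
  dsimp only
  rw [← integral_sub i1 i2, ← integral_const_mul]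
  refine (le_abs_self _).trans ?_
  rw [← Real.norm_eq_abs]
  refine norm_integral_le_of_norm_le (hD.const_mul 2) ?_
  refine ae_restrict_of_forall_mem hΩo.measurableSet fun x hx => ?_
  have q : ∀ j, |lambdaVec u G x j * fderiv ℝ φ x (ee j) - lambdaVec (Pu w) (PG w) x j * fderiv ℝ φ x (ee j)| ≤ DD u G w x := by
    intro j
    rw [← sub_mul, abs_mul]
    have h1 := fd_le_on hΩo hL hx j
    rw [NNReal.coe_one] at h1
    exact (mul_le_of_le_one_right (abs_nonneg _) h1).trans (lam_diff_le u G w x j)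
  rw [← Finset.sum_sub_distrib, Fin.sum_univ_two, two_mul]
  refine (norm_add_le (_ : ℝ) _).trans ?_
  exact add_le_add (q 0) (q 1)

lemma conjPt_smul (t : ℝ) (v : R2) : conjPt (t • v) = t • conjPt v := by
  ext i
  fin_cases i <;> simp [conjPt]

lemma toC_conj (v : R2) : toC.symm (starRingEnd ℂ (toC v)) = conjPt v := by
  ext i
  fin_cases i
  · simp [conjPt, symm_toC_0, toC_re]
  · simp [conjPt, symm_toC_1, toC_im]

lemma Pu_scale (w : R2 → ℂ) (z : R2) (c : ℝ) (hc : 0 < c) (ζ : ℂ) (h : w z = (c:ℂ) * ζ) : Pu w z = ‖ζ‖⁻¹ • toC.symm ζ := by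
  rw [Pu, h]
  have : (c:ℂ) * ζ = c • ζ := by simp
  rw [this, map_smul, norm_smul, smul_smul, Real.norm_of_nonneg hc.le, mul_inv]
  congr 1
  field_simp

lemma Pu_pos (w : R2 → ℂ) (z a : R2) (c : ℝ) (hc : 0 < c) (h : w z = (c:ℂ) * tau true (z - a)) : Pu w z = ‖z - a‖⁻¹ • (z - a) := by
  rw [Pu_scale w z c hc _ h, LinearIsometryEquiv.norm_map]
  simp [tau]

lemma Pu_neg (w : R2 → ℂ) (z a : R2) (c : ℝ) (hc : 0 < c) (h : w z = (c:ℂ) * tau false (z - a)) : Pu w z = conjPt (‖z - a‖⁻¹ • (z - a)) := by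
  rw [Pu_scale w z c hc _ h, LinearIsometryEquiv.norm_map, conjPt_smul, ← toC_conj]
  simp [tau]

lemma sum_pts {n : ℕ} (q : Fin n → R2) (σ : R2 → Bool) (b : R2) (Ω : Set R2) (hb : b ∉ Ω)
    (s : Fin n ⊕ Fin n) (hs : Sum.elim (fun i => if σ (q i) then q i else b) (fun i => if σ (q i) then b else q i) s ∈ Ω) :
    Sum.elim (fun i => if σ (q i) then q i else b) (fun i => if σ (q i) then b else q i) s = q (Sum.elim id id s) ∧
      s = if σ (q (Sum.elim id id s)) then Sum.inl (Sum.elim id id s) else Sum.inr (Sum.elim id id s) := by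
  rcases s with i | i
  · by_cases h : σ (q i) = true
    · simp [h]
    · simp [h, hb] at hs
  · by_cases h : σ (q i) = true
    · simp [h, hb] at hs
    · simp [h]

lemma frontier_ne {Ω : Set R2} (hΩb : Bornology.IsBounded Ω) (hne : Ω.Nonempty) : (frontier Ω).Nonempty := by
  rw [nonempty_frontier_iff]
  refine ⟨hne, ?_⟩
  rintro rfl
  exact NormedSpace.unbounded_univ ℝ R2 hΩb

/-- **Proposition 5.1 (density in `W^{1,1}(Ω;S¹)`).** Every `u ∈ W^{1,1}(Ω;S¹)` can be
approximated in `W^{1,1}` and in flat norm by maps whose Jacobian is a finite sum of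
dipoles with distinct, non-collinear interior points, which are standard vortices near
those points. -/
theorem density_in_flat_norm (Ω : Set R2) (hΩo : IsOpen Ω)
    (hΩb : Bornology.IsBounded Ω) (hΩc : IsConnected Ω) (hΩl : HasLipschitzBoundary Ω)
    (u : R2 → R2) (G : R2 → Matrix (Fin 2) (Fin 2) ℝ)
    (hu : MemW11 Ω u G) (hS : SphereValued Ω u) :
    ∀ ε : ℝ, 0 < ε →
      ∃ (uε : R2 → R2) (Gε : R2 → Matrix (Fin 2) (Fin 2) ℝ) (nε : ℕ)
        (x y : Fin nε → R2),
        MemW11 Ω uε Gε ∧ SphereValued Ω uε ∧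
        (∀ i, x i ∈ closure Ω ∧ y i ∈ closure Ω) ∧
        (∀ φ : R2 → ℝ, MemLip0 Ω φ →
          detPairing Ω uε Gε φ = Real.pi * ∑ i, (φ (x i) - φ (y i))) ∧
        InteriorPointsGeneric Ω x y ∧
        (∃ ρ : Fin nε ⊕ Fin nε → ℝ, (∀ a, 0 < ρ a ∧ ρ a < ε) ∧ VortexAt Ω uε x y ρ) ∧
        ENNReal.ofReal (∫ z in Ω, (‖u z - uε z‖ + frob (G z - Gε z))) +
            flatNorm Ω 1 (fun φ => detPairing Ω u G φ - detPairing Ω uε Gε φ) <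
          ENNReal.ofReal ε := by
  intro ε hε
  have hε4 : 0 < ENNReal.ofReal (ε / 4) := ENNReal.ofReal_pos.2 (by positivity)
  obtain ⟨w, hw, hlt, hStd, hGen⟩ := propB Ω hΩo hΩb hΩl u G hu hS (ENNReal.ofReal (ε / 4)) hε4
  obtain ⟨σ, c, r, hr, hrε, hv⟩ := vortex_data hΩo hw hStd ε hε
  obtain ⟨b, hb⟩ := frontier_ne hΩb hΩc.nonempty
  have hbΩ : b ∉ Ω := by
    rw [hΩo.frontier_eq] at hb
    exact hb.2
  have hbc : b ∈ closure Ω := frontier_subset_closure hb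
  set e := hw.fin.toFinset.equivFin.symm with he
  set q : Fin hw.fin.toFinset.card → R2 := fun i => (e i : R2) with hqdef
  have hqi : Function.Injective q := Subtype.val_injective.comp e.injective
  have hqZ : ∀ i, q i ∈ {x ∈ Ω | w x = 0} := fun i => (Set.Finite.mem_toFinset _).1 (e i).2
  have hpts := sum_pts q σ b Ω hbΩ
  set x : Fin hw.fin.toFinset.card → R2 := fun i => if σ (q i) then q i else b with hx
  set y : Fin hw.fin.toFinset.card → R2 := fun i => if σ (q i) then b else q i with hy
  have hne : ∀ s t : Fin hw.fin.toFinset.card ⊕ Fin hw.fin.toFinset.card, Sum.elim x y s ∈ Ω → Sum.elim x y t ∈ Ω → s ≠ t →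
      Sum.elim x y s ≠ Sum.elim x y t := by
    intro s t hs ht hst h
    apply hst
    rw [(hpts s hs).1, (hpts t ht).1] at h
    rw [(hpts s hs).2, (hpts t ht).2, hqi h]
  have hZ : ∀ s, Sum.elim x y s ∈ Ω → Sum.elim x y s ∈ {x ∈ Ω | w x = 0} := by
    intro s hs
    rw [(hpts s hs).1]
    exact hqZ _
  refine ⟨Pu w, PG w, hw.fin.toFinset.card, x, y, good_w11 hΩo hΩb hw, good_sphere hΩo hw, ?_, ?_, ?_, ?_, ?_⟩
  · intro i
    have := subset_closure (hqZ i).1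
    simp only [hx, hy]
    split_ifs
    · exact ⟨this, hbc⟩
    · exact ⟨hbc, this⟩
  · intro φ hφ
    rw [det_lip0 hΩo hΩb hw σ c r hr hv φ hφ, ← Finset.mul_sum]
    congr 1
    rw [← Finset.sum_coe_sort, ← Equiv.sum_comp e]
    refine Finset.sum_congr rfl fun i _ => ?_
    have h0 := hφ.2 b hb
    simp only [hx, hy, sg, hqdef]
    split_ifs <;> simp [h0]
  · refine ⟨hne, fun s t v hs ht hv' hst hsv htv => ?_⟩
    exact hGen _ (hZ s hs) _ (hZ t ht) _ (hZ v hv') (hne s t hs ht hst) (hne s v hs hv' hsv) (hne t v ht hv' htv)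
  · refine ⟨fun _ => r, fun _ => ⟨hr, hrε⟩, ?_, ?_, ?_, ?_⟩
    · intro s hs
      exact (hv _ (hZ s hs)).2.1
    · intro s t hst hs ht
      exact (hv _ (hZ s hs)).2.2.2 _ (hZ t ht) (hne s t hs ht hst)
    · intro i hi
      refine ae_restrict_of_forall_mem measurableSet_ball fun z hz => ?_
      have hσ : σ (q i) = true := by
        by_contra h
        simp [hx, h, hbΩ] at hi
      have hxi : x i = q i := by simp [hx, hσ]
      rw [hxi] at hz ⊢
      have := (hv _ (hqZ i)).2.2.1 z hz
      rw [hσ] at this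
      exact Pu_pos w z _ _ (hv _ (hqZ i)).1 this
    · intro i hi
      refine ae_restrict_of_forall_mem measurableSet_ball fun z hz => ?_
      have hσ : σ (q i) = false := by
        by_contra h
        rw [Bool.not_eq_false] at h
        simp [hy, h, hbΩ] at hi
      have hyi : y i = q i := by simp [hy, hσ]
      rw [hyi] at hz ⊢
      have := (hv _ (hqZ i)).2.2.1 z hz
      rw [hσ] at this
      exact Pu_neg w z _ _ (hv _ (hqZ i)).1 this
  · have hD := DD_intOn hΩb hu hw (hlt.trans ENNReal.ofReal_lt_top)
    have hI := ofReal_integral_eq_lintegral_ofReal hD (ae_of_all _ (DD_nonneg' u G w))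
    rw [← hI] at hlt
    have hI2 : ∫ z in Ω, DD u G w z < ε / 4 := (ENNReal.ofReal_lt_ofReal_iff (by positivity)).1 hlt
    have hI0 : 0 ≤ ∫ z in Ω, DD u G w z := integral_nonneg (DD_nonneg' u G w)
    have b1 : ∫ z in Ω, (‖u z - Pu w z‖ + frob (G z - PG w z)) ≤ ∫ z in Ω, DD u G w z :=
      integral_mono_of_nonneg (ae_of_all _ fun z => add_nonneg (norm_nonneg _) (Real.sqrt_nonneg _)) hD (ae_of_all _ (norm_le_DD u G w))
    calc _ ≤ ENNReal.ofReal (∫ z in Ω, DD u G w z) + ENNReal.ofReal (2 * ∫ z in Ω, DD u G w z) :=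
          add_le_add (ENNReal.ofReal_le_ofReal b1) (flat_le hΩo hΩb hu hS hw hD)
      _ = ENNReal.ofReal ((∫ z in Ω, DD u G w z) + 2 * ∫ z in Ω, DD u G w z) := by
          rw [← ENNReal.ofReal_add hI0 (by positivity)]
      _ < ENNReal.ofReal ε := (ENNReal.ofReal_lt_ofReal_iff hε).2 (by linarith)
end
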